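/- arXiv:2012.05666 — 5 statements merged into one kernel-verified Lean document; each statement's English description precedes it below -/
import Mathlib

section
/- For every α ∈ (0,1], m > 0 and l > m − 1/α, one has x · E_{α,m,l}(−x) → Γ(1 + α(l+1−m)) / Γ(1 + α(l−m)) as x → +∞; that is, E_{α,m,l}(−x) is asymptotically equivalent to Γ(1 + α(l+1−m)) / (Γ(1 + α(l−m)) x) as x → +∞. -/
open Filter

/-- The Kilbas-Saigo function `E_{α,m,l}(x)` for real argument. -/
noncomputable def kilbasSaigo (α m l : ℝ) (x : ℝ) : ℝ :=
  ∑' n : ℕ, (∏ k ∈ Finset.range n,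
    Real.Gamma (1 + α * (k * m + l)) / Real.Gamma (1 + α * (k * m + l + 1))) * x ^ n


section KSBeta
open MeasureTheory Set

theorem ks_beta {p q : ℝ} (hp : 0 < p) (hq : 0 < q) :
    IntegrableOn (fun t : ℝ => t ^ (p - 1) * (1 - t) ^ (q - 1)) (Ioo 0 1) ∧
    ∫ t in Ioo (0:ℝ) 1, t ^ (p - 1) * (1 - t) ^ (q - 1) =
      Real.Gamma p * Real.Gamma q / Real.Gamma (p + q) := by
  have hc := Complex.betaIntegral_convergent (u := (p:ℂ)) (v := (q:ℂ)) (by simpa) (by simpa)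
  rw [intervalIntegrable_iff_integrableOn_Ioo_of_le zero_le_one] at hc
  have he : EqOn (fun x : ℝ => (x:ℂ) ^ ((p:ℂ) - 1) * (1 - (x:ℂ)) ^ ((q:ℂ) - 1))
      (fun t : ℝ => ((t ^ (p - 1) * (1 - t) ^ (q - 1) : ℝ) : ℂ)) (Ioo 0 1) := by
    intro t ht
    simp only
    rw [Complex.ofReal_mul, Complex.ofReal_cpow ht.1.le, Complex.ofReal_cpow (by linarith [ht.2])]
    push_cast
    rfl
  have hc2 := hc.congr_fun he measurableSet_Ioo
  have hc3 : IntegrableOn (fun t : ℝ => t ^ (p - 1) * (1 - t) ^ (q - 1)) (Ioo 0 1) := by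
    have := hc2.re
    simp only [RCLike.re_eq_complex_re, Complex.ofReal_re] at this
    exact this
  refine ⟨hc3, ?_⟩
  have h1 := ProbabilityTheory.beta_eq_betaIntegralReal p q hp hq
  rw [Complex.betaIntegral, intervalIntegral.integral_of_le zero_le_one,
    integral_Ioc_eq_integral_Ioo, setIntegral_congr_fun measurableSet_Ioo he,
    integral_complex_ofReal, Complex.ofReal_re] at h1
  rw [← h1, ProbabilityTheory.beta]

theorem ks_one_sub_rpow_le {t r : ℝ} (ht : t ∈ Ioo (0:ℝ) 1) (hr : 0 ≤ r) :
    0 ≤ 1 - t ^ r ∧ 1 - t ^ r ≤ (1 + r) * (1 - t) := by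
  constructor
  · linarith [Real.rpow_le_one ht.1.le ht.2.le hr]
  · rcases le_total r 1 with h | h
    · have := Real.rpow_le_rpow_of_exponent_ge ht.1 ht.2.le h
      rw [Real.rpow_one] at this
      nlinarith [ht.2]
    · have := one_add_mul_self_le_rpow_one_add (s := t - 1) (by linarith [ht.1]) h
      rw [add_sub_cancel] at this
      nlinarith [ht.2]

theorem ks_levy_integrable {a v r : ℝ} (ha1 : a < 1) (hv : 0 < v) (hr : 0 ≤ r) :
    IntegrableOn (fun t : ℝ => t ^ (v - 1) * (1 - t) ^ (-a - 1) * (1 - t ^ r)) (Ioo 0 1) := by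
  have hb := (ks_beta hv (q := 1 - a) (by linarith)).1.const_mul (1 + r)
  refine Integrable.mono' hb ?_ ?_
  · exact Measurable.aestronglyMeasurable (by fun_prop)
  · refine (ae_restrict_iff' measurableSet_Ioo).2 (Eventually.of_forall fun t ht => ?_)
    have h1 := ks_one_sub_rpow_le ht hr
    have h2 : 0 < 1 - t := by linarith [ht.2]
    have e : (1 - t) ^ (1 - a - 1) = (1 - t) ^ (-a - 1) * (1 - t) := by
      rw [← Real.rpow_add_one h2.ne']; congr 1; ring
    have p1 : 0 < t ^ (v - 1) := Real.rpow_pos_of_pos ht.1 _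
    have p2 : 0 < (1 - t) ^ (-a - 1) := Real.rpow_pos_of_pos h2 _
    rw [Real.norm_of_nonneg (mul_nonneg (mul_pos p1 p2).le h1.1), e]
    calc _ ≤ t ^ (v - 1) * (1 - t) ^ (-a - 1) * ((1 + r) * (1 - t)) := by
            gcongr; exact h1.2
      _ = _ := by ring

theorem ks_levy_integral {a u r : ℝ} (ha0 : 0 < a) (ha1 : a < 1) (hu : 0 < u) (hr : 0 ≤ r) :
    ∫ t in Ioo (0:ℝ) 1, t ^ (u + a - 1) * (1 - t) ^ (-a - 1) * (1 - t ^ r) =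
      Real.Gamma (1 - a) / a *
        (Real.Gamma (u + r + a) / Real.Gamma (u + r) - Real.Gamma (u + a) / Real.Gamma u) := by
  set v := u + a with hv
  have hv0 : 0 < v := by positivity
  obtain ⟨i1, e1⟩ := ks_beta (p := v) (q := 1 - a) (by positivity) (by linarith)
  obtain ⟨i2, e2⟩ := ks_beta (p := v + r) (q := 1 - a) (by positivity) (by linarith)
  have i3 := ks_levy_integrable ha1 hv0 hr
  -- derivative of W
  let W : ℝ → ℝ := fun t => (t ^ v * (1 - t ^ r)) * (1 - t) ^ (-a)
  let W' : ℝ → ℝ := fun t => (v - a) * (t ^ (v - 1) * (1 - t) ^ (1 - a - 1))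
    - (v + r - a) * (t ^ (v + r - 1) * (1 - t) ^ (1 - a - 1))
    + a * (t ^ (v - 1) * (1 - t) ^ (-a - 1) * (1 - t ^ r))
  have hd : ∀ t ∈ Ioo (0:ℝ) 1, HasDerivAt W (W' t) t := by
    intro t ht
    have h2 : 0 < 1 - t := by linarith [ht.2]
    have d1 := Real.hasDerivAt_rpow_const (x := t) (p := v) (Or.inl ht.1.ne')
    have d2 := Real.hasDerivAt_rpow_const (x := t) (p := r) (Or.inl ht.1.ne')
    have d3 := ((hasDerivAt_id t).const_sub 1).rpow_const (p := -a) (Or.inl h2.ne')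
    have d := (d1.mul (d2.const_sub 1)).mul d3
    refine d.congr_deriv ?_
    simp only [W', id, Pi.mul_apply]
    have x1 : t ^ v = t ^ (v - 1) * t := by rw [← Real.rpow_add_one ht.1.ne']; congr 1; ring
    have x2 : t ^ r = t ^ (r - 1) * t := by rw [← Real.rpow_add_one ht.1.ne']; congr 1; ring
    have x3 : t ^ (v + r - 1) = t ^ (v - 1) * t ^ (r - 1) * t := by
      rw [← Real.rpow_add ht.1, ← Real.rpow_add_one ht.1.ne']; congr 1; ring
    have x4 : (1 - t) ^ (1 - a - 1) = (1 - t) ^ (-a - 1) * (1 - t) := by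
      rw [← Real.rpow_add_one h2.ne']; congr 1; ring
    have x5 : (1 - t) ^ (-a) = (1 - t) ^ (-a - 1) * (1 - t) := by
      rw [← Real.rpow_add_one h2.ne']; congr 1; ring
    rw [x1, x2, x3, x4, x5]
    ring
  have j1 := i1.const_mul (v - a)
  have j2 := i2.const_mul (v + r - a)
  have j3 := i3.const_mul a
  have hint : IntegrableOn W' (Ioo 0 1) := (j1.sub j2).add j3
  have hftc := intervalIntegral.integral_eq_sub_of_hasDerivAt_of_tendsto (f := W) (f' := W')
    (fa := 0) (fb := 0) zero_lt_one hd
    ((intervalIntegrable_iff_integrableOn_Ioo_of_le zero_le_one).2 hint) ?_ ?_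
  · rw [intervalIntegral.integral_of_le zero_le_one, integral_Ioc_eq_integral_Ioo] at hftc
    have hs : ∫ t in Ioo (0:ℝ) 1, W' t = (v - a) * (Real.Gamma v * Real.Gamma (1 - a) / Real.Gamma (v + (1 - a)))
      - (v + r - a) * (Real.Gamma (v + r) * Real.Gamma (1 - a) / Real.Gamma (v + r + (1 - a)))
      + a * ∫ t in Ioo (0:ℝ) 1, t ^ (v - 1) * (1 - t) ^ (-a - 1) * (1 - t ^ r) := by
      rw [← e1, ← e2, ← integral_const_mul, ← integral_const_mul, ← integral_const_mul,
        ← integral_sub j1 j2]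
      exact integral_add (j1.sub j2) j3
    rw [hs] at hftc
    have g1 : Real.Gamma (v + (1 - a)) = u * Real.Gamma u := by
      rw [← Real.Gamma_add_one hu.ne']; congr 1; rw [hv]; ring
    have g2 : Real.Gamma (v + r + (1 - a)) = (u + r) * Real.Gamma (u + r) := by
      rw [← Real.Gamma_add_one (by positivity)]; congr 1; rw [hv]; ring
    have g3 : v - a = u := by rw [hv]; ring
    have g4 : v + r - a = u + r := by rw [hv]; ring
    have g5 : u + r + a = v + r := by rw [hv]; ring
    rw [g1, g2, g3, g4] at hftc
    rw [g5]
    have n1 := (Real.Gamma_pos_of_pos hu).ne'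
    have n2 := (Real.Gamma_pos_of_pos (show 0 < u + r by positivity)).ne'
    have n3 : u + r ≠ 0 := by positivity
    have : u * (Real.Gamma v * Real.Gamma (1 - a) / (u * Real.Gamma u)) =
      Real.Gamma (1 - a) * (Real.Gamma v / Real.Gamma u) := by field_simp
    rw [this] at hftc
    have : (u + r) * (Real.Gamma (v + r) * Real.Gamma (1 - a) / ((u + r) * Real.Gamma (u + r))) =
      Real.Gamma (1 - a) * (Real.Gamma (v + r) / Real.Gamma (u + r)) := by field_simp
    rw [this] at hftc
    rw [div_mul_eq_mul_div, eq_div_iff ha0.ne']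
    linarith
  · have c1 : ContinuousAt (fun t : ℝ => t ^ v * (1 - t) ^ (-a)) 0 := by
      refine (Real.continuousAt_rpow_const _ _ (Or.inr hv0.le)).mul ?_
      exact ContinuousAt.rpow_const (by fun_prop) (Or.inl (by norm_num))
    have c2 : Tendsto (fun t : ℝ => t ^ v * (1 - t) ^ (-a)) (nhdsWithin 0 (Ioi 0)) (nhds 0) := by
      have := c1.tendsto
      simp only [Real.zero_rpow hv0.ne', zero_mul] at this
      exact this.mono_left nhdsWithin_le_nhds
    have hmem : Ioo (0:ℝ) 1 ∈ nhdsWithin (0:ℝ) (Ioi 0) := Ioo_mem_nhdsGT zero_lt_one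
    refine squeeze_zero' ?_ ?_ c2
    · filter_upwards [hmem] with t ht
      have := Real.rpow_le_one ht.1.le ht.2.le hr
      have h2 : 0 < 1 - t := by linarith [ht.2]
      exact mul_nonneg (mul_nonneg (Real.rpow_nonneg ht.1.le _) (by linarith)) (Real.rpow_nonneg h2.le _)
    · filter_upwards [hmem] with t ht
      have h2 : 0 < 1 - t := by linarith [ht.2]
      have h3 := Real.rpow_nonneg ht.1.le r
      refine mul_le_mul_of_nonneg_right ?_ (Real.rpow_nonneg h2.le _)
      exact mul_le_of_le_one_right (Real.rpow_nonneg ht.1.le _) (by linarith)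
  · have c1 : ContinuousAt (fun t : ℝ => (1 + r) * (1 - t) ^ (1 - a)) 1 := by
      refine continuousAt_const.mul ?_
      exact ContinuousAt.rpow_const (by fun_prop) (Or.inr (by linarith))
    have c2 : Tendsto (fun t : ℝ => (1 + r) * (1 - t) ^ (1 - a)) (nhdsWithin 1 (Iio 1)) (nhds 0) := by
      have := c1.tendsto
      simp only [sub_self, Real.zero_rpow (show 1 - a ≠ 0 by linarith), mul_zero] at this
      exact this.mono_left nhdsWithin_le_nhds
    have hmem : Ioo (0:ℝ) 1 ∈ nhdsWithin (1:ℝ) (Iio 1) := Ioo_mem_nhdsLT zero_lt_one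
    refine squeeze_zero' ?_ ?_ c2
    · filter_upwards [hmem] with t ht
      have := Real.rpow_le_one ht.1.le ht.2.le hr
      have h2 : 0 < 1 - t := by linarith [ht.2]
      exact mul_nonneg (mul_nonneg (Real.rpow_nonneg ht.1.le _) (by linarith)) (Real.rpow_nonneg h2.le _)
    · filter_upwards [hmem] with t ht
      have h2 : 0 < 1 - t := by linarith [ht.2]
      have h3 := ks_one_sub_rpow_le ht hr
      have x : (1 - t) ^ (1 - a) = (1 - t) * (1 - t) ^ (-a) := by
        rw [sub_eq_add_neg 1 a, Real.rpow_add h2, Real.rpow_one]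
      rw [x, ← mul_assoc]
      refine mul_le_mul_of_nonneg_right ?_ (Real.rpow_nonneg h2.le _)
      refine le_trans (mul_le_of_le_one_left h3.1 ?_) h3.2
      exact Real.rpow_le_one ht.1.le ht.2.le hv0.le

theorem ks_gamma_lower {a y : ℝ} (ha0 : 0 < a) (hy : 1 < y) :
    (y - 1) ^ a ≤ Real.Gamma (y + a) / Real.Gamma y := by
  have h := Real.convexOn_log_Gamma.slope_mono_adjacent (x := y - 1) (y := y) (z := y + a)
    (by simp only [mem_Ioi]; linarith) (by simp only [mem_Ioi]; linarith) (by linarith) (by linarith)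
  have p1 : 0 < y - 1 := by linarith
  have g0 := Real.Gamma_pos_of_pos p1
  have g1 : 0 < Real.Gamma y := Real.Gamma_pos_of_pos (by linarith)
  have g2 : 0 < Real.Gamma (y + a) := Real.Gamma_pos_of_pos (by linarith)
  have e : Real.Gamma y = (y - 1) * Real.Gamma (y - 1) := by
    rw [← Real.Gamma_add_one p1.ne']; congr 1; ring
  have e2 : Real.log (Real.Gamma y) - Real.log (Real.Gamma (y-1)) = Real.log (y - 1) := by
    rw [e, Real.log_mul p1.ne' g0.ne']; ring
  simp only [Function.comp] at h
  rw [e2, sub_sub_cancel, div_one, add_sub_cancel_left, le_div_iff₀ ha0, ← Real.log_div g2.ne' g1.ne'] at h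
  rw [← Real.log_le_log_iff (by positivity) (by positivity), Real.log_rpow p1]
  linarith

end KSBeta

section KSAbstract
open MeasureTheory Set

/-- Alternating exponential generating function of a shifted sequence. -/
noncomputable def ksF (M : ℕ → ℝ) (n : ℕ) (x : ℝ) : ℝ :=
  ∑' k : ℕ, M (k + n) * (-x) ^ k / (k.factorial : ℝ)

theorem ks_pos_of_no_first_zero {f : ℝ → ℝ} (hf : Continuous f) (h0 : 0 < f 0)
    (h : ∀ x, 0 < x → (∀ y, 0 ≤ y → y < x → 0 < f y) → f x = 0 → False) :
    ∀ x, 0 ≤ x → 0 < f x := by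
  intro x hx
  by_contra hneg
  push Not at hneg
  have hK : IsCompact (Icc 0 x ∩ f ⁻¹' Iic 0) :=
    isCompact_Icc.inter_right (isClosed_Iic.preimage hf)
  obtain ⟨z, ⟨⟨hz0, hzx⟩, hz⟩, hleast⟩ := hK.exists_isLeast ⟨x, ⟨hx, le_rfl⟩, hneg⟩
  have hbefore : ∀ y, 0 ≤ y → y < z → 0 < f y := by
    intro y hy hyz
    by_contra hc
    push Not at hc
    exact absurd (hleast ⟨⟨hy, hyz.le.trans hzx⟩, hc⟩) (not_le.2 hyz)
  have hz0' : 0 < z := by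
    rcases hz0.eq_or_lt with h | h
    · rw [← h] at hz; exact absurd h0 (not_lt.2 hz)
    · exact h
  have : 0 ≤ f z := by
    have ht : Tendsto f (nhdsWithin z (Iio z)) (nhds (f z)) :=
      hf.continuousAt.tendsto.mono_left nhdsWithin_le_nhds
    refine ge_of_tendsto ht ?_
    filter_upwards [Ioo_mem_nhdsLT hz0'] with y hy
    exact (hbefore y hy.1.le hy.2).le
  exact h z hz0' hbefore (le_antisymm hz this)

theorem ks_deriv_nonpos_of_left_pos {f : ℝ → ℝ} {f' x : ℝ} (hx : 0 < x) (hd : HasDerivAt f f' x)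
    (h : ∀ y, 0 ≤ y → y < x → 0 < f y) (h0 : f x = 0) : f' ≤ 0 := by
  have ht := (hasDerivWithinAt_iff_tendsto_slope' (s := Iio x) (by simp)).1 hd.hasDerivWithinAt
  refine le_of_tendsto ht ?_
  filter_upwards [Ioo_mem_nhdsLT hx] with y hy
  rw [slope_def_field, h0]
  have := h y hy.1.le hy.2
  exact div_nonpos_of_nonneg_of_nonpos (by linarith) (by linarith [hy.2])

variable {M φ : ℕ → ℝ}

theorem ks_M_pos (hM0 : M 0 = 1) (hφ : ∀ n, 0 < φ n)
    (hrec : ∀ n, φ (n + 1) * M (n + 1) = (n + 1) * M n) (n : ℕ) : 0 < M n := by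
  induction n with
  | zero => rw [hM0]; exact one_pos
  | succ n ih =>
    have h1 : 0 < φ (n + 1) * M (n + 1) := by rw [hrec]; positivity
    exact (pos_iff_pos_of_mul_pos h1).1 (hφ _)

theorem ks_summable (hM : ∀ n, 0 < M n) (hφt : Tendsto φ atTop atTop)
    (hrec : ∀ n, φ (n + 1) * M (n + 1) = (n + 1) * M n) (n : ℕ) (x : ℝ) :
    Summable fun k : ℕ => M (k + n) * x ^ k / (k.factorial : ℝ) := by
  refine summable_of_ratio_norm_eventually_le (r := 1 / 2) (by norm_num) ?_
  have ht : Tendsto (fun k : ℕ => φ (k + n + 1)) atTop atTop := by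
    have := hφt.comp (tendsto_add_atTop_nat (n + 1))
    exact this
  filter_upwards [ht.eventually_ge_atTop (2 * (n + 1) * |x| + 1)] with k hk
  have hp : 0 < φ (k + n + 1) := lt_of_lt_of_le (by positivity) hk
  have hr := hrec (k + n)
  have e : M (k + 1 + n) = ((k:ℝ) + n + 1) * M (k + n) / φ (k + n + 1) := by
    rw [eq_div_iff hp.ne', show k + 1 + n = k + n + 1 by ring, mul_comm, hr]; push_cast; ring
  have hMk := hM (k + n)
  rw [Real.norm_eq_abs, Real.norm_eq_abs, abs_div, abs_div, abs_mul, abs_mul, abs_of_pos (hM _), abs_of_pos hMk,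
    Nat.abs_cast, Nat.abs_cast, abs_pow, abs_pow, e, Nat.factorial_succ, pow_succ]
  push_cast
  have hk0 : (0:ℝ) ≤ k := Nat.cast_nonneg k
  have hn0 : (0:ℝ) ≤ n := Nat.cast_nonneg n
  have key : ((k:ℝ) + n + 1) * |x| / (φ (k + n + 1) * (k + 1)) ≤ 1 / 2 := by
    rw [div_le_iff₀ (by positivity)]
    have : (2 * (n + 1) * |x|) * (k + 1) ≤ φ (k + n + 1) * (k + 1) := by gcongr; linarith
    have h3 : ((k:ℝ) + n + 1) * |x| ≤ ((n + 1) * (k + 1)) * |x| := by gcongr; nlinarith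
    linarith
  have hf : (0:ℝ) < (k.factorial : ℝ) := by positivity
  calc _ = ((k:ℝ) + n + 1) * |x| / (φ (k + n + 1) * (k + 1)) * (M (k + n) * |x| ^ k / (k.factorial : ℝ)) := by
        field_simp
    _ ≤ _ := by gcongr

theorem ks_hasSum_mul {n : ℕ} {x : ℝ}
    (hs : ∀ (n : ℕ) (x : ℝ), Summable fun k : ℕ => M (k + n) * x ^ k / (k.factorial : ℝ)) :
    HasSum (fun k : ℕ => (k:ℝ) * (M (k + n) * x ^ k / (k.factorial : ℝ)))
      (x * ∑' k : ℕ, M (k + (n + 1)) * x ^ k / (k.factorial : ℝ)) := by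
  rw [← hasSum_nat_add_iff' 1]
  simp only [Finset.range_one, Finset.sum_singleton, Nat.cast_zero, zero_mul, sub_zero]
  have := (hs (n + 1) x).hasSum.mul_left x
  refine this.congr_fun ?_
  intro k
  have hf : ((k.factorial : ℝ)) ≠ 0 := by positivity
  rw [Nat.factorial_succ, show k + 1 + n = k + (n + 1) by ring]
  push_cast
  have : (k:ℝ) + 1 ≠ 0 := by positivity
  field_simp
  ring

theorem ks_hasDerivAt (hM : ∀ n, 0 < M n)
    (hs : ∀ (n : ℕ) (x : ℝ), Summable fun k : ℕ => M (k + n) * x ^ k / (k.factorial : ℝ))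
    (n : ℕ) (x : ℝ) : HasDerivAt (ksF M n) (-(ksF M (n + 1) x)) x := by
  have hbound : Summable (fun k : ℕ => M (k + n) * ((k:ℝ) * (|x| + 1) ^ (k - 1)) / (k.factorial : ℝ)) := by
    have h := (ks_hasSum_mul (n := n) (x := |x| + 1) hs).summable.mul_left (|x| + 1)⁻¹
    refine h.congr ?_
    intro k
    cases k with
    | zero => simp
    | succ k =>
      have : |x| + 1 ≠ 0 := by positivity
      simp only [Nat.add_sub_cancel]
      field_simp
      ring
  have hd := hasDerivAt_tsum_of_isPreconnected (𝕜 := ℝ)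
    (g := fun k y => M (k + n) * (-y) ^ k / (k.factorial : ℝ))
    (g' := fun k y => M (k + n) * (-((k:ℝ) * (-y) ^ (k - 1))) / (k.factorial : ℝ))
    (t := Metric.ball 0 (|x| + 1)) (y₀ := 0) (y := x) hbound Metric.isOpen_ball
    (convex_ball _ _).isPreconnected ?_ ?_ ?_ ?_ ?_
  · refine hd.congr_deriv ?_
    rw [ksF, ← tsum_neg, ((hs (n + 1) (-x)).hasSum.neg.congr_fun (f := fun k : ℕ => -(M (k + (n + 1)) * (-x) ^ k / (k.factorial : ℝ))) (fun _ => rfl)).tsum_eq]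
    refine HasSum.tsum_eq ?_
    rw [← hasSum_nat_add_iff' 1]
    simp only [Finset.range_one, Finset.sum_singleton, Nat.cast_zero, zero_mul, neg_zero, mul_zero, zero_div, sub_zero]
    refine (hs (n + 1) (-x)).hasSum.neg.congr_fun ?_
    intro k
    have hf : ((k.factorial : ℝ)) ≠ 0 := by positivity
    rw [Nat.factorial_succ, show k + 1 + n = k + (n + 1) by ring]
    push_cast
    have : (k:ℝ) + 1 ≠ 0 := by positivity
    field_simp
  · intro k y hy
    have h1 := ((hasDerivAt_neg y).pow k).const_mul (M (k + n)) |>.div_const (k.factorial : ℝ)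
    refine h1.congr_deriv ?_
    ring
  · intro k y hy
    have hy' : |y| ≤ |x| + 1 := by
      have := mem_ball_zero_iff.1 hy
      exact this.le
    rw [Real.norm_eq_abs, abs_div, abs_mul, abs_of_pos (hM _), Nat.abs_cast, abs_neg, abs_mul,
      Nat.abs_cast, abs_pow, abs_neg]
    have := hM (k + n)
    gcongr
  · simp; positivity
  · simpa using hs n 0
  · simp

variable {μ : Measure ℝ} {w s : ℝ → ℝ} {L d : ℝ}

theorem ks_int_aux (hw : AEMeasurable w μ) (hsm : AEMeasurable s μ) (hw0 : ∀ᵐ t ∂μ, 0 ≤ w t)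
    (hs01 : ∀ᵐ t ∂μ, s t ∈ Ioo (0:ℝ) 1) (hi : Integrable (fun t => w t * (1 - s t)) μ) (n : ℕ) :
    Integrable (fun t => w t * (1 - s t ^ n)) μ ∧ 0 ≤ ∫ t, w t * (1 - s t ^ n) ∂μ ∧
    ∫ t, w t * (1 - s t ^ n) ∂μ ≤ n * ∫ t, w t * (1 - s t) ∂μ := by
  have hb : ∀ᵐ t ∂μ, 0 ≤ w t * (1 - s t ^ n) ∧ w t * (1 - s t ^ n) ≤ n * (w t * (1 - s t)) := by
    filter_upwards [hw0, hs01] with t h1 h2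
    have h3 := pow_le_one₀ (n := n) h2.1.le h2.2.le
    have h4 := one_add_mul_le_pow (a := s t - 1) (by linarith [h2.1]) n
    rw [add_sub_cancel] at h4
    constructor
    · exact mul_nonneg h1 (by linarith)
    · nlinarith
  have hint : Integrable (fun t => w t * (1 - s t ^ n)) μ := by
    refine Integrable.mono' (hi.const_mul n) ?_ ?_
    · exact (hw.mul ((hsm.pow_const n).const_sub 1)).aestronglyMeasurable
    · filter_upwards [hb] with t ht
      rw [Real.norm_of_nonneg ht.1]; exact ht.2
  refine ⟨hint, integral_nonneg_of_ae (hb.mono fun t ht => ht.1), ?_⟩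
  rw [← integral_const_mul]
  exact integral_mono_ae hint (hi.const_mul _) (hb.mono fun t ht => ht.2)

theorem ks_eq (hM : ∀ n, 0 < M n)
    (hs : ∀ (n : ℕ) (x : ℝ), Summable fun k : ℕ => M (k + n) * x ^ k / (k.factorial : ℝ))
    (hw : AEMeasurable w μ) (hsm : AEMeasurable s μ) (hw0 : ∀ᵐ t ∂μ, 0 ≤ w t)
    (hs01 : ∀ᵐ t ∂μ, s t ∈ Ioo (0:ℝ) 1) (hi : Integrable (fun t => w t * (1 - s t)) μ)
    (hφ : ∀ n : ℕ, φ n = L + d * n + ∫ t, w t * (1 - s t ^ n) ∂μ) (n : ℕ) (x : ℝ) :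
    HasSum (fun k : ℕ => φ (k + n) * (M (k + n) * (-x) ^ k / (k.factorial : ℝ)))
      (L * ksF M n x + d * (n * ksF M n x - x * ksF M (n + 1) x)
        + ∫ t, w t * (ksF M n x - s t ^ n * ksF M n (x * s t)) ∂μ) := by
  have A : HasSum (fun k : ℕ => M (k + n) * (-x) ^ k / (k.factorial : ℝ)) (ksF M n x) :=
    (hs n (-x)).hasSum
  have B : HasSum (fun k : ℕ => (k:ℝ) * (M (k + n) * (-x) ^ k / (k.factorial : ℝ)))
      (-x * ksF M (n + 1) x) := ks_hasSum_mul hs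
  have C : HasSum (fun k : ℕ => ∫ t, (M (k + n) * (-x) ^ k / (k.factorial : ℝ)) * (w t * (1 - s t ^ (k + n))) ∂μ)
      (∫ t, ∑' k : ℕ, (M (k + n) * (-x) ^ k / (k.factorial : ℝ)) * (w t * (1 - s t ^ (k + n))) ∂μ) := by
    refine hasSum_integral_of_summable_integral_norm ?_ ?_
    · intro k
      exact (ks_int_aux hw hsm hw0 hs01 hi (k + n)).1.const_mul _
    · have S1 := (hs n |x|).mul_left (n * ∫ t, w t * (1 - s t) ∂μ)
      have S2 := (ks_hasSum_mul (n := n) (x := |x|) hs).summable.mul_left (∫ t, w t * (1 - s t) ∂μ)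
      refine Summable.of_nonneg_of_le (fun k => integral_nonneg fun t => norm_nonneg _) ?_ (S1.add S2)
      intro k
      obtain ⟨h1, h2, h3⟩ := ks_int_aux hw hsm hw0 hs01 hi (k + n)
      have : ∫ t, ‖(M (k + n) * (-x) ^ k / (k.factorial : ℝ)) * (w t * (1 - s t ^ (k + n)))‖ ∂μ
          = (M (k + n) * |x| ^ k / (k.factorial : ℝ)) * ∫ t, w t * (1 - s t ^ (k + n)) ∂μ := by
        rw [← integral_const_mul]
        refine integral_congr_ae ?_
        filter_upwards [hw0, hs01] with t ht1 ht2
        have h3 := pow_le_one₀ (n := k + n) ht2.1.le ht2.2.le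
        rw [norm_mul, Real.norm_of_nonneg (mul_nonneg ht1 (by linarith)), Real.norm_eq_abs, abs_div,
          abs_mul, abs_of_pos (hM _), abs_pow, abs_neg, Nat.abs_cast]
      rw [this]
      have hnn : 0 ≤ M (k + n) * |x| ^ k / (k.factorial : ℝ) := by
        have := hM (k + n); positivity
      refine (mul_le_mul_of_nonneg_left h3 hnn).trans (le_of_eq ?_)
      push_cast
      ring
  have D : ∀ t, ∑' k : ℕ, (M (k + n) * (-x) ^ k / (k.factorial : ℝ)) * (w t * (1 - s t ^ (k + n)))
      = w t * (ksF M n x - s t ^ n * ksF M n (x * s t)) := by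
    intro t
    have A2 : HasSum (fun k : ℕ => M (k + n) * (-(x * s t)) ^ k / (k.factorial : ℝ)) (ksF M n (x * s t)) :=
      (hs n (-(x * s t))).hasSum
    have := (A.sub (A2.mul_left (s t ^ n))).mul_left (w t)
    refine (this.congr_fun ?_).tsum_eq
    intro k
    rw [show -(x * s t) = (-x) * s t by ring, mul_pow, pow_add]
    ring
  simp only [D] at C
  have T := ((A.mul_left L).add (((A.mul_left (n:ℝ)).add B).mul_left d)).add C
  rw [neg_mul, ← sub_eq_add_neg] at T
  refine T.congr_fun fun k => ?_
  rw [hφ, integral_const_mul]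
  push_cast
  ring

theorem ks_abstract (hM0 : M 0 = 1) (hL : 0 < L) (hd : 0 ≤ d) (hφt : Tendsto φ atTop atTop)
    (hrec : ∀ n, φ (n + 1) * M (n + 1) = (n + 1) * M n)
    (hw : AEMeasurable w μ) (hsm : AEMeasurable s μ) (hw0 : ∀ᵐ t ∂μ, 0 ≤ w t)
    (hs01 : ∀ᵐ t ∂μ, s t ∈ Ioo (0:ℝ) 1) (hi : Integrable (fun t => w t * (1 - s t)) μ)
    (hφ : ∀ n : ℕ, φ n = L + d * n + ∫ t, w t * (1 - s t ^ n) ∂μ) :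
    Tendsto (fun x => x * ksF M 0 x) atTop (nhds L) := by
  have hφpos : ∀ n, 0 < φ n := by
    intro n
    rw [hφ]
    have := (ks_int_aux hw hsm hw0 hs01 hi n).2.1
    positivity
  have hM := ks_M_pos hM0 hφpos hrec
  have hs := ks_summable hM hφt hrec
  have hD := ks_hasDerivAt hM hs
  have hE := ks_eq hM hs hw hsm hw0 hs01 hi hφ
  have hcont : ∀ n, Continuous (ksF M n) := fun n =>
    continuous_iff_continuousAt.2 fun x => (hD n x).continuousAt
  have hzero : ∀ n, ksF M n 0 = M n := by
    intro n
    rw [ksF, tsum_eq_single 0]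
    · simp
    · intro k hk; simp [hk]
  have hφ0 : φ 0 = L := by rw [hφ]; simp
  -- the two functional equations
  have E0 : ∀ x, L * ksF M 0 x - d * (x * ksF M 1 x)
        + ∫ t, w t * (ksF M 0 x - ksF M 0 (x * s t)) ∂μ = L - x * ksF M 0 x := by
    intro x
    have h1 := hE 0 x
    have h2 : HasSum (fun k : ℕ => φ (k + 0) * (M (k + 0) * (-x) ^ k / (k.factorial : ℝ)))
        (L - x * ksF M 0 x) := by
      rw [← hasSum_nat_add_iff' 1]
      simp only [Finset.range_one, Finset.sum_singleton, Nat.add_zero, pow_zero, Nat.factorial_zero,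
        Nat.cast_one, div_one, mul_one, hM0, hφ0]
      have A := (hs 0 (-x)).hasSum.mul_left (-x)
      have e : L - x * ksF M 0 x - L = -x * ksF M 0 x := by ring
      rw [e]
      refine A.congr_fun ?_
      intro k
      have hf : ((k.factorial : ℝ)) ≠ 0 := by positivity
      have : (k:ℝ) + 1 ≠ 0 := by positivity
      rw [mul_div_assoc, ← mul_assoc, hrec, Nat.factorial_succ]
      push_cast
      simp only [add_zero]
      field_simp
      ring
    have h3 := h1.unique h2
    simp only [pow_zero, one_mul, Nat.cast_zero, zero_mul, zero_sub, zero_add] at h3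
    linarith
  have E1 : ∀ n x, L * ksF M (n + 1) x + d * ((n + 1) * ksF M (n + 1) x - x * ksF M (n + 2) x)
        + ∫ t, w t * (ksF M (n + 1) x - s t ^ (n + 1) * ksF M (n + 1) (x * s t)) ∂μ
        = (n + 1) * ksF M n x - x * ksF M (n + 1) x := by
    intro n x
    have h1 := hE (n + 1) x
    have A : HasSum (fun k : ℕ => M (k + n) * (-x) ^ k / (k.factorial : ℝ)) (ksF M n x) :=
      (hs n (-x)).hasSum
    have B : HasSum (fun k : ℕ => (k:ℝ) * (M (k + n) * (-x) ^ k / (k.factorial : ℝ)))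
      (-x * ksF M (n + 1) x) := ks_hasSum_mul hs
    have h2 := (A.mul_left ((n:ℝ) + 1)).add B
    have h3 : HasSum (fun k : ℕ => φ (k + (n + 1)) * (M (k + (n + 1)) * (-x) ^ k / (k.factorial : ℝ)))
        ((n + 1) * ksF M n x + -x * ksF M (n + 1) x) := by
      refine h2.congr_fun ?_
      intro k
      have := hrec (k + n)
      rw [mul_div_assoc, ← mul_assoc, ← add_assoc, this]
      push_cast
      ring
    have h4 := h1.unique h3
    push_cast at h4
    linarith
  -- positivity
  have P0 : ∀ x, 0 ≤ x → 0 < ksF M 0 x := by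
    refine ks_pos_of_no_first_zero (hcont 0) (by rw [hzero]; exact hM 0) ?_
    intro x hx hb h0
    have e := E0 x
    have hd1 := ks_deriv_nonpos_of_left_pos hx (hD 0 x) hb h0
    have hint : ∫ t, w t * (ksF M 0 x - ksF M 0 (x * s t)) ∂μ ≤ 0 := by
      refine integral_nonpos_of_ae ?_
      filter_upwards [hw0, hs01] with t h1 h2
      have := hb (x * s t) (mul_nonneg hx.le h2.1.le) (mul_lt_of_lt_one_right hx h2.2)
      rw [h0]
      exact mul_nonpos_of_nonneg_of_nonpos h1 (by linarith)
    have : 0 ≤ d * (x * ksF M 1 x) := mul_nonneg hd (mul_nonneg hx.le (by simpa using hd1))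
    rw [h0] at e hint
    linarith
  have P1 : ∀ n, (∀ x, 0 ≤ x → 0 < ksF M n x) → ∀ x, 0 ≤ x → 0 < ksF M (n + 1) x := by
    intro n ih
    refine ks_pos_of_no_first_zero (hcont _) (by rw [hzero]; exact hM _) ?_
    intro x hx hb h0
    have e := E1 n x
    have hd1 := ks_deriv_nonpos_of_left_pos hx (hD (n + 1) x) hb h0
    have hint : ∫ t, w t * (ksF M (n + 1) x - s t ^ (n + 1) * ksF M (n + 1) (x * s t)) ∂μ ≤ 0 := by
      refine integral_nonpos_of_ae ?_
      filter_upwards [hw0, hs01] with t h1 h2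
      have := hb (x * s t) (mul_nonneg hx.le h2.1.le) (mul_lt_of_lt_one_right hx h2.2)
      have h3 : 0 ≤ s t ^ (n + 1) * ksF M (n + 1) (x * s t) := mul_nonneg (pow_nonneg h2.1.le _) this.le
      rw [h0]
      exact mul_nonpos_of_nonneg_of_nonpos h1 (by linarith)
    have : 0 ≤ d * (x * ksF M (n + 2) x) := mul_nonneg hd (mul_nonneg hx.le (by
      have : n + 1 + 1 = n + 2 := rfl
      rw [this] at hd1; linarith))
    have h5 : 0 < ((n:ℝ) + 1) * ksF M n x := mul_pos (by positivity) (ih x hx.le)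
    rw [h0] at e hint
    linarith
  have P1' := P1 0 P0
  have P2' := P1 1 P1'
  have anti : ∀ n, (∀ x, 0 ≤ x → 0 < ksF M (n + 1) x) → AntitoneOn (ksF M n) (Ici 0) := by
    intro n h
    refine antitoneOn_of_deriv_nonpos (convex_Ici 0) (hcont n).continuousOn
      (fun x _ => (hD n x).differentiableAt.differentiableWithinAt) ?_
    intro x hx
    rw [interior_Ici] at hx
    rw [(hD n x).deriv]
    linarith [h x (le_of_lt hx)]
  have A0 := anti 0 P1'
  have A1 := anti 1 P2'
  have le1 : ∀ x, 0 ≤ x → ksF M 0 x ≤ 1 := by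
    intro x hx
    have := A0 (mem_Ici.2 le_rfl) (mem_Ici.2 hx) hx
    rwa [hzero, hM0] at this
  -- mean value bounds
  have mvt : ∀ a b, 0 ≤ a → a < b → (b - a) * ksF M 1 b ≤ ksF M 0 a - ksF M 0 b ∧
      ksF M 0 a - ksF M 0 b ≤ (b - a) * ksF M 1 a := by
    intro a b ha hab
    obtain ⟨c, hc, he⟩ := exists_hasDerivAt_eq_slope (ksF M 0) (fun x => -(ksF M 1 x)) hab
      (hcont 0).continuousOn (fun x _ => hD 0 x)
    have hba : 0 < b - a := by linarith
    have he2 : ksF M 0 a - ksF M 0 b = (b - a) * ksF M 1 c := by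
      rw [eq_div_iff hba.ne'] at he
      linarith
    have c0 : 0 ≤ c := ha.trans hc.1.le
    rw [he2]
    exact ⟨mul_le_mul_of_nonneg_left (A1 c0 (c0.trans hc.2.le) hc.2.le) hba.le,
      mul_le_mul_of_nonneg_left (A1 ha c0 hc.1.le) hba.le⟩
  -- limit of F 0
  obtain ⟨ℓ, hℓ⟩ : ∃ ℓ, Tendsto (ksF M 0) atTop (nhds ℓ) := by
    have hanti : Antitone (fun x => ksF M 0 (max x 0)) := by
      intro a b hab
      exact A0 (mem_Ici.2 (le_max_right _ _)) (mem_Ici.2 (le_max_right _ _)) (max_le_max_right 0 hab)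
    have hb : BddBelow (range (fun x => ksF M 0 (max x 0))) :=
      ⟨0, by rintro _ ⟨x, rfl⟩; exact (P0 _ (le_max_right _ _)).le⟩
    refine ⟨_, (tendsto_atTop_ciInf hanti hb).congr' ?_⟩
    filter_upwards [eventually_ge_atTop 0] with x hx
    rw [max_eq_left hx]
  have T1 : Tendsto (fun x => x * ksF M 1 x) atTop (nhds 0) := by
    have h2 : Tendsto (fun x => 2 * (ksF M 0 (x / 2) - ksF M 0 x)) atTop (nhds 0) := by
      have := ((hℓ.comp (tendsto_id.atTop_div_const (show (0:ℝ) < 2 by norm_num))).sub hℓ).const_mul 2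
      simpa using this
    refine squeeze_zero' ?_ ?_ h2
    · filter_upwards [eventually_ge_atTop 0] with x hx
      exact mul_nonneg hx (P1' x hx).le
    · filter_upwards [eventually_gt_atTop 0] with x hx
      have := (mvt (x / 2) x (by linarith) (by linarith)).1
      linarith
  have T2 : Tendsto (fun x => ∫ t, w t * (ksF M 0 x - ksF M 0 (x * s t)) ∂μ) atTop (nhds 0) := by
    have := tendsto_integral_filter_of_dominated_convergence (μ := μ) (l := (atTop : Filter ℝ))
      (F := fun x t => w t * (ksF M 0 x - ksF M 0 (x * s t))) (f := fun _ => 0)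
      (fun t => 4 * (w t * (1 - s t))) ?_ ?_ (hi.const_mul 4) ?_
    · simpa using this
    · refine Eventually.of_forall fun x => ?_
      exact (hw.mul (((hcont 0).measurable.comp_aemeasurable (hsm.const_mul x)).const_sub _)).aestronglyMeasurable
    · filter_upwards [eventually_gt_atTop 0] with x hx
      filter_upwards [hw0, hs01] with t h1 h2
      have q0 : 0 < x * s t := mul_pos hx h2.1
      have q1 : x * s t < x := mul_lt_of_lt_one_right hx h2.2
      have r1 := (mvt (x * s t) x q0.le q1)
      have r2 := (mvt (x * s t / 2) (x * s t) (by linarith) (by linarith)).1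
      have r3 := le1 (x * s t / 2) (by linarith)
      have r4 := P0 (x * s t) q0.le
      have r5 := A0 (mem_Ici.2 q0.le) (mem_Ici.2 hx.le) q1.le
      have r6 := le1 (x * s t) q0.le
      have r7 := P0 x hx.le
      have r8 := P1' (x * s t) q0.le
      have key : ksF M 0 (x * s t) - ksF M 0 x ≤ 4 * (1 - s t) := by
        rcases le_total (s t) (1 / 2) with h | h
        · linarith
        · have : x * ksF M 1 (x * s t) ≤ 4 := by
            have : x * ksF M 1 (x * s t) * (1 / 2) ≤ x * ksF M 1 (x * s t) * s t :=
              mul_le_mul_of_nonneg_left h (mul_pos hx r8).le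
            nlinarith
          calc _ ≤ (x - x * s t) * ksF M 1 (x * s t) := r1.2
            _ = (1 - s t) * (x * ksF M 1 (x * s t)) := by ring
            _ ≤ (1 - s t) * 4 := mul_le_mul_of_nonneg_left this (by linarith [h2.2])
            _ = _ := by ring
      rw [norm_mul, Real.norm_of_nonneg h1, Real.norm_eq_abs, abs_sub_comm, abs_of_nonneg (by linarith)]
      calc _ ≤ w t * (4 * (1 - s t)) := mul_le_mul_of_nonneg_left key h1
        _ = _ := by ring
    · filter_upwards [hs01] with t h2
      have := (hℓ.sub (hℓ.comp (tendsto_id.atTop_mul_const h2.1))).const_mul (w t)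
      simpa using this
  -- conclusion
  have T3 : Tendsto (fun x => (L + x) * ksF M 0 x) atTop (nhds L) := by
    have := ((T1.const_mul d).const_add L).sub T2
    simp only [mul_zero, add_zero, sub_zero] at this
    refine this.congr fun x => ?_
    linarith [E0 x]
  have T4 : Tendsto (fun x : ℝ => x / (L + x)) atTop (nhds 1) := by
    have h : Tendsto (fun x : ℝ => 1 - L / (L + x)) atTop (nhds (1 - 0)) :=
      ((tendsto_atTop_add_const_left _ L tendsto_id).const_div_atTop L).const_sub 1
    rw [sub_zero] at h
    refine h.congr' ?_
    filter_upwards [eventually_gt_atTop 0] with x hx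
    have : L + x ≠ 0 := by positivity
    field_simp
    ring
  have T5 := T4.mul T3
  rw [one_mul] at T5
  refine T5.congr' ?_
  filter_upwards [eventually_gt_atTop 0] with x hx
  have : L + x ≠ 0 := by positivity
  field_simp

end KSAbstract

theorem kilbasSaigo_asymptotics_atTop (α m l : ℝ)
    (hα : α ∈ Set.Ioc (0 : ℝ) 1) (hm : 0 < m) (hl : m - 1 / α < l) :
    Tendsto (fun x : ℝ => x * kilbasSaigo α m l (-x)) atTop
      (nhds (Real.Gamma (1 + α * (l + 1 - m)) / Real.Gamma (1 + α * (l - m)))) := by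
  obtain ⟨hα0, hα1⟩ := hα
  obtain ⟨u, hu⟩ : ∃ u, u = 1 + α * (l - m) := ⟨_, rfl⟩
  have hu0 : 0 < u := by
    have h1 : α * (m - 1 / α) < α * l := mul_lt_mul_of_pos_left hl hα0
    have h2 : α * (1 / α) = 1 := by field_simp
    rw [hu]; linarith
  obtain ⟨κ, hκ⟩ : ∃ κ, κ = α * m := ⟨_, rfl⟩
  have hκ0 : 0 < κ := by rw [hκ]; positivity
  let φ : ℕ → ℝ := fun n => Real.Gamma (u + κ * n + α) / Real.Gamma (u + κ * n)
  let M : ℕ → ℝ := fun n => (n.factorial : ℝ) * ∏ k ∈ Finset.range n,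
    Real.Gamma (1 + α * (k * m + l)) / Real.Gamma (1 + α * (k * m + l + 1))
  have hF : ∀ x, kilbasSaigo α m l (-x) = ksF M 0 x := by
    intro x
    rw [kilbasSaigo, ksF]
    refine tsum_congr fun n => ?_
    have : (n.factorial : ℝ) ≠ 0 := by positivity
    simp only [M, Nat.add_zero]
    generalize (∏ k ∈ Finset.range n, Real.Gamma (1 + α * (k * m + l)) / Real.Gamma (1 + α * (k * m + l + 1))) = Q
    field_simp
  have hM0 : M 0 = 1 := by simp [M]
  have hrec : ∀ n, φ (n + 1) * M (n + 1) = (n + 1) * M n := by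
    intro n
    simp only [φ, M]
    rw [Finset.prod_range_succ, Nat.factorial_succ]
    have e1 : 1 + α * (n * m + l) = u + κ * ((n + 1 : ℕ) : ℝ) := by
      rw [hu, hκ]; push_cast; ring
    have e2 : 1 + α * (n * m + l + 1) = u + κ * ((n + 1 : ℕ) : ℝ) + α := by
      rw [hu, hκ]; push_cast; ring
    rw [e1, e2]
    have p1 : 0 < u + κ * ((n + 1 : ℕ) : ℝ) := by positivity
    have g1 := (Real.Gamma_pos_of_pos p1).ne'
    have g2 := (Real.Gamma_pos_of_pos (add_pos p1 hα0)).ne'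
    generalize Real.Gamma (u + κ * ((n + 1 : ℕ) : ℝ)) = G1 at g1 ⊢
    generalize Real.Gamma (u + κ * ((n + 1 : ℕ) : ℝ) + α) = G2 at g2 ⊢
    generalize (∏ k ∈ Finset.range n, Real.Gamma (1 + α * (k * m + l)) / Real.Gamma (1 + α * (k * m + l + 1))) = Q
    push_cast
    field_simp
  have hφt : Tendsto φ atTop atTop := by
    have h1 : Tendsto (fun n : ℕ => u - 1 + κ * (n : ℝ)) atTop atTop :=
      tendsto_atTop_add_const_left _ _ (tendsto_natCast_atTop_atTop.const_mul_atTop hκ0)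
    have h2 := (tendsto_rpow_atTop hα0).comp h1
    refine tendsto_atTop_mono' _ ?_ h2
    filter_upwards [h1.eventually_gt_atTop 0] with n hn
    have := ks_gamma_lower (a := α) (y := u + κ * n) hα0 (by linarith)
    simp only [Function.comp, φ]
    rwa [show u - 1 + κ * (n:ℝ) = u + κ * n - 1 by ring]
  have hL : 0 < Real.Gamma (u + α) / Real.Gamma u :=
    div_pos (Real.Gamma_pos_of_pos (by positivity)) (Real.Gamma_pos_of_pos hu0)
  rw [show 1 + α * (l + 1 - m) = u + α by rw [hu]; ring, ← hu]
  simp only [hF]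
  rcases hα1.eq_or_lt with h1 | h1
  · subst h1
    refine ks_abstract (μ := 0) (w := fun _ => 0) (s := fun _ => 0) (d := κ) hM0 hL hκ0.le hφt hrec
      (by fun_prop) (by fun_prop) (by simp) (by simp) (by simp) ?_
    intro n
    simp only [φ]
    have p : 0 < u + κ * (n:ℝ) := by positivity
    rw [Real.Gamma_add_one p.ne', Real.Gamma_add_one hu0.ne']
    have g1 := (Real.Gamma_pos_of_pos p).ne'
    have g2 := (Real.Gamma_pos_of_pos hu0).ne'
    rw [mul_div_assoc, div_self g1, mul_div_assoc, div_self g2]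
    simp
  · have hc : 0 < Real.Gamma (1 - α) := Real.Gamma_pos_of_pos (by linarith)
    have hv : 0 < u + α := by positivity
    refine ks_abstract (μ := MeasureTheory.volume.restrict (Set.Ioo (0:ℝ) 1))
      (w := fun t => α / Real.Gamma (1 - α) * (t ^ (u + α - 1) * (1 - t) ^ (-α - 1)))
      (s := fun t => t ^ κ) (d := 0) hM0 hL le_rfl hφt hrec
      (Measurable.aemeasurable (by fun_prop)) (Measurable.aemeasurable (by fun_prop)) ?_ ?_ ?_ ?_
    · refine (MeasureTheory.ae_restrict_iff' measurableSet_Ioo).2 (Eventually.of_forall fun t ht => ?_)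
      have h2 : 0 < 1 - t := by linarith [ht.2]
      have h3 := ht.1
      positivity
    · refine (MeasureTheory.ae_restrict_iff' measurableSet_Ioo).2 (Eventually.of_forall fun t ht => ?_)
      exact ⟨Real.rpow_pos_of_pos ht.1 _, Real.rpow_lt_one ht.1.le ht.2 hκ0⟩
    · simp only [mul_assoc (α / Real.Gamma (1 - α))]
      exact (ks_levy_integrable h1 hv hκ0.le).const_mul _
    · intro n
      have hr : 0 ≤ κ * (n:ℝ) := by positivity
      have e : ∫ t in Set.Ioo (0:ℝ) 1, α / Real.Gamma (1 - α) * (t ^ (u + α - 1) * (1 - t) ^ (-α - 1)) * (1 - (t ^ κ) ^ n)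
          = α / Real.Gamma (1 - α) * ∫ t in Set.Ioo (0:ℝ) 1, t ^ (u + α - 1) * (1 - t) ^ (-α - 1) * (1 - t ^ (κ * (n:ℝ))) := by
        rw [← MeasureTheory.integral_const_mul]
        refine MeasureTheory.setIntegral_congr_fun measurableSet_Ioo fun t ht => ?_
        rw [Real.rpow_mul ht.1.le, Real.rpow_natCast]
        ring
      rw [e, ks_levy_integral hα0 h1 hu0 hr]
      simp only [φ]
      field_simp
      ring
end

section
/- For every α ∈ (0,1), m > 0, one has x · E_{α,m,m−1}(−x) → 1/Γ(1−α) as x → +∞; that is, E_{α,m,m−1}(−x) is asymptotically equivalent to 1/(Γ(1−α) x) as x → +∞. -/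
open Filter

open MeasureTheory Set Topology

namespace KS

lemma one_sub_rpow_le {s y : ℝ} (hs0 : 0 < s) (hs1 : s < 1) (hy : 0 ≤ y) :
    1 - s ^ y ≤ (1 + y) * (1 - s) := by
  have h := one_add_mul_self_le_rpow_one_add (s := s - 1) (by linarith) (p := 1 + y) (by linarith)
  have h2 : (1 + (s - 1)) ^ (1 + y) ≤ s ^ y := by
    rw [show 1 + (s - 1) = s by ring]
    exact Real.rpow_le_rpow_of_exponent_ge hs0 hs1.le (by linarith)
  linarith

lemma kernel_eq {s α : ℝ} (hs1 : s < 1) :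
    (1 - s) * (1 - s) ^ (-α - 1) = (1 - s) ^ (-α) := by
  have : (0:ℝ) < 1 - s := by linarith
  rw [Real.rpow_sub_one this.ne']
  field_simp

lemma integrable_base {α : ℝ} (h1 : α < 1) :
    IntegrableOn (fun s : ℝ => (1 - s) ^ (-α)) (Ioo 0 1) := by
  have h := (intervalIntegral.intervalIntegrable_rpow' (a := 1) (b := 0) (r := -α) (by linarith)).comp_sub_left 1
  simp only [sub_self, sub_zero] at h
  exact ((intervalIntegrable_iff_integrableOn_Ioo_of_le zero_le_one).1 h)

lemma integrable_of_bound {α C : ℝ} (h1 : α < 1) {g : ℝ → ℝ}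
    (hg : ContinuousOn g (Ioo 0 1)) (hb : ∀ s ∈ Ioo (0:ℝ) 1, |g s| ≤ C * (1 - s)) :
    IntegrableOn (fun s : ℝ => g s * (1 - s) ^ (-α - 1)) (Ioo 0 1) := by
  refine Integrable.mono' ((integrable_base h1).const_mul C) ?_ ?_
  · refine ContinuousOn.aestronglyMeasurable (hg.mul ?_) measurableSet_Ioo
    intro s hs
    refine (ContinuousAt.rpow_const (by fun_prop) (Or.inl ?_)).continuousWithinAt
    linarith [hs.2]
  · refine ae_restrict_of_forall_mem measurableSet_Ioo fun s hs => ?_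
    have hp : 0 < (1 - s) ^ (-α - 1) := Real.rpow_pos_of_pos (by linarith [hs.2]) _
    rw [Real.norm_eq_abs, abs_mul, abs_of_pos hp, ← kernel_eq hs.2, ← mul_assoc]
    exact mul_le_mul_of_nonneg_right (hb s hs) hp.le

lemma abs_integral_le {α C : ℝ} (h1 : α < 1) {g : ℝ → ℝ}
    (hb : ∀ s ∈ Ioo (0:ℝ) 1, |g s| ≤ C * (1 - s)) :
    |∫ s in Ioo (0:ℝ) 1, g s * (1 - s) ^ (-α - 1)| ≤ C * ∫ s in Ioo (0:ℝ) 1, (1 - s) ^ (-α) := by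
  rw [← integral_const_mul, ← Real.norm_eq_abs]
  refine norm_integral_le_of_norm_le ((integrable_base h1).const_mul C) ?_
  refine ae_restrict_of_forall_mem measurableSet_Ioo fun s hs => ?_
  have hp : 0 < (1 - s) ^ (-α - 1) := Real.rpow_pos_of_pos (by linarith [hs.2]) _
  rw [Real.norm_eq_abs, abs_mul, abs_of_pos hp, ← kernel_eq hs.2, ← mul_assoc]
  exact mul_le_mul_of_nonneg_right (hb s hs) hp.le

lemma abs_one_sub_rpow_le {y s : ℝ} (hy : 0 ≤ y) (hs : s ∈ Ioo (0:ℝ) 1) :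
    |1 - s ^ y| ≤ (1 + y) * (1 - s) := by
  rw [abs_of_nonneg]
  · exact one_sub_rpow_le hs.1 hs.2 hy
  · linarith [Real.rpow_le_one hs.1.le hs.2.le hy]

lemma contOn_one_sub_rpow (y : ℝ) : ContinuousOn (fun s : ℝ => 1 - s ^ y) (Ioo 0 1) := by
  intro s hs
  exact (continuousAt_const.sub
    (Real.continuousAt_rpow_const s y (Or.inl hs.1.ne'))).continuousWithinAt

lemma beta_real {a b : ℝ} (ha : 0 < a) (hb : 0 < b) :
    IntegrableOn (fun s : ℝ => s ^ (a - 1) * (1 - s) ^ (b - 1)) (Ioo 0 1) ∧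
    ∫ s in Ioo (0:ℝ) 1, s ^ (a - 1) * (1 - s) ^ (b - 1) =
      Real.Gamma a * Real.Gamma b / Real.Gamma (a + b) := by
  have hc := Complex.betaIntegral_convergent (u := a) (v := b) (by simpa) (by simpa)
  rw [intervalIntegrable_iff_integrableOn_Ioo_of_le zero_le_one] at hc
  have heq : ∀ s ∈ Ioo (0:ℝ) 1, RCLike.re ((s:ℂ) ^ ((a:ℂ) - 1) * (1 - (s:ℂ)) ^ ((b:ℂ) - 1))
      = s ^ (a - 1) * (1 - s) ^ (b - 1) := by
    intro s hs
    norm_cast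
    rw [← Complex.ofReal_cpow hs.1.le, ← Complex.ofReal_cpow (by linarith [hs.2]), RCLike.re_to_complex,
        Complex.re_mul_ofReal, Complex.ofReal_re]
  constructor
  · exact IntegrableOn.congr_fun hc.re heq measurableSet_Ioo
  · have := ProbabilityTheory.beta_eq_betaIntegralReal a b ha hb
    rw [ProbabilityTheory.beta] at this
    rw [this, Complex.betaIntegral, intervalIntegral.integral_of_le zero_le_one,
      integral_Ioc_eq_integral_Ioo, ← RCLike.re_to_complex, ← integral_re hc]
    exact (setIntegral_congr_fun measurableSet_Ioo heq).symm

lemma J_value {α y : ℝ} (h1 : α < 1) (hy : 0 < y) :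
    1 + α * ∫ s in Ioo (0:ℝ) 1, (1 - s ^ y) * (1 - s) ^ (-α - 1) =
      Real.Gamma (1 - α) * (Real.Gamma (1 + y) / Real.Gamma (1 + y - α)) := by
  obtain ⟨hbi, hbv⟩ := beta_real hy (show 0 < 1 - α by linarith)
  rw [show 1 - α - 1 = -α by ring] at hbi hbv
  have hJ := integrable_of_bound h1 (contOn_one_sub_rpow y)
    (fun s hs => abs_one_sub_rpow_le hy.le hs)
  set F : ℝ → ℝ := fun s => (1 - s ^ y) * (1 - s) ^ (-α) with hF
  set F' : ℝ → ℝ := fun s => α * ((1 - s ^ y) * (1 - s) ^ (-α - 1)) -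
    y * (s ^ (y - 1) * (1 - s) ^ (-α)) with hF'
  have hint : IntegrableOn F' (Ioo 0 1) := (hJ.const_mul α).sub (hbi.const_mul y)
  have key : ∫ s in (0:ℝ)..1, F' s = 0 - 1 := by
    apply intervalIntegral.integral_eq_sub_of_hasDerivAt_of_tendsto (f := F) zero_lt_one
    · intro s hs
      have d1 : HasDerivAt (fun s : ℝ => 1 - s ^ y) (-(y * s ^ (y - 1))) s := by
        simpa using (Real.hasDerivAt_rpow_const (p := y) (Or.inl hs.1.ne')).const_sub 1
      have d2 : HasDerivAt (fun s : ℝ => (1 - s) ^ (-α)) ((-1) * (-α) * (1 - s) ^ (-α - 1)) s :=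
        ((hasDerivAt_id s).const_sub 1).rpow_const (p := -α) (Or.inl (by simp; linarith [hs.2]))
      refine (d1.mul d2).congr_deriv ?_
      simp only [hF']; ring
    · exact (intervalIntegrable_iff_integrableOn_Ioo_of_le zero_le_one).2 hint
    · have : ContinuousAt F 0 := by
        refine ContinuousAt.mul (continuousAt_const.sub
          (Real.continuousAt_rpow_const 0 y (Or.inr hy.le))) ?_
        exact ContinuousAt.rpow_const (by fun_prop) (Or.inl (by norm_num))
      have h := this.tendsto.mono_left (nhdsWithin_le_nhds (s := Ioi 0))
      simpa [hF, Real.zero_rpow hy.ne'] using h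
    · have hc : ContinuousAt (fun s : ℝ => (1 + y) * (1 - s) ^ (1 - α)) 1 :=
        continuousAt_const.mul (ContinuousAt.rpow_const (by fun_prop) (Or.inr (by linarith)))
      have h := hc.tendsto.mono_left (nhdsWithin_le_nhds (s := Iio 1))
      simp only [sub_self, Real.zero_rpow (show 1 - α ≠ 0 by linarith), mul_zero] at h
      refine squeeze_zero_norm' ?_ h
      filter_upwards [Ioo_mem_nhdsLT (zero_lt_one' ℝ)] with s hs
      have hp : 0 < (1 - s) ^ (-α) := Real.rpow_pos_of_pos (by linarith [hs.2]) _
      rw [hF, Real.norm_eq_abs, abs_mul, abs_of_pos hp,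
        show (1 - α) = 1 + (-α) by ring, Real.rpow_add (by linarith [hs.2]), Real.rpow_one, ← mul_assoc]
      exact mul_le_mul_of_nonneg_right (abs_one_sub_rpow_le hy.le hs) hp.le
  rw [intervalIntegral.integral_of_le zero_le_one, integral_Ioc_eq_integral_Ioo, hF',
    integral_sub (hJ.const_mul α) (hbi.const_mul y), integral_const_mul, integral_const_mul, hbv] at key
  rw [show 1 + y - α = y + (1 - α) by ring, add_comm 1 y, Real.Gamma_add_one hy.ne']
  linear_combination key


/-- Sum of a real power series. -/
noncomputable def P (b : ℕ → ℝ) (x : ℝ) : ℝ := ∑' n : ℕ, b n * x ^ n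

/-- Everywhere absolutely convergent power series. -/
def S (b : ℕ → ℝ) : Prop := ∀ R : ℝ, 0 ≤ R → Summable fun n : ℕ => |b n| * R ^ n

lemma S.summable {b : ℕ → ℝ} (h : S b) (x : ℝ) : Summable fun n : ℕ => b n * x ^ n := by
  refine Summable.of_norm ?_
  simpa [abs_mul, abs_pow] using h |x| (abs_nonneg x)

lemma S.theta {b : ℕ → ℝ} (h : S b) : S (fun n => n * b n) := by
  intro R hR
  refine Summable.of_nonneg_of_le (fun n => by positivity) (fun n => ?_) (h (2 * R) (by positivity))
  have : (n:ℝ) ≤ 2 ^ n := by exact_mod_cast (Nat.lt_two_pow_self (n := n)).le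
  rw [abs_mul, Nat.abs_cast, mul_pow]
  calc (n:ℝ) * |b n| * R ^ n = n * (|b n| * R ^ n) := by ring
    _ ≤ 2 ^ n * (|b n| * R ^ n) := by gcongr
    _ = _ := by ring

lemma P_zero (b : ℕ → ℝ) : P b 0 = b 0 := by
  rw [P, tsum_eq_single 0]
  · simp
  · intro n hn; simp [hn]

lemma P_hasDerivAt {b : ℕ → ℝ} (h : S b) (x : ℝ) :
    HasDerivAt (P b) (∑' n : ℕ, b n * (n * x ^ (n - 1))) x := by
  have hR : 1 ≤ |x| + 1 := by linarith [abs_nonneg x]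
  refine hasDerivAt_tsum_of_isPreconnected (g := fun (n : ℕ) (x : ℝ) => b n * x ^ n)
    (g' := fun (n : ℕ) (x : ℝ) => b n * (n * x ^ (n - 1)))
    (t := Metric.ball (0:ℝ) (|x| + 1)) (y₀ := (0:ℝ)) (y := x)
    (u := fun n : ℕ => |n * b n| * (|x| + 1) ^ n)
    (h.theta (|x| + 1) (by positivity)) Metric.isOpen_ball
    (convex_ball _ _).isPreconnected ?_ ?_ ?_ (h.summable 0) ?_
  · intro n y _
    exact (hasDerivAt_pow n y).const_mul (b n)
  · intro n y hy
    have hy' : |y| ≤ |x| + 1 := by simpa using (mem_ball_zero_iff.1 hy).le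
    rw [Real.norm_eq_abs, abs_mul, abs_mul, abs_mul, Nat.abs_cast, abs_pow]
    have : |y| ^ (n - 1) ≤ (|x| + 1) ^ n :=
      (pow_le_pow_left₀ (abs_nonneg y) hy' _).trans (pow_le_pow_right₀ hR (Nat.sub_le _ _))
    calc |b n| * (n * |y| ^ (n - 1)) ≤ |b n| * (n * (|x| + 1) ^ n) := by gcongr
      _ = _ := by ring
  · simp; positivity
  · simp

lemma P_theta (b : ℕ → ℝ) (x : ℝ) :
    x * (∑' n : ℕ, b n * (n * x ^ (n - 1))) = P (fun n => n * b n) x := by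
  rw [P, ← tsum_mul_left]
  congr 1; ext n
  cases n with
  | zero => simp
  | succ n => simp [pow_succ]; ring

lemma P_continuous {b : ℕ → ℝ} (h : S b) : Continuous (P b) :=
  continuous_iff_continuousAt.2 fun x => (P_hasDerivAt h x).continuousAt

/-- The Caputo-type identity. -/
lemma caputo {α δ : ℝ} (h1 : α < 1) (hδ : 0 < δ) {b d : ℕ → ℝ} (hb : S b) (hd : S d)
    (hbd : ∀ n : ℕ, b (n + 1) * (Real.Gamma (1 - α) *
      (Real.Gamma (1 + δ * (n + 1)) / Real.Gamma (1 + δ * (n + 1) - α))) = d n)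
    {x : ℝ} (hx : 0 < x) :
    P b x - b 0 + α * ∫ s in Ioo (0:ℝ) 1, (P b x - P b (x * s ^ δ)) * (1 - s) ^ (-α - 1) =
      x * P d x := by
  set J : ℕ → ℝ := fun n => ∫ s in Ioo (0:ℝ) 1, (1 - s ^ (δ * n)) * (1 - s) ^ (-α - 1) with hJ
  have hJn : ∀ n : ℕ, IntegrableOn (fun s : ℝ => (1 - s ^ (δ * n)) * (1 - s) ^ (-α - 1)) (Ioo 0 1) :=
    fun n => integrable_of_bound h1 (contOn_one_sub_rpow _)
      (fun s hs => abs_one_sub_rpow_le (by positivity) hs)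
  have hI0 : 0 ≤ ∫ s in Ioo (0:ℝ) 1, (1 - s) ^ (-α) :=
    setIntegral_nonneg measurableSet_Ioo fun s hs => Real.rpow_nonneg (by linarith [hs.2]) _
  have hJabs : ∀ n : ℕ, |J n| ≤ (1 + δ * n) * ∫ s in Ioo (0:ℝ) 1, (1 - s) ^ (-α) :=
    fun n => abs_integral_le h1 (fun s hs => abs_one_sub_rpow_le (by positivity) hs)
  set F : ℕ → ℝ → ℝ := fun n s => (b n * x ^ n) * ((1 - s ^ (δ * n)) * (1 - s) ^ (-α - 1)) with hF
  have hsum : HasSum (fun n => ∫ s in Ioo (0:ℝ) 1, F n s) (∫ s in Ioo (0:ℝ) 1, ∑' n, F n s) := by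
    refine hasSum_integral_of_summable_integral_norm (fun n => (hJn n).const_mul _) ?_
    have hs : Summable fun n : ℕ => (|b n| * x ^ n + δ * (|n * b n| * x ^ n)) *
        ∫ s in Ioo (0:ℝ) 1, (1 - s) ^ (-α) :=
      ((hb x hx.le).add ((hb.theta x hx.le).mul_left δ)).mul_right _
    refine Summable.of_nonneg_of_le (fun n => integral_nonneg fun s => norm_nonneg _) (fun n => ?_) hs
    have e : ∫ s in Ioo (0:ℝ) 1, ‖F n s‖ = |b n| * x ^ n * J n := by
      rw [hJ, ← integral_const_mul]
      refine setIntegral_congr_fun measurableSet_Ioo fun s hs => ?_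
      have hp : 0 < (1 - s) ^ (-α - 1) := Real.rpow_pos_of_pos (by linarith [hs.2]) _
      have hq : 0 ≤ 1 - s ^ (δ * n) := by
        linarith [Real.rpow_le_one hs.1.le hs.2.le (show 0 ≤ δ * n by positivity)]
      simp only [hF, Real.norm_eq_abs, abs_mul, abs_pow, abs_of_pos hp, abs_of_nonneg hq, abs_of_pos hx]
    rw [e]
    calc |b n| * x ^ n * J n ≤ |b n| * x ^ n * ((1 + δ * n) * ∫ s in Ioo (0:ℝ) 1, (1 - s) ^ (-α)) := by
          gcongr
          exact (le_abs_self _).trans (hJabs n)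
      _ = _ := by rw [abs_mul, Nat.abs_cast]; ring
  have e1 : ∀ n, ∫ s in Ioo (0:ℝ) 1, F n s = b n * x ^ n * J n := fun n => by
    rw [hJ, ← integral_const_mul]
  have e2 : ∫ s in Ioo (0:ℝ) 1, ∑' n, F n s =
      ∫ s in Ioo (0:ℝ) 1, (P b x - P b (x * s ^ δ)) * (1 - s) ^ (-α - 1) := by
    refine setIntegral_congr_fun measurableSet_Ioo fun s hs => ?_
    simp only [P]
    rw [← (hb.summable x).tsum_sub (hb.summable _), ← tsum_mul_right]
    congr 1; ext n
    simp only [hF]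
    rw [mul_pow, ← Real.rpow_natCast (s ^ δ), ← Real.rpow_mul hs.1.le]
    ring
  simp only [e1] at hsum
  rw [e2] at hsum
  have h3 := ((hb.summable x).hasSum.add (hsum.mul_left α))
  have h4 := (hasSum_nat_add_iff' 1).2 h3
  have hJ0 : J 0 = 0 := by simp [hJ]
  have h5 := (hd.summable x).hasSum.mul_left x
  have h6 : ∀ n : ℕ, b (n + 1) * x ^ (n + 1) + α * (b (n + 1) * x ^ (n + 1) * J (n + 1)) =
      x * (d n * x ^ n) := fun n => by
    have := J_value (α := α) (y := δ * (n + 1)) h1 (by positivity)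
    rw [← hbd n, ← this, hJ]
    push_cast
    ring
  simp only [h6] at h4
  have := h4.unique h5
  simp only [Finset.range_one, Finset.sum_singleton, hJ0, pow_zero, mul_zero, mul_one, add_zero] at this
  rw [P, P] 
  rw [← this]
  simp only [P]
  ring

/-- Maximum principle. -/
lemma maxp {α δ c M : ℝ} (h0 : 0 < α) (hδ : 0 < δ) (hc : 0 < c) {p g : ℝ → ℝ}
    (hp : Continuous p) (hM : 0 ≤ M) (hp0 : p 0 ≤ M) (hg : ∀ x, 0 ≤ x → g x ≤ M)
    (heq : ∀ x, 0 < x → p x - p 0 +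
      α * ∫ s in Ioo (0:ℝ) 1, (p x - p (x * s ^ δ)) * (1 - s) ^ (-α - 1) = c * x * (g x - p x)) :
    ∀ x, 0 ≤ x → p x ≤ M := by
  intro X hX
  by_contra! hlt
  obtain ⟨z, hz, hmax⟩ := isCompact_Icc.exists_isMaxOn (nonempty_Icc.2 hX) hp.continuousOn
  have hzX : p X ≤ p z := hmax (right_mem_Icc.2 hX)
  have hz0 : 0 < z := by
    rcases hz.1.eq_or_lt with h | h
    · subst h; linarith
    · exact h
  have h := heq z hz0
  have hJ : 0 ≤ ∫ s in Ioo (0:ℝ) 1, (p z - p (z * s ^ δ)) * (1 - s) ^ (-α - 1) := by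
    refine setIntegral_nonneg measurableSet_Ioo fun s hs => ?_
    refine mul_nonneg (sub_nonneg.2 (hmax ⟨?_, ?_⟩)) (Real.rpow_nonneg (by linarith [hs.2]) _)
    · exact mul_nonneg hz0.le (Real.rpow_nonneg hs.1.le _)
    · exact (mul_le_of_le_one_right hz0.le (Real.rpow_le_one hs.1.le hs.2.le hδ.le)).trans hz.2
  have h7 : 0 < c * z * (p z - g z) := mul_pos (mul_pos hc hz0) (by linarith [hg z hz0.le])
  have h8 := mul_nonneg h0.le hJ
  nlinarith

lemma maxp_abs {α δ c M : ℝ} (h0 : 0 < α) (hδ : 0 < δ) (hc : 0 < c) {p g : ℝ → ℝ}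
    (hp : Continuous p) (hM : 0 ≤ M) (hp0 : |p 0| ≤ M) (hg : ∀ x, 0 ≤ x → |g x| ≤ M)
    (heq : ∀ x, 0 < x → p x - p 0 +
      α * ∫ s in Ioo (0:ℝ) 1, (p x - p (x * s ^ δ)) * (1 - s) ^ (-α - 1) = c * x * (g x - p x)) :
    ∀ x, 0 ≤ x → |p x| ≤ M := by
  intro x hx
  refine abs_le'.2 ⟨maxp h0 hδ hc hp hM ((le_abs_self _).trans hp0)
    (fun y hy => (le_abs_self _).trans (hg y hy)) heq x hx, ?_⟩
  refine maxp (p := fun x => - p x) (g := fun x => - g x) h0 hδ hc hp.neg hM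
    ((neg_le_abs _).trans hp0) (fun y hy => (neg_le_abs _).trans (hg y hy)) ?_ x hx
  intro y hy
  have e : ∫ s in Ioo (0:ℝ) 1, (-p y - -p (y * s ^ δ)) * (1 - s) ^ (-α - 1) =
      - ∫ s in Ioo (0:ℝ) 1, (p y - p (y * s ^ δ)) * (1 - s) ^ (-α - 1) := by
    rw [← integral_neg]
    congr 1; ext s; ring
  simp only [e]
  linear_combination -(heq y hy)

/-- Lipschitz-type bound along the scaling. -/
lemma lip {δ : ℝ} (hδ : 0 < δ) {p p' : ℝ → ℝ} (hp : ∀ x, HasDerivAt p (p' x) x)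
    (hb : ∀ x, 0 ≤ x → |p x| ≤ 1) (hb' : ∀ x, 0 ≤ x → |x * p' x| ≤ 1) {x s : ℝ} (hx : 0 < x)
    (hs : s ∈ Ioo (0:ℝ) 1) : |p x - p (x * s ^ δ)| ≤ (4 + 2 * δ) * (1 - s) := by
  have hxs : 0 ≤ x * s ^ δ := mul_nonneg hx.le (Real.rpow_nonneg hs.1.le _)
  rcases lt_or_ge s (1/2) with h | h
  · have h2 : |p x - p (x * s ^ δ)| ≤ 2 := by
      have := abs_sub (p x) (p (x * s ^ δ))
      linarith [hb x hx.le, hb _ hxs]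
    nlinarith [hs.2]
  · have key : ‖p (x * (1:ℝ) ^ δ) - p (x * s ^ δ)‖ ≤ (2 * δ) * ‖1 - s‖ := by
      refine Convex.norm_image_sub_le_of_norm_hasDerivWithin_le (s := Icc s 1)
        (f := fun r : ℝ => p (x * r ^ δ))
        (f' := fun r => p' (x * r ^ δ) * (x * (δ * r ^ (δ - 1)))) ?_ ?_ (convex_Icc s 1)
        (left_mem_Icc.2 hs.2.le) (right_mem_Icc.2 hs.2.le)
      · intro r hr
        have hr0 : 0 < r := hs.1.trans_le hr.1
        have d := (Real.hasDerivAt_rpow_const (p := δ) (Or.inl hr0.ne')).const_mul x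
        exact ((hp (x * r ^ δ)).comp r d).hasDerivWithinAt
      · intro r hr
        have hr0 : 0 < r := hs.1.trans_le hr.1
        have e : p' (x * r ^ δ) * (x * (δ * r ^ (δ - 1))) =
            (x * r ^ δ * p' (x * r ^ δ)) * (δ * r⁻¹) := by
          rw [Real.rpow_sub_one hr0.ne']; field_simp
        rw [e, norm_mul, Real.norm_eq_abs, Real.norm_eq_abs, abs_of_pos (show 0 < δ * r⁻¹ by positivity)]
        have hi : r⁻¹ ≤ 2 := by
          rw [inv_le_comm₀ hr0 two_pos]; linarith [hr.1]
        calc _ ≤ 1 * (δ * r⁻¹) := by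
              gcongr
              exact hb' _ (mul_nonneg hx.le (Real.rpow_nonneg hr0.le _))
          _ ≤ 2 * δ := by nlinarith
    rw [Real.one_rpow, mul_one, Real.norm_eq_abs, Real.norm_eq_abs, abs_of_pos (by linarith [hs.2] : 0 < 1 - s)] at key
    nlinarith [hs.2]

/-- Abstract final step. -/
lemma final {α δ c : ℝ} (h1 : α < 1) (hδ : 0 < δ) (hc : 0 < c) {p p' : ℝ → ℝ}
    (hp : ∀ x, HasDerivAt p (p' x) x)
    (hb : ∀ x, 0 ≤ x → |p x| ≤ 1) (hb' : ∀ x, 0 ≤ x → |x * p' x| ≤ 1)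
    (heq : ∀ x, 0 < x → p x - 1 +
      α * ∫ s in Ioo (0:ℝ) 1, (p x - p (x * s ^ δ)) * (1 - s) ^ (-α - 1) = - (c * x * p x)) :
    Tendsto (fun x => x * p x) atTop (𝓝 (1 / c)) := by
  have hcont : Continuous p := continuous_iff_continuousAt.2 fun x => (hp x).continuousAt
  set J : ℝ → ℝ := fun x => ∫ s in Ioo (0:ℝ) 1, (p x - p (x * s ^ δ)) * (1 - s) ^ (-α - 1) with hJ
  set I0 := ∫ s in Ioo (0:ℝ) 1, (1 - s) ^ (-α) with hI0
  have hJb : ∀ x, 0 < x → |J x| ≤ (4 + 2 * δ) * I0 := fun x hx =>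
    abs_integral_le h1 (fun s hs => lip hδ hp hb hb' hx hs)
  have hxp : ∀ x, 0 < x → x * p x = (1 - p x - α * J x) / c := fun x hx => by
    rw [eq_div_iff hc.ne']; linear_combination heq x hx
  have hp0 : Tendsto p atTop (𝓝 0) := by
    have hlim : Tendsto (fun x : ℝ => ((2 + |α| * ((4 + 2 * δ) * I0)) / c) * x⁻¹) atTop (𝓝 0) := by
      simpa using tendsto_inv_atTop_zero.const_mul ((2 + |α| * ((4 + 2 * δ) * I0)) / c)
    refine squeeze_zero_norm' ?_ hlim
    filter_upwards [eventually_gt_atTop 0] with x hx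
    have h2 : p x = ((1 - p x - α * J x) / c) * x⁻¹ := by
      rw [← hxp x hx]; field_simp
    rw [h2, norm_mul, norm_inv, Real.norm_eq_abs, Real.norm_eq_abs, abs_of_pos hx, abs_div, abs_of_pos hc]
    gcongr
    have a1 := abs_sub (1 - p x) (α * J x)
    have a2 := abs_sub 1 (p x)
    rw [abs_one] at a2
    rw [abs_mul] at a1
    have a3 := mul_le_mul_of_nonneg_left (hJb x hx) (abs_nonneg α)
    linarith [hb x hx.le]
  have hJ0 : Tendsto J atTop (𝓝 0) := by
    have : Tendsto J atTop (𝓝 (∫ s in Ioo (0:ℝ) 1, (0:ℝ))) := by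
      refine tendsto_integral_filter_of_dominated_convergence
        (fun s => (4 + 2 * δ) * (1 - s) ^ (-α)) ?_ ?_ ((integrable_base h1).const_mul _) ?_
      · filter_upwards [eventually_gt_atTop 0] with x hx
        refine (integrable_of_bound h1 (C := 4 + 2 * δ) ?_ (fun s hs => lip hδ hp hb hb' hx hs)).aestronglyMeasurable
        have : Continuous fun s : ℝ => s ^ δ := Real.continuous_rpow_const hδ.le
        exact (continuous_const.sub (hcont.comp (continuous_const.mul this))).continuousOn
      · filter_upwards [eventually_gt_atTop 0] with x hx
        refine ae_restrict_of_forall_mem measurableSet_Ioo fun s hs => ?_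
        have hq : 0 < (1 - s) ^ (-α - 1) := Real.rpow_pos_of_pos (by linarith [hs.2]) _
        rw [Real.norm_eq_abs, abs_mul, abs_of_pos hq, ← kernel_eq hs.2, ← mul_assoc]
        exact mul_le_mul_of_nonneg_right (lip hδ hp hb hb' hx hs) hq.le
      · refine ae_restrict_of_forall_mem measurableSet_Ioo fun s hs => ?_
        have t1 : Tendsto (fun x : ℝ => x * s ^ δ) atTop atTop :=
          tendsto_id.atTop_mul_const (Real.rpow_pos_of_pos hs.1 _)
        simpa using (hp0.sub (hp0.comp t1)).mul_const ((1 - s) ^ (-α - 1))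
    simpa using this
  have : Tendsto (fun x => (1 - p x - α * J x) / c) atTop (𝓝 ((1 - 0 - α * 0) / c)) :=
    ((tendsto_const_nhds.sub hp0).sub (hJ0.const_mul α)).div_const c
  simp only [sub_zero, mul_zero] at this
  refine this.congr' ?_
  filter_upwards [eventually_gt_atTop 0] with x hx
  exact (hxp x hx).symm

/-- Coefficients. -/
noncomputable def A (α δ : ℝ) (n : ℕ) : ℝ :=
  ∏ k ∈ Finset.range n, Real.Gamma (1 + δ * (k + 1) - α) / Real.Gamma (1 + δ * (k + 1))

lemma ratio_le {α y : ℝ} (h0 : 0 < α) (h1 : α < 1) (hy : 0 < y) :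
    Real.Gamma (1 + y - α) / Real.Gamma (1 + y) ≤ y ^ (-α) := by
  have h := Real.Gamma_mul_add_mul_le_rpow_Gamma_mul_rpow_Gamma hy (show 0 < 1 + y by linarith)
    h0 (show 0 < 1 - α by linarith) (by ring)
  have hG : 0 < Real.Gamma (1 + y) := Real.Gamma_pos_of_pos (by linarith)
  have hGy : 0 < Real.Gamma y := Real.Gamma_pos_of_pos hy
  rw [show α * y + (1 - α) * (1 + y) = 1 + y - α by ring] at h
  rw [div_le_iff₀ hG]
  refine h.trans (le_of_eq ?_)
  have e : Real.Gamma (1 + y) = y * Real.Gamma y := by rw [add_comm, Real.Gamma_add_one hy.ne']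
  rw [e, Real.mul_rpow hy.le hGy.le, Real.rpow_sub hy, Real.rpow_sub hGy, Real.rpow_one, Real.rpow_one,
    Real.rpow_neg hy.le]
  have := Real.rpow_pos_of_pos hy α
  have := Real.rpow_pos_of_pos hGy α
  field_simp

lemma A_pos {α δ : ℝ} (h1 : α < 1) (hδ : 0 < δ) (n : ℕ) : 0 < A α δ n := by
  refine Finset.prod_pos fun k _ => ?_
  have : 0 < δ * (k + 1) := by positivity
  exact div_pos (Real.Gamma_pos_of_pos (by linarith)) (Real.Gamma_pos_of_pos (by linarith))

lemma A_S {α δ : ℝ} (h0 : 0 < α) (h1 : α < 1) (hδ : 0 < δ) : S (fun n => (-1) ^ n * A α δ n) := by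
  intro R hR
  have hA := A_pos h1 hδ
  have e : ∀ n, |(-1) ^ n * A α δ n| * R ^ n = A α δ n * R ^ n := fun n => by
    rw [abs_mul, abs_pow, abs_neg, abs_one, one_pow, one_mul, abs_of_pos (hA n)]
  simp only [e]
  have hlim : Tendsto (fun n : ℕ => (δ * ((n:ℝ) + 1)) ^ (-α) * R) atTop (𝓝 0) := by
    have t1 : Tendsto (fun n : ℕ => δ * ((n:ℝ) + 1)) atTop atTop :=
      (tendsto_atTop_add_const_right _ 1 tendsto_natCast_atTop_atTop).const_mul_atTop hδ
    simpa using ((tendsto_rpow_neg_atTop h0).comp t1).mul_const R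
  refine summable_of_ratio_norm_eventually_le (r := 1/2) (by norm_num) ?_
  filter_upwards [hlim.eventually_le_const (show (0:ℝ) < 1/2 by norm_num)] with n hn
  have hpn : 0 ≤ A α δ n * R ^ n := mul_nonneg (hA n).le (pow_nonneg hR n)
  rw [Real.norm_of_nonneg (mul_nonneg (hA _).le (pow_nonneg hR _)), Real.norm_of_nonneg hpn]
  have hr := ratio_le h0 h1 (show 0 < δ * ((n:ℝ) + 1) by positivity)
  calc A α δ (n + 1) * R ^ (n + 1) = (Real.Gamma (1 + δ * (n + 1) - α) / Real.Gamma (1 + δ * (n + 1)) * R)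
        * (A α δ n * R ^ n) := by rw [A, Finset.prod_range_succ, ← A, pow_succ]; ring
    _ ≤ (δ * ((n:ℝ) + 1)) ^ (-α) * R * (A α δ n * R ^ n) := by gcongr
    _ ≤ _ := by gcongr

end KS

theorem kilbasSaigo_weibull_asymptotics_atTop (α m : ℝ)
    (hα : α ∈ Set.Ioo (0 : ℝ) 1) (hm : 0 < m) :
    Tendsto (fun x : ℝ => x * kilbasSaigo α m (m - 1) (-x)) atTop
      (nhds (1 / Real.Gamma (1 - α))) := by
  obtain ⟨h0, h1⟩ := hα
  set δ := α * m with hδd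
  have hδ : 0 < δ := mul_pos h0 hm
  set c := Real.Gamma (1 - α) with hcd
  have hc : 0 < c := Real.Gamma_pos_of_pos (by linarith)
  set b : ℕ → ℝ := fun n => (-1) ^ n * KS.A α δ n with hb
  have hbS : KS.S b := KS.A_S h0 h1 hδ
  have hbT := hbS.theta
  have hb0 : b 0 = 1 := by simp [hb, KS.A]
  have hks : ∀ x, kilbasSaigo α m (m - 1) (-x) = KS.P b x := by
    intro x
    rw [kilbasSaigo, KS.P]
    congr 1; ext n
    simp only [hb, KS.A]
    rw [neg_pow x, mul_comm ((-1) ^ n) (Finset.prod _ _), mul_assoc]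
    congr 1
    refine Finset.prod_congr rfl fun k _ => ?_
    congr 2 <;> rw [hδd] <;> ring
  simp only [hks]
  have hrec : ∀ n : ℕ, b (n + 1) * (c *
      (Real.Gamma (1 + δ * (n + 1)) / Real.Gamma (1 + δ * (n + 1) - α))) = - c * b n := by
    intro n
    have hy : 0 < δ * ((n:ℝ) + 1) := by positivity
    have g1 := Real.Gamma_pos_of_pos (show 0 < 1 + δ * ((n:ℝ) + 1) - α by linarith)
    have g2 := Real.Gamma_pos_of_pos (show 0 < 1 + δ * ((n:ℝ) + 1) by linarith)
    simp only [hb]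
    rw [KS.A, Finset.prod_range_succ, ← KS.A, pow_succ]
    field_simp
  have hS1 : KS.S (fun n => - c * b n) := fun R hR => by
    simpa [abs_mul, mul_assoc] using (hbS R hR).mul_left |c|
  have hS2 : KS.S (fun n => - c * (((n:ℝ) + 1) * b n)) := fun R hR => by
    refine Summable.of_nonneg_of_le (fun n => by positivity) (fun n => ?_)
      (((hbT R hR).add (hbS R hR)).mul_left |c|)
    have e1 : |(n:ℝ) * b n| = n * |b n| := by rw [abs_mul, Nat.abs_cast]
    have e2 : |-c * (((n:ℝ) + 1) * b n)| = |c| * (((n:ℝ) + 1) * |b n|) := by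
      rw [abs_mul, abs_neg, abs_mul, abs_of_pos (by positivity : 0 < (n:ℝ) + 1)]
    simp only [e1, e2]
    exact le_of_eq (by ring)
  have eq1 : ∀ x, 0 < x → KS.P b x - KS.P b 0 + α * ∫ s in Ioo (0:ℝ) 1,
      (KS.P b x - KS.P b (x * s ^ δ)) * (1 - s) ^ (-α - 1) = c * x * (0 - KS.P b x) := by
    intro x hx
    rw [KS.P_zero, KS.caputo h1 hδ hbS hS1 hrec hx]
    have : KS.P (fun n => - c * b n) x = - c * KS.P b x := by
      simp only [KS.P]; rw [← tsum_mul_left]; congr 1; ext n; ring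
    rw [this]; ring
  set θ : ℝ → ℝ := KS.P (fun n => n * b n) with hθ
  have eq2 : ∀ x, 0 < x → θ x - θ 0 + α * ∫ s in Ioo (0:ℝ) 1,
      (θ x - θ (x * s ^ δ)) * (1 - s) ^ (-α - 1) = c * x * (- KS.P b x - θ x) := by
    intro x hx
    rw [hθ, KS.P_zero, KS.caputo h1 hδ hbT hS2 ?_ hx]
    · have : KS.P (fun n => - c * (((n:ℝ) + 1) * b n)) x =
          - c * (KS.P (fun n => n * b n) x + KS.P b x) := by
        simp only [KS.P]
        rw [← (hbT.summable x).tsum_add (hbS.summable x), ← tsum_mul_left]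
        congr 1; ext n; ring
      rw [this]; ring
    · intro n
      push_cast
      linear_combination ((n:ℝ) + 1) * hrec n
  have bd1 : ∀ x, 0 ≤ x → |KS.P b x| ≤ 1 :=
    KS.maxp_abs (g := fun _ => 0) h0 hδ hc (KS.P_continuous hbS) zero_le_one
      (by rw [KS.P_zero, hb0]; simp) (fun _ _ => by simp) eq1
  have bd2 : ∀ x, 0 ≤ x → |θ x| ≤ 1 :=
    KS.maxp_abs (g := fun x => - KS.P b x) h0 hδ hc (KS.P_continuous hbT) zero_le_one
      (by rw [hθ, KS.P_zero]; simp) (fun x hx => by simpa using bd1 x hx) eq2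
  refine KS.final (δ := δ) h1 hδ hc (KS.P_hasDerivAt hbS) bd1 ?_ ?_
  · intro x hx
    rw [KS.P_theta]; exact bd2 x hx
  · intro x hx
    have := eq1 x hx
    rw [KS.P_zero, hb0] at this
    rw [this]; ring
end

section
/- For every α ∈ (0,1], β ≥ α and s ∈ (0,1), the function x ↦ E_{α,β}(−x) x^{s−1} is integrable on (0,∞) and ∫₀^∞ E_{α,β}(−x) x^{s−1} dx = Γ(s)Γ(1−s)/Γ(β − αs). -/
open MeasureTheory

/-- The two-parameter Mittag-Leffler function `E_{α,β}(x)` for real argument. -/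
noncomputable def mittagLeffler (α β : ℝ) (x : ℝ) : ℝ :=
  ∑' n : ℕ, x ^ n / Real.Gamma (β + α * n)

namespace MLProof

/-- Crude lower bound for Gamma. -/
lemma gamma_lower {R y : ℝ} (hR : 0 < R) (hy : 1 ≤ y) :
    R ^ (y - 1) * Real.exp (-R) ≤ Real.Gamma y := by
  have hy0 : 0 < y := by linarith
  rw [Real.Gamma_eq_integral hy0]
  have hint := Real.GammaIntegral_convergent hy0
  have hsub : Set.Ioi R ⊆ Set.Ioi (0:ℝ) := Set.Ioi_subset_Ioi hR.le
  calc R ^ (y - 1) * Real.exp (-R) = ∫ x in Set.Ioi R, R ^ (y - 1) * Real.exp (-x) := by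
        rw [integral_const_mul, integral_exp_neg_Ioi]
    _ ≤ ∫ x in Set.Ioi R, Real.exp (-x) * x ^ (y - 1) := by
        apply setIntegral_mono_on
        · exact ((integrableOn_exp_neg_Ioi R)).const_mul _
        · exact hint.mono_set hsub
        · exact measurableSet_Ioi
        · intro x hx
          rw [mul_comm]
          have hx' : R ≤ x := le_of_lt hx
          gcongr
    _ ≤ ∫ x in Set.Ioi (0:ℝ), Real.exp (-x) * x ^ (y - 1) := by
        apply setIntegral_mono_set hint
        · filter_upwards [ae_restrict_mem measurableSet_Ioi] with x hx
          have : (0:ℝ) < x := hx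
          simp only [Pi.zero_apply]
          positivity
        · exact hsub.eventuallyLE

lemma ml_summable {α b : ℝ} (hα : 0 < α) (hb : 0 < b) (x : ℝ) :
    Summable (fun n : ℕ => |x| ^ n / Real.Gamma (b + α * n)) := by
  set Q : ℝ := 2 * |x| + 1 with hQ
  have hQ0 : 0 < Q := by positivity
  set R : ℝ := Q ^ (1 / α) with hRdef
  have hR : 0 < R := by positivity
  have hRα : R ^ α = Q := by
    rw [hRdef, ← Real.rpow_mul hQ0.le]; field_simp; simp
  have hg : Summable (fun n : ℕ => (R ^ (1 - b) * Real.exp R) * (1 / 2 : ℝ) ^ n) :=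
    (summable_geometric_of_lt_one (by norm_num) (by norm_num)).mul_left _
  refine Summable.of_norm_bounded_eventually_nat hg ?_
  obtain ⟨N, hN⟩ := exists_nat_gt (1 / α)
  filter_upwards [Filter.eventually_ge_atTop N] with n hn
  have hn' : (N : ℝ) ≤ n := by exact_mod_cast hn
  have h1 : 1 ≤ b + α * n := by
    have : 1 / α < n := lt_of_lt_of_le hN hn'
    rw [div_lt_iff₀ hα] at this
    linarith
  have hG := gamma_lower hR h1
  have hpos : 0 < R ^ (b + α * n - 1) * Real.exp (-R) := by positivity
  rw [Real.norm_of_nonneg (div_nonneg (by positivity) (by linarith))]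
  have e1 : R ^ (b + α * n - 1) = (R ^ (1 - b))⁻¹ * Q ^ n := by
    rw [← Real.rpow_neg hR.le, ← hRα, ← Real.rpow_natCast, ← Real.rpow_mul hR.le,
      ← Real.rpow_add hR]
    congr 1; ring
  calc |x| ^ n / Real.Gamma (b + α * n) ≤ |x| ^ n / (R ^ (b + α * n - 1) * Real.exp (-R)) := by
        gcongr
    _ = (R ^ (1 - b) * Real.exp R) * (|x| / Q) ^ n := by
        rw [e1, Real.exp_neg, div_pow]
        field_simp
    _ ≤ _ := by
        have : |x| / Q ≤ 1 / 2 := by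
          rw [div_le_div_iff₀ hQ0 (by norm_num)]
          linarith
        exact mul_le_mul_of_nonneg_left (pow_le_pow_left₀ (by positivity) this n) (by positivity)

lemma ml_continuous {α b : ℝ} (hα : 0 < α) (hb : 0 < b) :
    Continuous (mittagLeffler α b) := by
  rw [continuous_iff_continuousAt]
  intro x
  have hG : ∀ n : ℕ, 0 < Real.Gamma (b + α * n) := fun n =>
    Real.Gamma_pos_of_pos (by positivity)
  have : ContinuousOn (mittagLeffler α b) (Metric.ball 0 (|x| + 1)) := by
    unfold mittagLeffler
    refine continuousOn_tsum (u := fun n : ℕ => |(|x| + 1)| ^ n / Real.Gamma (b + α * n))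
      (fun n => by fun_prop) (ml_summable hα hb _) ?_
    intro n y hy
    have hy' : |y| < |x| + 1 := by simpa using hy
    rw [norm_div, norm_pow, Real.norm_eq_abs, Real.norm_eq_abs, abs_of_pos (hG n)]
    have := hG n
    exact div_le_div_of_nonneg_right
      (pow_le_pow_left₀ (abs_nonneg y) (hy'.le.trans (le_abs_self _)) n) (hG n).le
  exact this.continuousAt (Metric.isOpen_ball.mem_nhds (by simp))

lemma ml_hasSum {α b : ℝ} (hα : 0 < α) (hb : 0 < b) (x : ℝ) :
    HasSum (fun n : ℕ => x ^ n / Real.Gamma (b + α * n)) (mittagLeffler α b x) := by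
  have hG : ∀ n : ℕ, 0 < Real.Gamma (b + α * n) := fun n =>
    Real.Gamma_pos_of_pos (by positivity)
  apply Summable.hasSum
  apply Summable.of_norm
  refine (ml_summable hα hb x).congr fun n => ?_
  rw [norm_div, norm_pow, Real.norm_eq_abs, Real.norm_eq_abs, abs_of_pos (hG n)]

lemma ml_zero {α b : ℝ} : mittagLeffler α b 0 = 1 / Real.Gamma b := by
  unfold mittagLeffler
  rw [tsum_eq_single 0]
  · simp
  · intro n hn; simp [hn]

lemma ml_rec {α b : ℝ} (hα : 0 < α) (hb : 0 < b) (x : ℝ) :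
    mittagLeffler α b x = 1 / Real.Gamma b + x * mittagLeffler α (α + b) x := by
  unfold mittagLeffler
  rw [(ml_hasSum hα hb x).summable.tsum_eq_zero_add, ← tsum_mul_left]
  congr 1
  · simp
  · congr 1; ext n
    rw [show b + α * ((n + 1 : ℕ) : ℝ) = α + b + α * n by push_cast; ring]
    ring

lemma beta_real {a b t : ℝ} (ha : 0 < a) (hb : 0 < b) (ht : 0 < t) :
    ∫ x in Set.Ioc 0 t, x ^ (b - 1) * (t - x) ^ (a - 1) =
      t ^ (a + b - 1) * (Real.Gamma a * Real.Gamma b / Real.Gamma (a + b)) := by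
  have h := Complex.betaIntegral_scaled (b : ℂ) (a : ℂ) ht
  have h2 := Complex.betaIntegral_eq_Gamma_mul_div (b : ℂ) (a : ℂ) (by simpa) (by simpa)
  rw [h2, intervalIntegral.integral_of_le ht.le] at h
  have h3 : ∫ x in Set.Ioc 0 t, (x : ℂ) ^ ((b : ℂ) - 1) * ((t : ℂ) - x) ^ ((a : ℂ) - 1) =
      ((∫ x in Set.Ioc 0 t, x ^ (b - 1) * (t - x) ^ (a - 1) : ℝ) : ℂ) := by
    rw [← integral_complex_ofReal]
    refine setIntegral_congr_fun measurableSet_Ioc fun x hx => ?_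
    push_cast
    rw [Complex.ofReal_cpow hx.1.le, Complex.ofReal_cpow (by linarith [hx.2])]
    push_cast; rfl
  rw [h3] at h
  apply Complex.ofReal_injective
  rw [h]
  push_cast
  rw [Complex.ofReal_cpow ht.le, ← Complex.Gamma_ofReal, ← Complex.Gamma_ofReal,
    ← Complex.Gamma_ofReal]
  push_cast
  rw [add_comm (b : ℂ) a, mul_comm (Complex.Gamma b)]

lemma beta_real_integrable {a b t : ℝ} (ha : 0 < a) (hb : 0 < b) (ht : 0 < t) :
    IntegrableOn (fun x : ℝ => x ^ (b - 1) * (t - x) ^ (a - 1)) (Set.Ioc 0 t) := by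
  apply Integrable.of_integral_ne_zero
  rw [beta_real ha hb ht]
  have := Real.Gamma_pos_of_pos ha
  have := Real.Gamma_pos_of_pos hb
  have := Real.Gamma_pos_of_pos (add_pos ha hb)
  positivity

/-- `f_b(t) = t^(b-1) E_{α,b}(-t^α)`. -/
noncomputable def fml (α b t : ℝ) : ℝ := t ^ (b - 1) * mittagLeffler α b (-t ^ α)

lemma conv_integrable {α a b t : ℝ} (hα : 0 < α) (ha : 0 < a) (hb : 0 < b) (ht : 0 < t) :
    IntegrableOn (fun u : ℝ => (t - u) ^ (a - 1) * fml α b u) (Set.Ioc 0 t) := by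
  have hcont : Continuous (fun u : ℝ => mittagLeffler α b (-u ^ α)) :=
    (ml_continuous hα hb).comp (Real.continuous_rpow_const hα.le).neg
  obtain ⟨C, hC⟩ := (isCompact_Icc (a := (0:ℝ)) (b := t)).exists_bound_of_continuousOn
    hcont.continuousOn
  have h := (beta_real_integrable ha hb ht).mul_bdd (c := C) hcont.aestronglyMeasurable
    (by
      filter_upwards [ae_restrict_mem measurableSet_Ioc] with u hu
      exact hC u ⟨hu.1.le, hu.2⟩)
  refine h.congr ?_
  filter_upwards with u
  simp only [fml]; ring

lemma conv_integral {α a b t : ℝ} (hα : 0 < α) (ha : 0 < a) (hb : 0 < b) (ht : 0 < t) :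
    ∫ u in Set.Ioc 0 t, (t - u) ^ (a - 1) * fml α b u = Real.Gamma a * fml α (a + b) t := by
  have hG : ∀ n : ℕ, 0 < Real.Gamma (b + α * n) := fun n =>
    Real.Gamma_pos_of_pos (by positivity)
  have hG2 : ∀ n : ℕ, 0 < Real.Gamma (a + b + α * n) := fun n =>
    Real.Gamma_pos_of_pos (by positivity)
  have hGa := Real.Gamma_pos_of_pos ha
  set F : ℕ → ℝ → ℝ := fun n u =>
    ((-1) ^ n / Real.Gamma (b + α * n)) * (u ^ (b + α * n - 1) * (t - u) ^ (a - 1)) with hF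
  have hbn : ∀ n : ℕ, 0 < b + α * n := fun n => by positivity
  have hFint : ∀ n, Integrable (F n) (volume.restrict (Set.Ioc 0 t)) := fun n =>
    (beta_real_integrable ha (hbn n) ht).const_mul _
  have hval : ∀ n : ℕ, t ^ (a + (b + α * n) - 1) = t ^ (a + b - 1) * (t ^ α) ^ n := fun n => by
    rw [← Real.rpow_natCast, ← Real.rpow_mul ht.le, ← Real.rpow_add ht]; congr 1; ring
  have hIF : ∀ n, ∫ u in Set.Ioc 0 t, F n u =
      (Real.Gamma a * t ^ (a + b - 1)) * ((-t ^ α) ^ n / Real.Gamma (a + b + α * n)) := fun n => by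
    rw [hF]
    simp only
    rw [integral_const_mul, beta_real ha (hbn n) ht, hval, neg_pow (t ^ α), ← add_assoc]
    have := (hG n).ne'
    have := (hG2 n).ne'
    field_simp
  have hIFn : ∀ n, ∫ u in Set.Ioc 0 t, ‖F n u‖ =
      (Real.Gamma a * t ^ (a + b - 1)) * (|t ^ α| ^ n / Real.Gamma (a + b + α * n)) := fun n => by
    have : ∫ u in Set.Ioc 0 t, ‖F n u‖ = ∫ u in Set.Ioc 0 t,
        (1 / Real.Gamma (b + α * n)) * (u ^ (b + α * n - 1) * (t - u) ^ (a - 1)) := by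
      refine setIntegral_congr_fun measurableSet_Ioc fun u hu => ?_
      have h1 := Real.rpow_nonneg hu.1.le (b + α * n - 1)
      have h2 := Real.rpow_nonneg (sub_nonneg.2 hu.2) (a - 1)
      simp only [hF]
      rw [norm_mul, norm_div, norm_pow, norm_neg, norm_one, one_pow,
        Real.norm_of_nonneg (hG n).le, Real.norm_of_nonneg (mul_nonneg h1 h2)]
    rw [this, integral_const_mul, beta_real ha (hbn n) ht, hval, ← add_assoc,
      abs_of_pos (Real.rpow_pos_of_pos ht α)]
    have := (hG n).ne'
    have := (hG2 n).ne'
    field_simp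
  have hs : Summable fun n => ∫ u in Set.Ioc 0 t, ‖F n u‖ := by
    simp_rw [hIFn]
    exact (ml_summable hα (by positivity) _).mul_left _
  have key := hasSum_integral_of_summable_integral_norm hFint hs
  simp_rw [hIF] at key
  have key2 := (ml_hasSum hα (by positivity : 0 < a + b) (-t ^ α)).mul_left
    (Real.Gamma a * t ^ (a + b - 1))
  have := key.unique key2
  unfold fml
  rw [← mul_assoc, ← this]
  refine setIntegral_congr_fun measurableSet_Ioc fun u hu => ?_
  unfold mittagLeffler
  rw [← tsum_mul_left, ← tsum_mul_left]
  congr 1; ext n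
  simp only [hF]
  have : u ^ (b + α * n - 1) = u ^ (b - 1) * (u ^ α) ^ n := by
    rw [← Real.rpow_natCast, ← Real.rpow_mul hu.1.le, ← Real.rpow_add hu.1]; congr 1; ring
  rw [this, neg_pow (u ^ α)]
  ring

/-- the Volterra equation -/
lemma volterra {α b t : ℝ} (hα : 0 < α) (hb : 0 < b) (ht : 0 < t) :
    Real.Gamma α * fml α b t + ∫ u in Set.Ioc 0 t, (t - u) ^ (α - 1) * fml α b u =
      Real.Gamma α / Real.Gamma b * t ^ (b - 1) := by
  rw [conv_integral hα hα hb ht, fml, fml, ml_rec hα hb,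
    show α + b - 1 = (b - 1) + α by ring, Real.rpow_add ht]
  ring

lemma fml_continuousOn {α b : ℝ} (hα : 0 < α) (hb : 0 < b) :
    ContinuousOn (fml α b) (Set.Ioi 0) := by
  have hcont : Continuous (fun u : ℝ => mittagLeffler α b (-u ^ α)) :=
    (ml_continuous hα hb).comp (Real.continuous_rpow_const hα.le).neg
  refine ContinuousOn.mul ?_ hcont.continuousOn
  exact fun x hx => (Real.continuousAt_rpow_const x _ (Or.inl (ne_of_gt hx))).continuousWithinAt

lemma fml_pos {α : ℝ} (hα : 0 < α) (hα1 : α ≤ 1) {t : ℝ} (ht : 0 < t) : 0 < fml α α t := by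
  by_contra hneg
  have hcont : Continuous (fun u : ℝ => mittagLeffler α α (-u ^ α)) :=
    (ml_continuous hα hα).comp (Real.continuous_rpow_const hα.le).neg
  have hiff : ∀ u : ℝ, 0 < u → (fml α α u ≤ 0 ↔ mittagLeffler α α (-u ^ α) ≤ 0) := by
    intro u hu
    have := Real.rpow_pos_of_pos hu (α - 1)
    rw [fml, ← not_lt, ← not_lt, mul_pos_iff_of_pos_left this]
  have hΓ := Real.Gamma_pos_of_pos hα
  set S : Set ℝ := {u | 0 ≤ u ∧ mittagLeffler α α (-u ^ α) ≤ 0} with hS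
  have hSne : S.Nonempty := ⟨t, ht.le, (hiff t ht).1 (not_lt.1 hneg)⟩
  have hSbdd : BddBelow S := ⟨0, fun u hu => hu.1⟩
  have hSc : IsClosed S :=
    (isClosed_le continuous_const continuous_id).inter (isClosed_le hcont continuous_const)
  set t0 := sInf S with ht0def
  have ht0S : t0 ∈ S := hSc.csInf_mem hSne hSbdd
  have ht0 : 0 < t0 := by
    rcases ht0S.1.lt_or_eq with h | h
    · exact h
    · exfalso
      have := ht0S.2
      rw [← h, Real.zero_rpow hα.ne', neg_zero, ml_zero] at this
      have : 0 < 1 / Real.Gamma α := by positivity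
      linarith
  have hft0 : fml α α t0 ≤ 0 := (hiff t0 ht0).2 ht0S.2
  have hfpos : ∀ u, 0 < u → u < t0 → 0 < fml α α u := by
    intro u hu hut
    by_contra h
    have : u ∈ S := ⟨hu.le, (hiff u hu).1 (not_lt.1 h)⟩
    exact absurd (csInf_le hSbdd this) (not_le.2 hut)
  obtain ⟨δ, hδ0, hδt, hδ⟩ : ∃ δ : ℝ, 0 < δ ∧ δ ≤ t0 / 2 ∧ δ ^ α / α < Real.Gamma α / 2 := by
    have h1 : Filter.Tendsto (fun δ : ℝ => δ ^ α / α) (nhdsWithin 0 (Set.Ioi 0)) (nhds 0) := by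
      have : Filter.Tendsto (fun δ : ℝ => δ ^ α / α) (nhds 0) (nhds ((0:ℝ) ^ α / α)) :=
        ((Real.continuous_rpow_const hα.le).div_const α).tendsto 0
      rw [Real.zero_rpow hα.ne', zero_div] at this
      exact this.mono_left nhdsWithin_le_nhds
    have h2 := h1.eventually_lt_const (show (0:ℝ) < Real.Gamma α / 2 by positivity)
    have h3 : ∀ᶠ δ : ℝ in nhdsWithin 0 (Set.Ioi 0), δ ∈ Set.Ioc 0 (t0 / 2) :=
      Ioc_mem_nhdsGT (by positivity)
    obtain ⟨δ, hd, hd'⟩ := (h2.and h3).exists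
    exact ⟨δ, hd'.1, hd'.2, hd⟩
  obtain ⟨t1, ht1, hmax⟩ := (isCompact_Icc (a := t0 - δ) (b := t0)).exists_isMaxOn
    ⟨t0, by simp [hδ0.le]⟩ ((fml_continuousOn hα hα).mono (fun u hu => by
      have := hu.1
      simp only [Set.mem_Ioi]; linarith))
  have hmax' : ∀ u ∈ Set.Icc (t0 - δ) t0, fml α α u ≤ fml α α t1 := fun u hu => hmax hu
  have hft1 : 0 < fml α α t1 :=
    lt_of_lt_of_le (hfpos (t0 - δ) (by linarith) (by linarith))
      (hmax' _ ⟨le_rfl, by linarith⟩)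
  have ht10 : t1 < t0 := by
    rcases ht1.2.lt_or_eq with h | h
    · exact h
    · rw [h] at hft1; linarith
  have ht1pos : 0 < t1 := by linarith [ht1.1]
  set r : ℝ := (t0 / t1) ^ (α - 1) with hr
  have hr12 : 1 / 2 ≤ r := by
    calc (1 / 2 : ℝ) = 2 ^ (-1 : ℝ) := by rw [Real.rpow_neg_one]; norm_num
      _ ≤ 2 ^ (α - 1) := Real.rpow_le_rpow_of_exponent_le (by norm_num) (by linarith)
      _ ≤ r := by
        apply Real.rpow_le_rpow_of_nonpos (by positivity) _ (by linarith)
        rw [div_le_iff₀ ht1pos]; linarith [ht1.1]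
  have hrt : r * t1 ^ (α - 1) = t0 ^ (α - 1) := by
    rw [hr, ← Real.mul_rpow (by positivity) ht1pos.le, div_mul_cancel₀ _ ht1pos.ne']
  have v0 := volterra hα hα ht0
  have v1 := volterra hα hα ht1pos
  rw [div_self hΓ.ne', one_mul] at v0 v1
  have i0 := conv_integrable hα hα hα ht0
  have i1 := conv_integrable hα hα hα ht1pos
  have hsplit : ∫ u in Set.Ioc 0 t0, (t0 - u) ^ (α - 1) * fml α α u =
      (∫ u in Set.Ioc 0 t1, (t0 - u) ^ (α - 1) * fml α α u) +
      ∫ u in Set.Ioc t1 t0, (t0 - u) ^ (α - 1) * fml α α u := by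
    rw [← Set.Ioc_union_Ioc_eq_Ioc ht1pos.le ht10.le]
    apply setIntegral_union (Set.Ioc_disjoint_Ioc_of_le le_rfl) measurableSet_Ioc
    · exact i0.mono_set (Set.Ioc_subset_Ioc_right ht10.le)
    · exact i0.mono_set (Set.Ioc_subset_Ioc_left ht1pos.le)
  have hA : ∫ u in Set.Ioc 0 t1, (t0 - u) ^ (α - 1) * fml α α u ≤
      r * ∫ u in Set.Ioc 0 t1, (t1 - u) ^ (α - 1) * fml α α u := by
    rw [← integral_const_mul, integral_Ioc_eq_integral_Ioo, integral_Ioc_eq_integral_Ioo]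
    apply setIntegral_mono_on
    · exact i0.mono_set (fun u hu => ⟨hu.1, by linarith [hu.2]⟩)
    · exact (i1.mono_set Set.Ioo_subset_Ioc_self).const_mul r
    · exact measurableSet_Ioo
    · intro u hu
      have hfu := (hfpos u hu.1 (hu.2.trans ht10)).le
      rw [← mul_assoc]
      apply mul_le_mul_of_nonneg_right _ hfu
      have hu1 : 0 < t1 - u := by linarith [hu.2]
      rw [hr, ← Real.mul_rpow (by positivity) hu1.le]
      apply Real.rpow_le_rpow_of_nonpos (by positivity) _ (by linarith)
      rw [div_mul_eq_mul_div, div_le_iff₀ ht1pos]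
      nlinarith [hu.1]
  have hker : ∫ u in Set.Ioc t1 t0, (t0 - u) ^ (α - 1) = (t0 - t1) ^ α / α := by
    rw [← intervalIntegral.integral_of_le ht10.le,
      intervalIntegral.integral_comp_sub_left (fun x => x ^ (α - 1)) t0,
      integral_rpow (Or.inl (by linarith))]
    simp [Real.zero_rpow hα.ne']
  have hkeri : IntegrableOn (fun u : ℝ => (t0 - u) ^ (α - 1)) (Set.Ioc t1 t0) := by
    apply Integrable.of_integral_ne_zero
    rw [hker]
    have : 0 < t0 - t1 := by linarith
    positivity
  have hB : ∫ u in Set.Ioc t1 t0, (t0 - u) ^ (α - 1) * fml α α u ≤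
      (t0 - t1) ^ α / α * fml α α t1 := by
    rw [← hker, ← integral_mul_const]
    apply setIntegral_mono_on
    · exact i0.mono_set (Set.Ioc_subset_Ioc_left ht1pos.le)
    · exact hkeri.mul_const _
    · exact measurableSet_Ioc
    · intro u hu
      apply mul_le_mul_of_nonneg_left
      · exact hmax' u ⟨by linarith [ht1.1, hu.1], hu.2⟩
      · exact Real.rpow_nonneg (by linarith [hu.2]) _
  have hC : (t0 - t1) ^ α / α < Real.Gamma α / 2 := by
    refine lt_of_le_of_lt ?_ hδ
    have : t0 - t1 ≤ δ := by linarith [ht1.1]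
    have : 0 ≤ t0 - t1 := by linarith
    gcongr
  have e1 : r * (Real.Gamma α * fml α α t1) +
      r * (∫ u in Set.Ioc 0 t1, (t1 - u) ^ (α - 1) * fml α α u) = t0 ^ (α - 1) := by
    rw [← hrt, ← v1]; ring
  have e2 : Real.Gamma α * fml α α t0 ≤ 0 := mul_nonpos_of_nonneg_of_nonpos hΓ.le hft0
  have e3 : (t0 - t1) ^ α / α * fml α α t1 < Real.Gamma α / 2 * fml α α t1 :=
    mul_lt_mul_of_pos_right hC hft1
  have e4 : 1 / 2 * (Real.Gamma α * fml α α t1) ≤ r * (Real.Gamma α * fml α α t1) :=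
    mul_le_mul_of_nonneg_right hr12 (by positivity)
  linarith

lemma fml_nonneg {α b : ℝ} (hα : 0 < α) (hα1 : α ≤ 1) (hb : α ≤ b) {t : ℝ} (ht : 0 < t) :
    0 ≤ fml α b t := by
  rcases hb.lt_or_eq with h | h
  · have hc := conv_integral hα (sub_pos.2 h) hα ht
    rw [sub_add_cancel] at hc
    have hΓ := Real.Gamma_pos_of_pos (sub_pos.2 h)
    have : 0 ≤ Real.Gamma (b - α) * fml α b t := by
      rw [← hc]
      apply setIntegral_nonneg measurableSet_Ioc
      intro u hu
      exact mul_nonneg (Real.rpow_nonneg (by linarith [hu.2]) _) (fml_pos hα hα1 hu.1).le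
    exact nonneg_of_mul_nonneg_right this hΓ
  · rw [← h]; exact (fml_pos hα hα1 ht).le

lemma fml_measurable {α b : ℝ} (hα : 0 < α) (hb : 0 < b) : Measurable (fml α b) := by
  have hcont : Continuous (fun u : ℝ => mittagLeffler α b (-u ^ α)) :=
    (ml_continuous hα hb).comp (Real.continuous_rpow_const hα.le).neg
  exact (measurable_id.pow_const _).mul hcont.measurable

lemma gamma_lintegral {a l : ℝ} (ha : 0 < a) (hl : 0 < l) :
    ∫⁻ t in Set.Ioi (0:ℝ), ENNReal.ofReal (Real.exp (-(l * t)) * t ^ (a - 1)) =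
      ENNReal.ofReal (l ^ (-a) * Real.Gamma a) := by
  have h := Real.integral_rpow_mul_exp_neg_mul_Ioi ha hl
  have hΓ := Real.Gamma_pos_of_pos ha
  have hval : ∫ t in Set.Ioi (0:ℝ), Real.exp (-(l * t)) * t ^ (a - 1) =
      l ^ (-a) * Real.Gamma a := by
    rw [Real.rpow_neg hl.le, ← Real.inv_rpow hl.le, ← one_div, ← h]
    congr 1; ext t; ring
  rw [← hval, ofReal_integral_eq_lintegral_ofReal]
  · apply Integrable.of_integral_ne_zero
    rw [hval]; positivity
  · filter_upwards [ae_restrict_mem measurableSet_Ioi] with t ht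
    have : (0:ℝ) < t := ht
    simp only [Pi.zero_apply]; positivity

lemma laplace {α b l : ℝ} (hα : 0 < α) (hα1 : α ≤ 1) (hb : α ≤ b) (hl : 0 < l) :
    ∫⁻ t in Set.Ioi (0:ℝ), ENNReal.ofReal (Real.exp (-(l * t)) * fml α b t) =
      ENNReal.ofReal (l ^ (α - b) / (1 + l ^ α)) := by
  have hb0 : 0 < b := by linarith
  have hΓ := Real.Gamma_pos_of_pos hα
  have hΓb := Real.Gamma_pos_of_pos hb0
  set F := ∫⁻ t in Set.Ioi (0:ℝ), ENNReal.ofReal (Real.exp (-(l * t)) * fml α b t) with hF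
  set A : ℝ → ENNReal := (Set.Ioi (0:ℝ)).indicator
    (fun v => ENNReal.ofReal (Real.exp (-(l * v)) * v ^ (α - 1))) with hA
  set B : ℝ → ENNReal := (Set.Ioi (0:ℝ)).indicator
    (fun v => ENNReal.ofReal (Real.exp (-(l * v)) * fml α b v)) with hB
  have hmf := fml_measurable hα hb0
  have hAm : Measurable A := by
    apply Measurable.indicator _ measurableSet_Ioi
    fun_prop
  have hBm : Measurable B := by
    apply Measurable.indicator _ measurableSet_Ioi
    fun_prop
  have hAint : ∫⁻ v, A v = ENNReal.ofReal (l ^ (-α) * Real.Gamma α) := by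
    rw [hA, lintegral_indicator measurableSet_Ioi, gamma_lintegral hα hl]
  have hBint : ∫⁻ v, B v = F := by
    rw [hB, lintegral_indicator measurableSet_Ioi]
  have hconv : ∫⁻ t, ∫⁻ u, A (t - u) * B u = (∫⁻ v, A v) * ∫⁻ v, B v := by
    rw [lintegral_lintegral_swap]
    · rw [← lintegral_const_mul _ hBm]
      congr 1; ext u
      rw [lintegral_mul_const _ (by fun_prop), lintegral_sub_right_eq_self A u]
    · apply Measurable.aemeasurable
      fun_prop
  have hneg : ∀ t : ℝ, t ≤ 0 → ∫⁻ u, A (t - u) * B u = 0 := by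
    intro t ht
    rw [← lintegral_zero (μ := (volume : Measure ℝ))]
    congr 1; ext u
    by_cases hu : 0 < u
    · have : A (t - u) = 0 := by
        rw [hA]; apply Set.indicator_of_notMem
        simp only [Set.mem_Ioi]; linarith
      rw [this, zero_mul]
    · have : B u = 0 := by
        rw [hB]; apply Set.indicator_of_notMem
        simpa using hu
      rw [this, mul_zero]
  have hpos : ∀ t : ℝ, 0 < t → ∫⁻ u, A (t - u) * B u =
      ENNReal.ofReal (Real.exp (-(l * t)) *
        ∫ u in Set.Ioc 0 t, (t - u) ^ (α - 1) * fml α b u) := by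
    intro t ht
    rw [integral_Ioc_eq_integral_Ioo, ← integral_const_mul, ofReal_integral_eq_lintegral_ofReal,
      ← lintegral_indicator measurableSet_Ioo]
    · congr 1; ext u
      by_cases hu : u ∈ Set.Ioo 0 t
      · have h1 : (0:ℝ) < t - u := by linarith [hu.2]
        rw [Set.indicator_of_mem hu, hA, hB, Set.indicator_of_mem (show t - u ∈ Set.Ioi 0 from h1),
          Set.indicator_of_mem (show u ∈ Set.Ioi 0 from hu.1), ← ENNReal.ofReal_mul (by positivity)]
        congr 1
        have : Real.exp (-(l * t)) = Real.exp (-(l * (t - u))) * Real.exp (-(l * u)) := by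
          rw [← Real.exp_add]; congr 1; ring
        rw [this]; ring
      · rw [Set.indicator_of_notMem hu]
        by_cases hu0 : 0 < u
        · have : A (t - u) = 0 := by
            rw [hA]; apply Set.indicator_of_notMem
            intro h
            exact hu ⟨hu0, by simpa using h⟩
          rw [this, zero_mul]
        · have : B u = 0 := by
            rw [hB]; apply Set.indicator_of_notMem
            simpa using hu0
          rw [this, mul_zero]
    · exact ((conv_integrable hα hα hb0 ht).mono_set Set.Ioo_subset_Ioc_self).const_mul _
    · filter_upwards [ae_restrict_mem measurableSet_Ioo] with u hu
      have h1 := fml_nonneg hα hα1 hb hu.1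
      have h2 := Real.rpow_nonneg (sub_nonneg.2 hu.2.le) (α - 1)
      simp only [Pi.zero_apply]; positivity
  have hconv2 : ∫⁻ t, ∫⁻ u, A (t - u) * B u = ∫⁻ t in Set.Ioi (0:ℝ), ∫⁻ u, A (t - u) * B u := by
    rw [← lintegral_indicator measurableSet_Ioi]
    congr 1; ext t
    by_cases ht : 0 < t
    · rw [Set.indicator_of_mem (show t ∈ Set.Ioi 0 from ht)]
    · rw [Set.indicator_of_notMem (by simpa using ht), hneg t (not_lt.1 ht)]
  have hmain : ENNReal.ofReal (Real.Gamma α) * F +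
      ENNReal.ofReal (l ^ (-α) * Real.Gamma α) * F =
      ENNReal.ofReal (Real.Gamma α * l ^ (-b)) := by
    rw [← hAint]
    nth_rewrite 2 [← hBint]
    rw [← hconv, hconv2, hF, ← lintegral_const_mul _ (by fun_prop), ← lintegral_add_left (by fun_prop)]
    have : Real.Gamma α * l ^ (-b) = (Real.Gamma α / Real.Gamma b) * (l ^ (-b) * Real.Gamma b) := by
      field_simp
    rw [this, ENNReal.ofReal_mul (by positivity), ← gamma_lintegral hb0 hl,
      ← lintegral_const_mul _ (by fun_prop)]
    refine setLIntegral_congr_fun measurableSet_Ioi fun t ht => ?_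
    have ht' : (0:ℝ) < t := ht
    have hv := volterra hα hb0 ht'
    have h1 := fml_nonneg hα hα1 hb ht'
    rw [hpos t ht', ← ENNReal.ofReal_mul hΓ.le, ← ENNReal.ofReal_mul (by positivity),
      ← ENNReal.ofReal_add (by positivity)]
    · congr 1
      linear_combination Real.exp (-(l * t)) * hv
    · apply mul_nonneg (Real.exp_pos _).le
      apply setIntegral_nonneg measurableSet_Ioc
      intro u hu
      exact mul_nonneg (Real.rpow_nonneg (by linarith [hu.2]) _) (fml_nonneg hα hα1 hb hu.1)
  rw [← add_mul, ← ENNReal.ofReal_add (by positivity) (by positivity)] at hmain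
  have hK : 0 < Real.Gamma α + l ^ (-α) * Real.Gamma α := by positivity
  have hF' : F = ENNReal.ofReal (Real.Gamma α * l ^ (-b)) /
      ENNReal.ofReal (Real.Gamma α + l ^ (-α) * Real.Gamma α) := by
    rw [ENNReal.eq_div_iff (by simpa using hK) ENNReal.ofReal_ne_top]
    exact hmain
  rw [hF', ← ENNReal.ofReal_div_of_pos hK]
  congr 1
  rw [Real.rpow_sub hl, Real.rpow_neg hl.le, Real.rpow_neg hl.le]
  have := Real.rpow_pos_of_pos hl α
  have := Real.rpow_pos_of_pos hl b
  field_simp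
  ring

lemma last_lintegral {α c : ℝ} (hα : 0 < α) (hc : 0 < c) (hc1 : c < 1) :
    ∫⁻ l in Set.Ioi (0:ℝ), ENNReal.ofReal (l ^ (α * c - 1) / (1 + l ^ α)) =
      ENNReal.ofReal (Real.Gamma c * Real.Gamma (1 - c) / α) := by
  have hΓ := Real.Gamma_pos_of_pos hc
  have hΓ' := Real.Gamma_pos_of_pos (sub_pos.2 hc1)
  have h1 : ∀ l ∈ Set.Ioi (0:ℝ), ENNReal.ofReal (l ^ (α * c - 1) / (1 + l ^ α)) =
      ∫⁻ v in Set.Ioi (0:ℝ), ENNReal.ofReal (l ^ (α * c - 1) * Real.exp (-((1 + l ^ α) * v))) := by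
    intro l hl
    have hl' : (0:ℝ) < l := hl
    have hp : 0 < 1 + l ^ α := by positivity
    have h := gamma_lintegral one_pos hp
    simp only [sub_self, Real.rpow_zero, mul_one, Real.Gamma_one, Real.rpow_neg_one] at h
    rw [div_eq_mul_inv, ENNReal.ofReal_mul (by positivity), ← h,
      ← lintegral_const_mul _ (by fun_prop)]
    congr 1; ext v
    rw [ENNReal.ofReal_mul (by positivity)]
  rw [setLIntegral_congr_fun measurableSet_Ioi h1, lintegral_lintegral_swap]
  swap
  · apply Measurable.aemeasurable
    fun_prop
  have h2 : ∀ v ∈ Set.Ioi (0:ℝ), ∫⁻ l in Set.Ioi (0:ℝ),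
      ENNReal.ofReal (l ^ (α * c - 1) * Real.exp (-((1 + l ^ α) * v))) =
      ENNReal.ofReal (Real.Gamma c / α) *
        ENNReal.ofReal (Real.exp (-(1 * v)) * v ^ ((1 - c) - 1)) := by
    intro v hv
    have hv' : (0:ℝ) < v := hv
    have hαc : 0 < α * c := by positivity
    have h := integral_rpow_mul_exp_neg_mul_rpow hα (show -1 < α * c - 1 by linarith) hv'
    have e1 : (α * c - 1 + 1) / α = c := by field_simp; ring
    rw [neg_div, e1] at h
    have hval : ∫ l in Set.Ioi (0:ℝ), l ^ (α * c - 1) * Real.exp (-((1 + l ^ α) * v)) =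
        (Real.Gamma c / α) * (Real.exp (-(1 * v)) * v ^ ((1 - c) - 1)) := by
      have : ∀ l : ℝ, l ^ (α * c - 1) * Real.exp (-((1 + l ^ α) * v)) =
          Real.exp (-v) * (l ^ (α * c - 1) * Real.exp (-v * l ^ α)) := by
        intro l
        rw [show -((1 + l ^ α) * v) = -v + -v * l ^ α by ring, Real.exp_add]; ring
      simp_rw [this]
      rw [integral_const_mul, h, one_mul, show 1 - c - 1 = -c by ring]
      ring
    rw [← ENNReal.ofReal_mul (by positivity), ← hval, ofReal_integral_eq_lintegral_ofReal]
    · apply Integrable.of_integral_ne_zero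
      rw [hval]; positivity
    · filter_upwards [ae_restrict_mem measurableSet_Ioi] with t ht
      have : (0:ℝ) < t := ht
      simp only [Pi.zero_apply]; positivity
  rw [setLIntegral_congr_fun measurableSet_Ioi h2, lintegral_const_mul _ (by fun_prop),
    gamma_lintegral (sub_pos.2 hc1) one_pos, ← ENNReal.ofReal_mul (by positivity)]
  congr 1
  rw [Real.one_rpow]; ring

lemma mellin_lintegral {α b s : ℝ} (hα : 0 < α) (hα1 : α ≤ 1) (hb : α ≤ b)
    (hs : 0 < s) (hs1 : s < 1) :
    ∫⁻ t in Set.Ioi (0:ℝ), ENNReal.ofReal (t ^ (-(b - α * s)) * fml α b t) =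
      ENNReal.ofReal (Real.Gamma s * Real.Gamma (1 - s) / α / Real.Gamma (b - α * s)) := by
  have hb0 : 0 < b := by linarith
  have hp : 0 < b - α * s := by nlinarith
  set p := b - α * s with hpdef
  have hΓ := Real.Gamma_pos_of_pos hp
  have hmf := fml_measurable hα hb0
  have h1 : ENNReal.ofReal (Real.Gamma p) *
      ∫⁻ t in Set.Ioi (0:ℝ), ENNReal.ofReal (t ^ (-p) * fml α b t) =
      ENNReal.ofReal (Real.Gamma s * Real.Gamma (1 - s) / α) := by
    rw [← lintegral_const_mul _ (by fun_prop)]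
    have h2 : ∀ t ∈ Set.Ioi (0:ℝ), ENNReal.ofReal (Real.Gamma p) *
        ENNReal.ofReal (t ^ (-p) * fml α b t) =
        ∫⁻ l in Set.Ioi (0:ℝ), ENNReal.ofReal (Real.exp (-(l * t)) * l ^ (p - 1)) *
          ENNReal.ofReal (fml α b t) := by
      intro t ht
      have ht' : (0:ℝ) < t := ht
      rw [lintegral_mul_const _ (by fun_prop)]
      simp_rw [mul_comm _ t]
      rw [gamma_lintegral hp ht', ← ENNReal.ofReal_mul hΓ.le, ← ENNReal.ofReal_mul (by positivity)]
      congr 1; ring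
    rw [setLIntegral_congr_fun measurableSet_Ioi h2, lintegral_lintegral_swap]
    swap
    · apply Measurable.aemeasurable
      fun_prop
    have h3 : ∀ l ∈ Set.Ioi (0:ℝ), ∫⁻ t in Set.Ioi (0:ℝ),
        ENNReal.ofReal (Real.exp (-(l * t)) * l ^ (p - 1)) * ENNReal.ofReal (fml α b t) =
        ENNReal.ofReal (l ^ (α * (1 - s) - 1) / (1 + l ^ α)) := by
      intro l hl
      have hl' : (0:ℝ) < l := hl
      have : ∀ t : ℝ, ENNReal.ofReal (Real.exp (-(l * t)) * l ^ (p - 1)) *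
          ENNReal.ofReal (fml α b t) =
          ENNReal.ofReal (l ^ (p - 1)) * ENNReal.ofReal (Real.exp (-(l * t)) * fml α b t) := by
        intro t
        rw [← ENNReal.ofReal_mul (by positivity), ← ENNReal.ofReal_mul (by positivity)]
        congr 1; ring
      simp_rw [this]
      rw [lintegral_const_mul _ (by fun_prop), laplace hα hα1 hb hl',
        ← ENNReal.ofReal_mul (by positivity), ← mul_div_assoc, ← Real.rpow_add hl']
      congr 3
      rw [hpdef]; ring
    rw [setLIntegral_congr_fun measurableSet_Ioi h3,
      last_lintegral hα (sub_pos.2 hs1) (by linarith)]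
    congr 2
    rw [sub_sub_cancel, mul_comm]
  rw [ENNReal.ofReal_div_of_pos hΓ, ENNReal.eq_div_iff (by simpa using hΓ) ENNReal.ofReal_ne_top]
  exact h1

end MLProof

open MLProof in
theorem mittagLeffler_mellin_transform (α β s : ℝ)
    (hα : α ∈ Set.Ioc (0 : ℝ) 1) (hβ : α ≤ β) (hs : s ∈ Set.Ioo (0 : ℝ) 1) :
    IntegrableOn (fun x : ℝ => mittagLeffler α β (-x) * x ^ (s - 1)) (Set.Ioi 0) ∧
    ∫ x in Set.Ioi (0 : ℝ), mittagLeffler α β (-x) * x ^ (s - 1) =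
      Real.Gamma s * Real.Gamma (1 - s) / Real.Gamma (β - α * s) := by
  obtain ⟨hα0, hα1⟩ := hα
  obtain ⟨hs0, hs1⟩ := hs
  have hb0 : 0 < β := by linarith
  have hp : 0 < β - α * s := by nlinarith
  have hG1 := Real.Gamma_pos_of_pos hs0
  have hG2 := Real.Gamma_pos_of_pos (sub_pos.2 hs1)
  have hG3 := Real.Gamma_pos_of_pos hp
  have hmf := fml_measurable hα0 hb0
  have hval : ∫ x in Set.Ioi (0 : ℝ), mittagLeffler α β (-x) * x ^ (s - 1) =
      Real.Gamma s * Real.Gamma (1 - s) / Real.Gamma (β - α * s) := by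
    rw [← integral_comp_rpow_Ioi_of_pos hα0]
    have h1 : ∀ t ∈ Set.Ioi (0:ℝ),
        (α * t ^ (α - 1)) • (mittagLeffler α β (-t ^ α) * (t ^ α) ^ (s - 1)) =
        α * (t ^ (-(β - α * s)) * fml α β t) := by
      intro t ht
      have ht' : (0:ℝ) < t := ht
      have e1 : t ^ (α - 1) * (t ^ α) ^ (s - 1) = t ^ (-(β - α * s)) * t ^ (β - 1) := by
        rw [← Real.rpow_mul ht'.le, ← Real.rpow_add ht', ← Real.rpow_add ht']
        congr 1; ring
      rw [smul_eq_mul, fml]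
      linear_combination α * mittagLeffler α β (-t ^ α) * e1
    rw [setIntegral_congr_fun measurableSet_Ioi h1, integral_const_mul,
      integral_eq_lintegral_of_nonneg_ae, mellin_lintegral hα0 hα1 hβ hs0 hs1,
      ENNReal.toReal_ofReal (by positivity)]
    · field_simp
    · filter_upwards [ae_restrict_mem measurableSet_Ioi] with t ht
      exact mul_nonneg (Real.rpow_nonneg (le_of_lt ht) _) (fml_nonneg hα0 hα1 hβ ht)
    · exact Measurable.aestronglyMeasurable (by fun_prop)
  refine ⟨?_, hval⟩
  apply Integrable.of_integral_ne_zero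
  rw [hval]
  positivity
end

section
/- For every α ∈ (0,1), one has x (log x)^α L_α(−x) → 1/Γ(1−α) as x → +∞; that is, L_α(−x) is asymptotically equivalent to 1/(Γ(1−α) · x · (log x)^α) as x → +∞. -/
open Filter

/-- The Le Roy function `L_α(x)`. -/
noncomputable def leRoy (α : ℝ) (x : ℝ) : ℝ :=
  ∑' n : ℕ, x ^ n / (n.factorial : ℝ) ^ α

open MeasureTheory Set Topology

/-- `φ` is the moment function (for exponents `> -2`) of a finite measure on `(0,∞)`. -/
def HasMom (φ : ℝ → ℝ) : Prop :=
  ∃ μ : Measure ℝ, IsFiniteMeasure μ ∧ (∀ᵐ w ∂μ, 0 < w) ∧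
    ∀ s : ℝ, -2 < s → Integrable (fun w : ℝ => w ^ s) μ ∧ ∫ w, w ^ s ∂μ = φ s

lemma HasMom.congr {φ ψ : ℝ → ℝ} (h : HasMom φ) (e : ∀ s, -2 < s → φ s = ψ s) : HasMom ψ := by
  obtain ⟨μ, h1, h2, h3⟩ := h
  exact ⟨μ, h1, h2, fun s hs => ⟨(h3 s hs).1, (h3 s hs).2.trans (e s hs)⟩⟩

lemma HasMom.mul {φ ψ : ℝ → ℝ} (hφ : HasMom φ) (hψ : HasMom ψ) :
    HasMom (fun s => φ s * ψ s) := by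
  obtain ⟨μ, h1, h2, h3⟩ := hφ
  obtain ⟨ν, k1, k2, k3⟩ := hψ
  have hmeas : Measurable (fun p : ℝ × ℝ => p.1 * p.2) := by fun_prop
  have hpos : ∀ᵐ p ∂(μ.prod ν), 0 < p.1 ∧ 0 < p.2 := by
    have a1 : ∀ᵐ p ∂(μ.prod ν), 0 < p.1 := Measure.quasiMeasurePreserving_fst.ae h2
    have a2 : ∀ᵐ p ∂(μ.prod ν), 0 < p.2 := Measure.quasiMeasurePreserving_snd.ae k2
    filter_upwards [a1, a2] with p q r using ⟨q, r⟩
  refine ⟨(μ.prod ν).map (fun p => p.1 * p.2), inferInstance, ?_, ?_⟩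
  · rw [ae_map_iff hmeas.aemeasurable (measurableSet_Ioi : MeasurableSet {x : ℝ | 0 < x})]
    filter_upwards [hpos] with p hp using mul_pos hp.1 hp.2
  · intro s hs
    have hms : Measurable (fun w : ℝ => w ^ s) := by fun_prop
    have e : (fun p : ℝ × ℝ => p.1 ^ s * p.2 ^ s) =ᵐ[μ.prod ν] fun p => (p.1 * p.2) ^ s := by
      filter_upwards [hpos] with p hp
      rw [Real.mul_rpow hp.1.le hp.2.le]
    constructor
    · rw [integrable_map_measure hms.aestronglyMeasurable hmeas.aemeasurable]
      exact ((h3 s hs).1.mul_prod (k3 s hs).1).congr e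
    · rw [integral_map hmeas.aemeasurable hms.aestronglyMeasurable, ← integral_congr_ae e,
        integral_prod_mul (fun w : ℝ => w ^ s) (fun w : ℝ => w ^ s), (h3 s hs).2, (k3 s hs).2]

lemma hasMom_const_mul_rpow {c b : ℝ} (hc : 0 ≤ c) (hb : 0 < b) :
    HasMom (fun s => c * b ^ s) := by
  refine ⟨ENNReal.ofReal c • Measure.dirac b, ⟨by simp⟩, ?_, ?_⟩
  · refine Measure.ae_smul_measure ?_ _
    rw [ae_dirac_iff (measurableSet_Ioi : MeasurableSet {x : ℝ | 0 < x})]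
    exact hb
  · intro s hs
    refine ⟨Integrable.smul_measure (integrable_dirac (by simp)) (by simp), ?_⟩
    rw [integral_smul_measure, integral_dirac]
    simp [hc]

lemma integral_gam {β r : ℝ} (hβ : 0 < β) (hr : 0 < r) :
    IntegrableOn (fun t : ℝ => t ^ (β - 1) * Real.exp (-(r * t))) (Ioi 0) ∧
    ∫ t in Ioi (0:ℝ), t ^ (β - 1) * Real.exp (-(r * t)) = r ^ (-β) * Real.Gamma β := by
  have h := Real.integral_rpow_mul_exp_neg_mul_Ioi hβ hr
  have h' : (1 / r) ^ β = r ^ (-β) := by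
    rw [one_div, Real.inv_rpow hr.le, Real.rpow_neg hr.le]
  rw [h'] at h
  refine ⟨?_, h⟩
  by_contra hcon
  have : ∫ t in Ioi (0:ℝ), t ^ (β - 1) * Real.exp (-(r * t)) = 0 := integral_undef hcon
  rw [this] at h
  have := Real.Gamma_pos_of_pos hβ
  have : 0 < r ^ (-β) * Real.Gamma β := by positivity
  linarith

lemma hasMom_base {β a : ℝ} (hβ : 0 < β) (ha : 2 ≤ a) : HasMom (fun s => (s + a) ^ (-β)) := by
  have hG := Real.Gamma_pos_of_pos hβ
  set d : ℝ → ℝ := fun t => (Real.Gamma β)⁻¹ * (t ^ (β - 1) * Real.exp (-(a * t))) with hd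
  have hdm : Measurable d := by fun_prop
  have hdn : ∀ t ∈ Ioi (0:ℝ), 0 ≤ d t := by
    intro t ht
    have : (0:ℝ) < t := ht
    positivity
  have hdi : IntegrableOn d (Ioi 0) := (integral_gam hβ (by linarith : 0 < a)).1.const_mul _
  set μ0 : Measure ℝ := (volume.restrict (Ioi 0)).withDensity (fun t => ENNReal.ofReal (d t))
  have hem : Measurable (fun t : ℝ => Real.exp (-t)) := by fun_prop
  have hfin : IsFiniteMeasure μ0 := isFiniteMeasure_withDensity_ofReal hdi.2
  refine ⟨μ0.map (fun t => Real.exp (-t)), inferInstance, ?_, ?_⟩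
  · rw [ae_map_iff hem.aemeasurable (measurableSet_Ioi : MeasurableSet {x : ℝ | 0 < x})]
    exact Eventually.of_forall fun t => Real.exp_pos _
  · intro s hs
    have hms : Measurable (fun w : ℝ => w ^ s) := by fun_prop
    have hsa : 0 < s + a := by linarith
    have e : ∀ t : ℝ, (Real.exp (-t)) ^ s = Real.exp (-(s * t)) := fun t => by
      rw [← Real.exp_mul]; ring_nf
    have ke : ∀ᵐ t ∂(volume.restrict (Ioi (0:ℝ))),
        (Real.Gamma β)⁻¹ * (t ^ (β - 1) * Real.exp (-((s + a) * t))) =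
        (ENNReal.ofReal (d t)).toReal • Real.exp (-(s * t)) := by
      filter_upwards [ae_restrict_mem measurableSet_Ioi] with t ht
      rw [ENNReal.toReal_ofReal (hdn t ht), smul_eq_mul, hd]
      simp only
      rw [show -((s + a) * t) = -(a * t) + -(s * t) by ring, Real.exp_add]
      ring
    obtain ⟨g1, g2⟩ := integral_gam hβ hsa
    constructor
    · rw [integrable_map_measure hms.aestronglyMeasurable hem.aemeasurable]
      simp only [Function.comp_def, e]
      rw [integrable_withDensity_iff_integrable_smul' (by fun_prop) (by simp)]
      exact (g1.const_mul _).congr ke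
    · rw [integral_map hem.aemeasurable hms.aestronglyMeasurable]
      simp only [e]
      rw [integral_withDensity_eq_integral_toReal_smul (by fun_prop) (by simp),
        ← integral_congr_ae ke, integral_const_mul, g2]
      field_simp

lemma hasMom_prod {β : ℝ} (hβ : 0 < β) (n : ℕ) :
    HasMom (fun s => ∏ j ∈ Finset.range n, (s + 2 + j) ^ (-β)) := by
  induction n with
  | zero => exact (hasMom_const_mul_rpow zero_le_one zero_lt_one).congr (by simp)
  | succ n ih =>
    refine (ih.mul (hasMom_base hβ (a := 2 + n) (by simp))).congr fun s hs => ?_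
    rw [Finset.prod_range_succ, add_assoc]

lemma hasMom_GammaSeq {β : ℝ} (hβ : 0 < β) {n : ℕ} (hn : 0 < n) :
    HasMom (fun s => Real.GammaSeq (s + 2) n ^ β) := by
  have hn' : (0:ℝ) < n := by exact_mod_cast hn
  refine ((hasMom_const_mul_rpow (c := ((n:ℝ) ^ (2:ℝ) * n.factorial) ^ β) (b := (n:ℝ) ^ β)
    (by positivity) (by positivity)).mul (hasMom_prod hβ (n + 1))).congr fun s hs => ?_
  have hpos : ∀ j ∈ Finset.range (n+1), 0 ≤ s + 2 + (j:ℝ) := fun j _ => by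
    have : (0:ℝ) ≤ j := by positivity
    linarith
  have hp : 0 ≤ ∏ j ∈ Finset.range (n + 1), (s + 2 + (j:ℝ)) := Finset.prod_nonneg hpos
  rw [Real.GammaSeq, Real.div_rpow (by positivity) hp, Real.finsetProd_rpow _ _ hpos,
    Real.rpow_neg hp, Real.rpow_add hn', ← Real.rpow_mul hn'.le, mul_comm β s,
    Real.rpow_mul hn'.le, div_eq_mul_inv, ← Real.mul_rpow (by positivity) (by positivity)]
  ring_nf

lemma GammaSeq_nat_eq (m n : ℕ) :
    Real.GammaSeq ((m:ℝ) + 2) n =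
      (n:ℝ) ^ (m + 2) * n.factorial * (m + 1).factorial / (m + n + 2).factorial := by
  have key : ∀ k : ℕ, (∏ j ∈ Finset.range k, ((m:ℝ) + 2 + j)) * (m + 1).factorial =
      (m + 1 + k).factorial := by
    intro k
    induction k with
    | zero => simp
    | succ k ih =>
      rw [Finset.prod_range_succ, mul_right_comm, ih, ← add_assoc, Nat.factorial_succ (m + 1 + k)]
      push_cast
      ring
  have hk := key (n + 1)
  rw [show m + 1 + (n + 1) = m + n + 2 by ring] at hk
  have hp : (∏ j ∈ Finset.range (n + 1), ((m:ℝ) + 2 + j)) ≠ 0 :=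
    Finset.prod_ne_zero_iff.2 fun j _ => by positivity
  rw [Real.GammaSeq, ← hk, show (m:ℝ) + 2 = ((m + 2 : ℕ) : ℝ) by push_cast; ring,
    Real.rpow_natCast]
  push_cast
  have : ((m + 1).factorial : ℝ) ≠ 0 := by positivity
  field_simp

lemma GammaSeq_nat_nonneg (m n : ℕ) : 0 ≤ Real.GammaSeq ((m:ℝ) + 2) n := by
  rw [GammaSeq_nat_eq]; positivity

lemma GammaSeq_nat_le (m n : ℕ) : Real.GammaSeq ((m:ℝ) + 2) n ≤ (m + 1).factorial := by
  rw [GammaSeq_nat_eq, div_le_iff₀ (by positivity), mul_comm]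
  gcongr
  have h : n.factorial * (n + 1) ^ (m + 2) ≤ (n + (m + 2)).factorial :=
    Nat.factorial_mul_pow_le_factorial
  have h2 : (n ^ (m + 2) * n.factorial : ℕ) ≤ (m + n + 2).factorial := by
    calc n ^ (m + 2) * n.factorial ≤ (n + 1) ^ (m + 2) * n.factorial := by gcongr; omega
      _ ≤ (n + (m + 2)).factorial := by rw [mul_comm]; exact h
      _ = _ := by congr 1; ring
  exact_mod_cast h2

lemma summable_dom {β : ℝ} (hβ : β ∈ Ioo (0:ℝ) 1) (z : ℝ) :
    Summable (fun m : ℕ => z ^ m / m.factorial * ((m + 1).factorial : ℝ) ^ β) := by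
  by_cases hz : z = 0
  · refine summable_of_ne_finset_zero (s := {0}) fun m hm => ?_
    simp at hm
    simp [hz, hm]
  refine summable_of_ratio_test_tendsto_lt_one zero_lt_one
    (Eventually.of_forall fun m => ?_) ?_
  · positivity
  · have e : ∀ m : ℕ, ‖z ^ (m+1) / (m+1).factorial * ((m + 1 + 1).factorial : ℝ) ^ β‖ /
        ‖z ^ m / m.factorial * ((m + 1).factorial : ℝ) ^ β‖ =
        |z| * (((m:ℝ) + 2) / (m + 1) * ((m:ℝ) + 2) ^ (-(1 - β))) := by
      intro m
      have h2 : (0:ℝ) < (m:ℝ) + 2 := by positivity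
      rw [Nat.factorial_succ (m + 1), Nat.cast_mul, Real.mul_rpow (by positivity) (by positivity),
        Nat.factorial_succ m, show -(1 - β) = β - 1 by ring, Real.rpow_sub h2, Real.rpow_one,
        show (((m + 1 + 1 : ℕ)) : ℝ) = (m:ℝ) + 2 by push_cast; ring]
      simp only [norm_mul, norm_div, norm_pow, Real.norm_eq_abs, Nat.abs_cast]
      have a1 : |((m:ℝ) + 2) ^ β| = ((m:ℝ) + 2) ^ β := abs_of_pos (by positivity)
      have a2 : (0:ℝ) < |(((m + 1) * m.factorial : ℕ) : ℝ) ^ β| := by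
        have : (0:ℝ) < (((m + 1) * m.factorial : ℕ) : ℝ) := by positivity
        positivity
      have a3 : 0 < |z| := by positivity
      rw [a1]
      push_cast at a2 ⊢
      field_simp
      ring
    simp_rw [e]
    have t1 : Tendsto (fun m : ℕ => (m:ℝ) + 2) atTop atTop :=
      tendsto_atTop_add_const_right _ _ tendsto_natCast_atTop_atTop
    have t2 := (tendsto_rpow_neg_atTop (show 0 < 1 - β by linarith [hβ.2])).comp t1
    have t3 : Tendsto (fun m : ℕ => ((m:ℝ) + 2) / (m + 1)) atTop (𝓝 1) := by
      have : Tendsto (fun m : ℕ => 1 + 1 / ((m:ℝ) + 1)) atTop (𝓝 (1 + 0)) :=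
        tendsto_const_nhds.add tendsto_one_div_add_atTop_nhds_zero_nat
      rw [add_zero] at this
      refine this.congr fun m => ?_
      field_simp; ring
    simpa using (t3.mul t2).const_mul |z|

lemma exp_neg_le_rpow {u : ℝ} (hu : 0 < u) : Real.exp (-u) ≤ 3 * u ^ (-(3/2) : ℝ) := by
  have h1 : u ^ (3/2 : ℝ) ≤ 3 * Real.exp u := by
    have q := Real.quadratic_le_exp_of_nonneg hu.le
    rcases le_total u 1 with h | h
    · have := Real.rpow_le_one hu.le h (by norm_num : (0:ℝ) ≤ 3/2)
      nlinarith
    · have := Real.rpow_le_rpow_of_exponent_le h (by norm_num : (3/2:ℝ) ≤ 2)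
      rw [Real.rpow_two] at this
      nlinarith
  rw [Real.rpow_neg hu.le, Real.exp_neg, ← div_eq_mul_inv, inv_eq_one_div,
    div_le_div_iff₀ (Real.exp_pos _) (by positivity)]
  linarith

lemma exists_Fn {β : ℝ} (hβ : β ∈ Ioo (0:ℝ) 1) {n : ℕ} (hn : 0 < n) :
    ∃ f : ℝ → ℝ, Measurable f ∧ (∀ z, 0 < z → 0 ≤ f z ∧ f z ≤ 1 ∧
        f z ≤ 3 * z ^ (-(3/2) : ℝ) * Real.GammaSeq (1/2) n ^ β) ∧
      ∫ z in Ioi (0:ℝ), f z = Real.GammaSeq 1 n ^ β ∧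
      ∀ z, 0 < z → HasSum (fun m : ℕ => (-z) ^ m / m.factorial * Real.GammaSeq (m + 2) n ^ β)
        (f z) := by
  obtain ⟨μ, h1, h2, h3⟩ := hasMom_GammaSeq hβ.1 hn
  simp only at h3
  have hmass : μ.real univ = Real.GammaSeq 2 n ^ β := by
    have := (h3 0 (by norm_num)).2
    simpa using this
  have hint : ∀ z : ℝ, 0 < z → Integrable (fun w => Real.exp (-(z * w))) μ := by
    intro z hz
    refine (integrable_const (1:ℝ)).mono' (by fun_prop) ?_
    filter_upwards [h2] with w hw
    rw [Real.norm_eq_abs, Real.abs_exp, Real.exp_le_one_iff]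
    have := mul_pos hz hw
    linarith
  have hsm : StronglyMeasurable (fun z : ℝ => ∫ w, Real.exp (-(z * w)) ∂μ) := by
    apply StronglyMeasurable.integral_prod_right (f := fun z w : ℝ => Real.exp (-(z * w)))
    apply Measurable.stronglyMeasurable
    fun_prop
  refine ⟨fun z => ∫ w, Real.exp (-(z * w)) ∂μ, hsm.measurable, ?_, ?_, ?_⟩
  · intro z hz
    refine ⟨integral_nonneg fun w => (Real.exp_pos _).le, ?_, ?_⟩
    · calc ∫ w, Real.exp (-(z * w)) ∂μ ≤ ∫ w, (1:ℝ) ∂μ := by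
            refine integral_mono_ae (hint z hz) (integrable_const _) ?_
            filter_upwards [h2] with w hw
            rw [Real.exp_le_one_iff]
            have := mul_pos hz hw
            linarith
        _ = Real.GammaSeq 2 n ^ β := by simp [hmass]
        _ ≤ 1 := by
            have a := GammaSeq_nat_nonneg 0 n
            have b := GammaSeq_nat_le 0 n
            simp at a b
            exact Real.rpow_le_one a b hβ.1.le
    · obtain ⟨i1, i2⟩ := h3 (-(3/2)) (by norm_num)
      rw [show (-(3/2) + 2 : ℝ) = 1/2 by norm_num] at i2
      rw [← i2, ← integral_const_mul]
      refine integral_mono_ae (hint z hz) (i1.const_mul _) ?_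
      filter_upwards [h2] with w hw
      have := exp_neg_le_rpow (mul_pos hz hw)
      rwa [Real.mul_rpow hz.le hw.le, ← mul_assoc] at this
  · obtain ⟨i1, i2⟩ := h3 (-1) (by norm_num)
    rw [show (-1 + 2 : ℝ) = 1 by norm_num] at i2
    rw [← i2]
    have hin : ∀ w : ℝ, 0 < w → IntegrableOn (fun z => Real.exp (-(z * w))) (Ioi 0) ∧
        ∫ z in Ioi (0:ℝ), Real.exp (-(z * w)) = w ^ (-1:ℝ) := by
      intro w hw
      have := integral_gam (β := 1) one_pos hw
      simpa [mul_comm] using this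
    rw [integral_integral_swap]
    · refine integral_congr_ae ?_
      filter_upwards [h2] with w hw using (hin w hw).2
    · rw [integrable_prod_iff' (by
        apply Measurable.aestronglyMeasurable; simp only [Function.uncurry_def]; fun_prop)]
      constructor
      · filter_upwards [h2] with w hw using (hin w hw).1
      · refine i1.congr ?_
        filter_upwards [h2] with w hw
        simp only [Function.uncurry_def, Real.norm_eq_abs, Real.abs_exp]
        exact (hin w hw).2.symm
  · intro z hz
    have hm : ∀ m : ℕ, Integrable (fun w : ℝ => w ^ m) μ ∧
        ∫ w, w ^ m ∂μ = Real.GammaSeq (m + 2) n ^ β := by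
      intro m
      have hm0 : (0:ℝ) ≤ m := by positivity
      simpa using h3 m (by linarith)
    have hf : ∀ m : ℕ, (fun w : ℝ => (-(z * w)) ^ m / m.factorial) =
        fun w => ((-z) ^ m / m.factorial) * w ^ m := by
      intro m; ext w; rw [← neg_mul, mul_pow]; ring
    have hS := hasSum_integral_of_summable_integral_norm (μ := μ)
      (F := fun (m : ℕ) (w : ℝ) => (-(z * w)) ^ m / m.factorial)
      (fun m => by rw [hf m]; exact (hm m).1.const_mul _) ?_
    · convert! hS using 1
      · ext m
        rw [hf m, integral_const_mul, (hm m).2]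
      · refine integral_congr_ae (Eventually.of_forall fun w => ?_)
        simp only
        rw [Real.exp_eq_exp_ℝ, NormedSpace.exp_eq_tsum_div]
    · refine Summable.of_nonneg_of_le (fun m => by positivity) (fun m => ?_) (summable_dom hβ z)
      have : ∫ w, ‖(-(z * w)) ^ m / (m.factorial:ℝ)‖ ∂μ =
          z ^ m / m.factorial * Real.GammaSeq (m + 2) n ^ β := by
        rw [← (hm m).2, ← integral_const_mul]
        refine integral_congr_ae ?_
        filter_upwards [h2] with w hw
        simp only [norm_div, norm_pow, norm_neg, norm_mul, Real.norm_eq_abs, Nat.abs_cast,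
          abs_of_pos hz, abs_of_pos hw, mul_pow]
        ring
      rw [this]
      have := Real.rpow_le_rpow (GammaSeq_nat_nonneg m n) (GammaSeq_nat_le m n) hβ.1.le
      gcongr

/-- The auxiliary entire function. -/
noncomputable def auxF (β z : ℝ) : ℝ :=
  ∑' m : ℕ, (-z) ^ m / m.factorial * ((m + 1).factorial : ℝ) ^ β

lemma summable_auxF {β : ℝ} (hβ : β ∈ Ioo (0:ℝ) 1) (z : ℝ) :
    Summable (fun m : ℕ => (-z) ^ m / m.factorial * ((m + 1).factorial : ℝ) ^ β) :=
  summable_dom hβ (-z)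

lemma measurable_auxF {β : ℝ} (hβ : β ∈ Ioo (0:ℝ) 1) : Measurable (auxF β) := by
  refine measurable_of_tendsto_metrizable (f := fun (n : ℕ) (z : ℝ) => ∑ m ∈ Finset.range n,
    (-z) ^ m / m.factorial * ((m + 1).factorial : ℝ) ^ β) (fun n => by fun_prop) ?_
  rw [tendsto_pi_nhds]
  intro z
  exact (summable_auxF hβ z).hasSum.tendsto_sum_nat

lemma auxF_facts {β : ℝ} (hβ : β ∈ Ioo (0:ℝ) 1) :
    ∃ C : ℝ, 0 ≤ C ∧ (∀ z, 0 < z → 0 ≤ auxF β z ∧ auxF β z ≤ 1 ∧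
        auxF β z ≤ C * z ^ (-(3/2) : ℝ)) ∧ IntegrableOn (auxF β) (Ioi 0) ∧
      ∫ z in Ioi (0:ℝ), auxF β z = 1 := by
  choose f hfm hfb hfi hfs using fun n : ℕ => exists_Fn hβ (Nat.succ_pos n)
  have tG : ∀ s : ℝ, Tendsto (fun n : ℕ => Real.GammaSeq s (n + 1) ^ β) atTop
      (𝓝 (Real.Gamma s ^ β)) := fun s =>
    (((Real.GammaSeq_tendsto_Gamma s).comp (tendsto_add_atTop_nat 1))).rpow_const
      (Or.inr hβ.1.le)
  have hlim : ∀ z, 0 < z → Tendsto (fun n => f n z) atTop (𝓝 (auxF β z)) := by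
    intro z hz
    have e : (fun n => f n z) = fun n => ∑' m : ℕ, (-z) ^ m / m.factorial *
        Real.GammaSeq (m + 2) (n + 1) ^ β := funext fun n => (hfs n z hz).tsum_eq.symm
    rw [e]
    refine tendsto_tsum_of_dominated_convergence (summable_dom hβ z) ?_
      (Eventually.of_forall fun n m => ?_)
    · intro m
      have := (tG ((m:ℝ) + 2)).const_mul ((-z) ^ m / (m.factorial:ℝ))
      rwa [show (m:ℝ) + 2 = ((m + 1 : ℕ) : ℝ) + 1 by push_cast; ring,
        Real.Gamma_nat_eq_factorial,
        show ((m + 1 : ℕ) : ℝ) + 1 = (m:ℝ) + 2 by push_cast; ring] at this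
    · have h1 := Real.rpow_le_rpow (GammaSeq_nat_nonneg m (n+1)) (GammaSeq_nat_le m (n+1)) hβ.1.le
      have h0 := Real.rpow_nonneg (GammaSeq_nat_nonneg m (n+1)) β
      simp only [norm_mul, norm_div, norm_pow, norm_neg, Real.norm_eq_abs, Nat.abs_cast,
          abs_of_pos hz, abs_of_nonneg h0]
      gcongr
  obtain ⟨K, hK⟩ := (tG (1/2)).bddAbove_range
  have hK' : ∀ n : ℕ, Real.GammaSeq (1/2) (n + 1) ^ β ≤ K := fun n => hK ⟨n, rfl⟩
  have hfC : ∀ n z, 0 < z → f n z ≤ 3 * |K| * z ^ (-(3/2) : ℝ) := by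
    intro n z hz
    refine (hfb n z hz).2.2.trans ?_
    have := (hK' n).trans (le_abs_self K)
    calc _ ≤ 3 * z ^ (-(3/2) : ℝ) * |K| := by gcongr
      _ = _ := by ring
  have hb : ∀ z, 0 < z → 0 ≤ auxF β z ∧ auxF β z ≤ 1 ∧
      auxF β z ≤ 3 * |K| * z ^ (-(3/2) : ℝ) := by
    intro z hz
    exact ⟨ge_of_tendsto' (hlim z hz) fun n => (hfb n z hz).1,
      le_of_tendsto' (hlim z hz) fun n => (hfb n z hz).2.1,
      le_of_tendsto' (hlim z hz) fun n => hfC n z hz⟩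
  set b : ℝ → ℝ := fun z => if z ≤ 1 then 1 else 3 * |K| * z ^ (-(3/2) : ℝ) with hbdef
  have hbi : IntegrableOn b (Ioi 0) := by
    rw [← Ioc_union_Ioi_eq_Ioi (zero_le_one' ℝ)]
    refine IntegrableOn.union ?_ ?_
    · have : IntegrableOn (fun _ : ℝ => (1:ℝ)) (Ioc 0 1) := by simp
      refine this.congr_fun (fun z hz => ?_) measurableSet_Ioc
      simp [hbdef, hz.2]
    · have : IntegrableOn (fun z : ℝ => 3 * |K| * z ^ (-(3/2) : ℝ)) (Ioi 1) :=
        (integrableOn_Ioi_rpow_of_lt (by norm_num) one_pos).const_mul _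
      refine this.congr_fun (fun z hz => ?_) measurableSet_Ioi
      have : ¬ z ≤ 1 := not_le.2 hz
      simp [hbdef, this]
  refine ⟨3 * |K|, by positivity, hb, ?_, ?_⟩
  · refine Integrable.mono' hbi (measurable_auxF hβ).aestronglyMeasurable ?_
    filter_upwards [ae_restrict_mem measurableSet_Ioi] with z hz
    rw [Real.norm_eq_abs, abs_of_nonneg (hb z hz).1]
    simp only [hbdef]
    split_ifs
    · exact (hb z hz).2.1
    · exact (hb z hz).2.2
  · have h1 : Tendsto (fun n => ∫ z in Ioi (0:ℝ), f n z) atTop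
        (𝓝 (∫ z in Ioi (0:ℝ), auxF β z)) := by
      refine tendsto_integral_of_dominated_convergence b
        (fun n => (hfm n).aestronglyMeasurable) hbi (fun n => ?_) ?_
      · filter_upwards [ae_restrict_mem measurableSet_Ioi] with z hz
        rw [Real.norm_eq_abs, abs_of_nonneg (hfb n z hz).1]
        simp only [hbdef]
        split_ifs
        · exact (hfb n z hz).2.1
        · exact hfC n z hz
      · filter_upwards [ae_restrict_mem measurableSet_Ioi] with z hz using hlim z hz
    have h2 := tG 1
    simp only [Real.Gamma_one, Real.one_rpow] at h2
    simp only [hfi] at h1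
    exact tendsto_nhds_unique h1 h2

lemma leRoy_repr {α : ℝ} (hα : α ∈ Ioo (0:ℝ) 1) {x : ℝ} (hx : 0 < x) :
    ∫ t in Ioi (0:ℝ), t ^ (-α) * Real.exp (-t) * auxF (1 - α) (x * Real.exp (-t)) =
      Real.Gamma (1 - α) * leRoy α (-x) := by
  have hβ : 1 - α ∈ Ioo (0:ℝ) 1 := ⟨by linarith [hα.2], by linarith [hα.1]⟩
  set A : ℕ → ℝ := fun m => (-x) ^ m / m.factorial * ((m + 1).factorial : ℝ) ^ (1 - α) with hA
  have hG := Real.Gamma_pos_of_pos hβ.1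
  have hm : ∀ m : ℕ, IntegrableOn (fun t : ℝ => t ^ (-α) * Real.exp (-(((m:ℝ) + 1) * t))) (Ioi 0) ∧
      ∫ t in Ioi (0:ℝ), t ^ (-α) * Real.exp (-(((m:ℝ) + 1) * t)) =
        ((m:ℝ) + 1) ^ (-(1 - α)) * Real.Gamma (1 - α) := by
    intro m
    have := integral_gam hβ.1 (r := (m:ℝ) + 1) (by positivity)
    rwa [show 1 - α - 1 = -α by ring] at this
  have hS := hasSum_integral_of_summable_integral_norm (μ := volume.restrict (Ioi (0:ℝ)))
      (F := fun (m : ℕ) (t : ℝ) => A m * (t ^ (-α) * Real.exp (-(((m:ℝ) + 1) * t))))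
      (fun m => (hm m).1.const_mul _) ?_
  · have e1 : ∫ t in Ioi (0:ℝ), t ^ (-α) * Real.exp (-t) * auxF (1 - α) (x * Real.exp (-t)) =
        ∫ t in Ioi (0:ℝ), ∑' m : ℕ, A m * (t ^ (-α) * Real.exp (-(((m:ℝ) + 1) * t))) := by
      refine integral_congr_ae (Eventually.of_forall fun t => ?_)
      simp only [auxF]
      rw [← tsum_mul_left]
      refine tsum_congr fun m => ?_
      rw [show -(((m:ℝ) + 1) * t) = -t + (m:ℝ) * (-t) by ring, Real.exp_add, Real.exp_nat_mul,
        ← neg_mul, mul_pow, hA]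
      ring
    rw [e1, ← hS.tsum_eq, leRoy, ← tsum_mul_left]
    refine tsum_congr fun m => ?_
    rw [integral_const_mul, (hm m).2, hA]
    simp only
    have hf : (0:ℝ) < m.factorial := by positivity
    have hm1 : (0:ℝ) < (m:ℝ) + 1 := by positivity
    rw [Nat.factorial_succ, Nat.cast_mul, Real.mul_rpow (by positivity) (by positivity),
      Real.rpow_neg hm1.le, Real.rpow_sub hf, Real.rpow_one]
    push_cast
    have : ((m:ℝ) + 1) ^ (1 - α) ≠ 0 := by positivity
    have : (m.factorial:ℝ) ^ α ≠ 0 := by positivity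
    field_simp
  · refine Summable.of_nonneg_of_le (fun m => by positivity) (fun m => ?_)
      ((summable_dom hβ x).mul_left (Real.Gamma (1 - α)))
    have e2 : ∫ t in Ioi (0:ℝ), ‖A m * (t ^ (-α) * Real.exp (-(((m:ℝ) + 1) * t)))‖ =
        |A m| * (((m:ℝ) + 1) ^ (-(1 - α)) * Real.Gamma (1 - α)) := by
      rw [← (hm m).2, ← integral_const_mul]
      refine setIntegral_congr_fun measurableSet_Ioi fun t ht => ?_
      have ht' : (0:ℝ) < t := ht
      have : 0 ≤ t ^ (-α) * Real.exp (-(((m:ℝ) + 1) * t)) := by positivity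
      simp only [norm_mul _ (_ * _), Real.norm_eq_abs, abs_of_nonneg this]
    rw [e2]
    have hle : ((m:ℝ) + 1) ^ (-(1 - α)) ≤ 1 :=
      Real.rpow_le_one_of_one_le_of_nonpos (by linarith [(Nat.cast_nonneg m : (0:ℝ) ≤ m)])
        (by linarith [hβ.1])
    have hAe : |A m| = x ^ m / m.factorial * ((m + 1).factorial : ℝ) ^ (1 - α) := by
      have h0 : (0:ℝ) ≤ ((m + 1).factorial : ℝ) ^ (1 - α) := by positivity
      simp only [hA, abs_mul, abs_div, abs_pow, abs_neg, Nat.abs_cast, abs_of_pos hx,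
        abs_of_nonneg h0]
    rw [← hAe]
    calc |A m| * (((m:ℝ) + 1) ^ (-(1 - α)) * Real.Gamma (1 - α))
        ≤ |A m| * (1 * Real.Gamma (1 - α)) := by gcongr
      _ = _ := by ring

lemma integral_exp_change {F : ℝ → ℝ} (hF : IntegrableOn F (Ioi 0)) :
    Integrable (fun s : ℝ => Real.exp (-s) * F (Real.exp (-s))) ∧
      ∫ s : ℝ, Real.exp (-s) * F (Real.exp (-s)) = ∫ z in Ioi (0:ℝ), F z := by
  have hd : ∀ x ∈ (univ : Set ℝ),
      HasDerivWithinAt (fun s : ℝ => Real.exp (-s)) (-Real.exp (-x)) univ x := by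
    intro x _
    have := ((hasDerivAt_neg x).exp).hasDerivWithinAt (s := univ)
    simpa using this
  have hi : InjOn (fun s : ℝ => Real.exp (-s)) univ := by
    intro a _ b _ h
    have := Real.exp_injective h
    linarith
  have him : (fun s : ℝ => Real.exp (-s)) '' univ = Ioi 0 := by
    ext y
    simp only [image_univ, mem_range, mem_Ioi]
    constructor
    · rintro ⟨s, rfl⟩; exact Real.exp_pos _
    · intro hy; exact ⟨-Real.log y, by rw [neg_neg, Real.exp_log hy]⟩
  constructor
  · have := (integrableOn_image_iff_integrableOn_abs_deriv_smul MeasurableSet.univ hd hi F).1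
      (by rwa [him])
    simpa using this
  · have := integral_image_eq_integral_abs_deriv_smul MeasurableSet.univ hd hi F
    rw [him] at this
    simpa using this.symm

lemma main_limit {α C : ℝ} (hα : α ∈ Ioo (0:ℝ) 1) {G : ℝ → ℝ} (hGm : Measurable G)
    (hG0 : ∀ s, 0 ≤ G s) (hGC : ∀ s, G s ≤ C * Real.exp (s / 2))
    (hGi : Integrable G) (hG1 : ∫ s, G s = 1) :
    Tendsto (fun l : ℝ => ∫ t in Ioi (0:ℝ), l ^ α * t ^ (-α) * G (t - l)) atTop (𝓝 1) := by
  have hC : 0 ≤ C := by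
    have := (hG0 0).trans (hGC 0)
    simpa using this
  have hα0 := hα.1
  have hα1 := hα.2
  -- first piece
  have hrp : ∀ a : ℝ, 0 ≤ a → IntegrableOn (fun t : ℝ => t ^ (-α)) (Ioc 0 a) ∧
      ∫ t in Ioc (0:ℝ) a, t ^ (-α) = a ^ (1 - α) / (1 - α) := by
    intro a ha
    constructor
    · rw [← intervalIntegrable_iff_integrableOn_Ioc_of_le ha]
      exact intervalIntegral.intervalIntegrable_rpow' (by linarith)
    · rw [← intervalIntegral.integral_of_le ha, integral_rpow (Or.inl (by linarith)),
        show -α + 1 = 1 - α by ring, Real.zero_rpow (by linarith), sub_zero]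
  have hb1 : ∀ l : ℝ, 0 < l → ∀ t ∈ Ioc (0:ℝ) (l / 2),
      l ^ α * t ^ (-α) * G (t - l) ≤ (l ^ α * (C * Real.exp (-(l / 4)))) * t ^ (-α) := by
    intro l hl t ht
    have ht0 : 0 < t := ht.1
    have : G (t - l) ≤ C * Real.exp (-(l / 4)) := by
      refine (hGC _).trans ?_
      gcongr
      linarith [ht.2]
    calc _ ≤ l ^ α * t ^ (-α) * (C * Real.exp (-(l / 4))) := by gcongr
      _ = _ := by ring
  have hn1 : ∀ l : ℝ, 0 < l → ∀ t, 0 < t → 0 ≤ l ^ α * t ^ (-α) * G (t - l) := by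
    intro l hl t ht
    have := hG0 (t - l)
    positivity
  have hmeas : ∀ l : ℝ, Measurable (fun t : ℝ => l ^ α * t ^ (-α) * G (t - l)) := by
    intro l; fun_prop
  have hi1 : ∀ l : ℝ, 0 < l →
      IntegrableOn (fun t : ℝ => l ^ α * t ^ (-α) * G (t - l)) (Ioc 0 (l / 2)) := by
    intro l hl
    refine Integrable.mono' ((hrp (l / 2) (by positivity)).1.const_mul
      (l ^ α * (C * Real.exp (-(l / 4))))) (hmeas l).aestronglyMeasurable ?_
    filter_upwards [ae_restrict_mem measurableSet_Ioc] with t ht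
    rw [Real.norm_eq_abs, abs_of_nonneg (hn1 l hl t ht.1)]
    exact hb1 l hl t ht
  have hT1 : Tendsto (fun l : ℝ => ∫ t in Ioc (0:ℝ) (l / 2), l ^ α * t ^ (-α) * G (t - l)) atTop
      (𝓝 0) := by
    have hup : Tendsto (fun l : ℝ => C / (1 - α) * (l ^ (1:ℝ) * Real.exp (-(1 / 4) * l))) atTop
        (𝓝 0) := by
      simpa using (tendsto_rpow_mul_exp_neg_mul_atTop_nhds_zero 1 (1 / 4)
        (by norm_num)).const_mul (C / (1 - α))
    refine tendsto_of_tendsto_of_tendsto_of_le_of_le' tendsto_const_nhds hup ?_ ?_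
    · filter_upwards [eventually_gt_atTop 0] with l hl
      exact setIntegral_nonneg measurableSet_Ioc fun t ht => hn1 l hl t ht.1
    · filter_upwards [eventually_gt_atTop 0] with l hl
      have h1α : 0 < 1 - α := by linarith
      calc ∫ t in Ioc (0:ℝ) (l / 2), l ^ α * t ^ (-α) * G (t - l)
          ≤ ∫ t in Ioc (0:ℝ) (l / 2), (l ^ α * (C * Real.exp (-(l / 4)))) * t ^ (-α) :=
            setIntegral_mono_on (hi1 l hl) ((hrp (l / 2) (by positivity)).1.const_mul _)
              measurableSet_Ioc (hb1 l hl)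
        _ = (l ^ α * (C * Real.exp (-(l / 4)))) * ((l / 2) ^ (1 - α) / (1 - α)) := by
            rw [integral_const_mul, (hrp (l / 2) (by positivity)).2]
        _ ≤ (l ^ α * (C * Real.exp (-(l / 4)))) * (l ^ (1 - α) / (1 - α)) := by
            gcongr
            linarith
        _ = (l ^ α * l ^ (1 - α)) * (C / (1 - α) * Real.exp (-(l / 4))) := by ring
        _ = C / (1 - α) * (l ^ (1:ℝ) * Real.exp (-(1 / 4) * l)) := by
            rw [← Real.rpow_add hl, show α + (1 - α) = 1 by ring,
              show -(l / 4) = -(1 / 4) * l by ring]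
            ring
  -- second piece
  set K : ℝ → ℝ → ℝ := fun l => (Ioi (-(l / 2))).indicator
    (fun s => l ^ α * (s + l) ^ (-α) * G s) with hKdef
  have hKm : ∀ l, Measurable (K l) := fun l =>
    Measurable.indicator (by fun_prop) measurableSet_Ioi
  have hKb : ∀ l : ℝ, 0 < l → ∀ s, ‖K l s‖ ≤ 2 * G s := by
    intro l hl s
    have g0 := hG0 s
    by_cases hs : s ∈ Ioi (-(l / 2))
    · have hs' : -(l / 2) < s := hs
      have hsl : 0 < s + l := by linarith
      simp only [hKdef, indicator_of_mem hs]
      rw [Real.norm_eq_abs, abs_of_nonneg (by positivity)]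
      have : l ^ α * (s + l) ^ (-α) ≤ 2 := by
        rw [Real.rpow_neg hsl.le, ← div_eq_mul_inv, ← Real.div_rpow hl.le hsl.le]
        calc (l / (s + l)) ^ α ≤ 2 ^ α := by
              gcongr
              rw [div_le_iff₀ hsl]; linarith
          _ ≤ 2 ^ (1:ℝ) := Real.rpow_le_rpow_of_exponent_le (by norm_num) hα1.le
          _ = 2 := by norm_num
      gcongr
    · simp only [hKdef, indicator_of_notMem hs]
      simp; exact g0
  have hT2 : Tendsto (fun l => ∫ s, K l s) atTop (𝓝 1) := by
    rw [← hG1]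
    refine tendsto_integral_filter_of_dominated_convergence (fun s => 2 * G s)
      (Eventually.of_forall fun l => (hKm l).aestronglyMeasurable) ?_ (hGi.const_mul 2) ?_
    · filter_upwards [eventually_gt_atTop 0] with l hl
      exact Eventually.of_forall (hKb l hl)
    · refine Eventually.of_forall fun s => ?_
      have t1 : Tendsto (fun l : ℝ => (1 + s * l⁻¹) ^ (-α)) atTop (𝓝 1) := by
        have : Tendsto (fun l : ℝ => 1 + s * l⁻¹) atTop (𝓝 (1 + s * 0)) :=
          tendsto_const_nhds.add (tendsto_inv_atTop_zero.const_mul s)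
        rw [mul_zero, add_zero] at this
        simpa using this.rpow_const (p := -α) (Or.inl one_ne_zero)
      have t2 := t1.mul_const (G s)
      rw [one_mul] at t2
      refine t2.congr' ?_
      filter_upwards [eventually_gt_atTop (2 * |s|)] with l hl
      have hl0 : 0 < l := lt_of_le_of_lt (by positivity) hl
      have hs : s ∈ Ioi (-(l / 2)) := by
        have := neg_abs_le s
        simp only [mem_Ioi]; linarith
      have hs' : -(l / 2) < s := hs
      have hsl : 0 < s + l := by linarith
      simp only [hKdef, indicator_of_mem hs]
      rw [show 1 + s * l⁻¹ = (s + l) / l by field_simp; ring, Real.div_rpow hsl.le hl0.le,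
        Real.rpow_neg hl0.le, div_inv_eq_mul]
      ring
  have hT := hT1.add hT2
  rw [zero_add] at hT
  refine hT.congr' ?_
  filter_upwards [eventually_gt_atTop 0] with l hl
  have hl2 : 0 ≤ l / 2 := by positivity
  have hsh : ∀ t, K l (t - l) = (Ioi (l / 2)).indicator
      (fun t => l ^ α * t ^ (-α) * G (t - l)) t := by
    intro t
    simp only [hKdef, indicator_apply, mem_Ioi, sub_add_cancel]
    have : -(l / 2) < t - l ↔ l / 2 < t := by constructor <;> intro h <;> linarith
    simp only [this]
  have hKi : Integrable (K l) :=
    Integrable.mono' (hGi.const_mul 2) (hKm l).aestronglyMeasurable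
      (Eventually.of_forall (hKb l hl))
  have hKi2 : Integrable (fun t => K l (t - l)) := hKi.comp_sub_right l
  simp only [hsh] at hKi2
  have hi2 := (integrable_indicator_iff measurableSet_Ioi).1 hKi2
  have e2 : ∫ s, K l s = ∫ t in Ioi (l / 2), l ^ α * t ^ (-α) * G (t - l) := by
    rw [← integral_sub_right_eq_self (K l) l]
    simp only [hsh]
    rw [integral_indicator measurableSet_Ioi]
  rw [e2, ← Ioc_union_Ioi_eq_Ioi hl2,
    setIntegral_union (Ioc_disjoint_Ioi le_rfl) measurableSet_Ioi (hi1 l hl) hi2]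

theorem leRoy_asymptotics_atTop (α : ℝ) (hα : α ∈ Set.Ioo (0 : ℝ) 1) :
    Tendsto (fun x : ℝ => x * Real.log x ^ α * leRoy α (-x)) atTop
      (nhds (1 / Real.Gamma (1 - α))) := by
  have hβ : 1 - α ∈ Ioo (0:ℝ) 1 := ⟨by linarith [hα.2], by linarith [hα.1]⟩
  have hG := Real.Gamma_pos_of_pos hβ.1
  obtain ⟨C, hC, hF, hFi, hF1⟩ := auxF_facts hβ
  obtain ⟨hi, he⟩ := integral_exp_change hFi
  rw [hF1] at he
  have hm := measurable_auxF hβ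
  have hlim := main_limit hα (C := C)
    (G := fun s => Real.exp (-s) * auxF (1 - α) (Real.exp (-s))) (by fun_prop)
    (fun s => mul_nonneg (Real.exp_pos _).le (hF _ (Real.exp_pos _)).1)
    (fun s => by
      calc Real.exp (-s) * auxF (1 - α) (Real.exp (-s))
          ≤ Real.exp (-s) * (C * Real.exp (-s) ^ (-(3/2) : ℝ)) := by
            gcongr
            exact (hF _ (Real.exp_pos _)).2.2
        _ = C * Real.exp (s / 2) := by
            rw [← Real.exp_mul, mul_left_comm, ← Real.exp_add]
            ring_nf) hi he
  have h2 := (hlim.comp Real.tendsto_log_atTop).div_const (Real.Gamma (1 - α))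
  refine h2.congr' ?_
  filter_upwards [eventually_gt_atTop 0] with x hx
  have hr := leRoy_repr hα hx
  simp only [Function.comp_apply]
  rw [div_eq_iff hG.ne', mul_assoc (x * _), mul_comm (leRoy _ _), ← hr, ← integral_const_mul]
  refine setIntegral_congr_fun measurableSet_Ioi fun t _ => ?_
  have : Real.exp (-(t - Real.log x)) = x * Real.exp (-t) := by
    rw [neg_sub, sub_eq_add_neg, Real.exp_add, Real.exp_log hx]
  simp only [this]
  ring
end

section
/- Let α > 0. There exists a probability measure μ on ℝ such that for every x ∈ ℝ the function t ↦ e^{xt} is μ-integrable with ∫ e^{xt} dμ(t) = L_α(x), if and only if α ≤ 1. -/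
open MeasureTheory

open Filter Topology NNReal ENNReal ProbabilityTheory

/-- `a` is the moment sequence of a probability measure on the nonnegative reals. -/
def IsStieltjes (a : ℕ → ℝ≥0) : Prop :=
  ∃ μ : ProbabilityMeasure ℝ≥0, ∀ n : ℕ, ∫⁻ x, (x : ℝ≥0∞) ^ n ∂(μ : Measure ℝ≥0) = a n

lemma IsStieltjes.mul {a b : ℕ → ℝ≥0} (ha : IsStieltjes a) (hb : IsStieltjes b) :
    IsStieltjes (fun n => a n * b n) := by
  obtain ⟨μ, hμ⟩ := ha
  obtain ⟨ν, hν⟩ := hb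
  have hm : Measurable (fun p : ℝ≥0 × ℝ≥0 => p.1 * p.2) := by fun_prop
  refine ⟨⟨((μ : Measure ℝ≥0).prod (ν : Measure ℝ≥0)).map (fun p => p.1 * p.2),
    Measure.isProbabilityMeasure_map hm.aemeasurable⟩, fun n => ?_⟩
  simp only [ProbabilityMeasure.coe_mk]
  rw [lintegral_map (by fun_prop) hm]
  simp only [ENNReal.coe_mul, mul_pow]
  rw [lintegral_prod_mul (f := fun x : ℝ≥0 => (x : ℝ≥0∞) ^ n) (g := fun x : ℝ≥0 => (x : ℝ≥0∞) ^ n)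
    (by fun_prop) (by fun_prop), hμ, hν]

lemma IsStieltjes.const_pow (c : ℝ≥0) : IsStieltjes (fun n => c ^ n) := by
  refine ⟨⟨Measure.dirac c, inferInstance⟩, fun n => ?_⟩
  simp

lemma IsStieltjes.prod {ι : Type*} (t : Finset ι) (a : ι → ℕ → ℝ≥0)
    (h : ∀ i ∈ t, IsStieltjes (a i)) : IsStieltjes (fun n => ∏ i ∈ t, a i n) := by
  classical
  induction t using Finset.induction_on with
  | empty => simpa using IsStieltjes.const_pow 1
  | insert i t hi ih =>
    simp only [Finset.prod_insert hi]
    exact (h i (by simp)).mul (ih fun j hj => h j (by simp [hj]))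

lemma IsStieltjes.gamma {s : ℝ} (hs : 0 < s) {k : ℝ≥0} (hk : 0 < k) :
    IsStieltjes (fun n => (k / (k + n)) ^ s) := by
  have hk' : (0:ℝ) < k := by exact_mod_cast hk
  have := isProbabilityMeasure_gammaMeasure hs hk'
  have hm : Measurable (fun x : ℝ => Real.toNNReal (Real.exp (-x))) := by fun_prop
  refine ⟨⟨(gammaMeasure s k).map (fun x => Real.toNNReal (Real.exp (-x))),
    Measure.isProbabilityMeasure_map hm.aemeasurable⟩, fun n => ?_⟩
  simp only [ProbabilityMeasure.coe_mk]
  rw [lintegral_map (by fun_prop) hm, gammaMeasure, lintegral_withDensity_eq_lintegral_mul _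
    (by unfold gammaPDF; exact (measurable_gammaPDFReal _ _).ennreal_ofReal) (by fun_prop)]
  have hkn : (0:ℝ) < k + n := by positivity
  have key : ∀ x : ℝ, (gammaPDF s k * fun x : ℝ => ((Real.toNNReal (Real.exp (-x)) : ℝ≥0) : ℝ≥0∞) ^ n) x
      = (((k / (k + n)) ^ s : ℝ≥0) : ℝ≥0∞) * gammaPDF s (k + n) x := by
    intro x
    rcases lt_or_ge x 0 with hx | hx
    · simp [gammaPDF_of_neg hx]
    · have hG := Real.Gamma_pos_of_pos hs
      have e : (((k / (k + n)) ^ s : ℝ≥0) : ℝ≥0∞) = ENNReal.ofReal (((k:ℝ) / (k + n)) ^ s) := by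
        rw [ENNReal.ofReal, ENNReal.coe_inj]
        ext
        rw [Real.coe_toNNReal _ (by positivity)]
        simp
      have e2 : ((Real.toNNReal (Real.exp (-x)) : ℝ≥0) : ℝ≥0∞) ^ n
        = ENNReal.ofReal (Real.exp (-(n * x))) := by
        rw [← ENNReal.ofReal, ← ENNReal.ofReal_pow (Real.exp_pos _).le, ← Real.exp_nat_mul]
        congr 2; ring
      rw [Pi.mul_apply, gammaPDF_of_nonneg hx, gammaPDF_of_nonneg hx, e, e2,
        ← ENNReal.ofReal_mul (by positivity), ← ENNReal.ofReal_mul (by positivity)]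
      congr 1
      rw [Real.div_rpow hk'.le hkn.le, add_mul, neg_add, Real.exp_add]
      have : ((k:ℝ) + n) ^ s ≠ 0 := by positivity
      field_simp
  rw [lintegral_congr key, lintegral_const_mul _ 
    (by unfold gammaPDF; exact (measurable_gammaPDFReal _ _).ennreal_ofReal),
    lintegral_gammaPDF_eq_one hs hkn, mul_one]

lemma IsStieltjes.lim {a : ℕ → ℕ → ℝ≥0} {b : ℕ → ℝ≥0} (ha : ∀ j, IsStieltjes (a j))
    (hab : ∀ n, Tendsto (fun j => a j n) atTop (𝓝 (b n))) : IsStieltjes b := by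
  choose μ hμ using ha
  obtain ⟨C, hC⟩ := (hab 1).bddAbove_range
  have hC : ∀ j, a j 1 ≤ C := fun j => hC ⟨j, rfl⟩
  have hcomp : IsCompact {μ : ProbabilityMeasure ℝ≥0 |
      ∀ N : ℕ, μ (Set.Icc 0 ((N:ℝ≥0) + 1))ᶜ ≤ C / ((N:ℝ≥0) + 1)} := by
    refine isCompact_setOfPred_probabilityMeasure_mass_eq_compl_isCompact_le ?_
      (fun N => isCompact_Icc) (Or.inl inferInstance)
    have := (tendsto_const_div_atTop_nhds_zero_nat (C:ℝ)).comp (tendsto_add_atTop_nat 1)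
    rw [← NNReal.tendsto_coe]
    refine this.congr fun N => ?_
    simp
  have hmem : ∀ j, μ j ∈ {μ : ProbabilityMeasure ℝ≥0 |
      ∀ N : ℕ, μ (Set.Icc 0 ((N:ℝ≥0) + 1))ᶜ ≤ C / ((N:ℝ≥0) + 1)} := by
    intro j N
    rw [← ENNReal.coe_le_coe, ProbabilityMeasure.ennreal_coeFn_eq_coeFn_toMeasure,
      ENNReal.coe_div (by positivity)]
    rw [ENNReal.le_div_iff_mul_le (Or.inl (by simp)) (Or.inl (by simp)), mul_comm]
    calc _ ≤ ((N + 1 : ℝ≥0) : ℝ≥0∞) * (μ j : Measure ℝ≥0) {x | ((N + 1 : ℝ≥0) : ℝ≥0∞) ≤ (x:ℝ≥0∞) ^ 1} := by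
          gcongr
          intro x hx
          simp only [Set.mem_compl_iff, Set.mem_Icc, zero_le, true_and, not_le] at hx
          simpa using (by exact_mod_cast hx.le : ((N + 1 : ℝ≥0) : ℝ≥0∞) ≤ x)
      _ ≤ ∫⁻ x, (x : ℝ≥0∞) ^ 1 ∂(μ j : Measure ℝ≥0) := mul_meas_ge_le_lintegral (by fun_prop) _
      _ = a j 1 := hμ j 1
      _ ≤ C := by exact_mod_cast hC j
  obtain ⟨ν, -, hν⟩ := hcomp.ultrafilter_le_nhds ((hyperfilter ℕ).map μ) (by
    rw [le_principal_iff]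
    exact Eventually.of_forall (f := (hyperfilter ℕ : Filter ℕ)) hmem)
  have hU : ((hyperfilter ℕ : Ultrafilter ℕ) : Filter ℕ) ≤ atTop := Nat.hyperfilter_le_atTop
  have hν' : Tendsto μ (hyperfilter ℕ : Filter ℕ) (𝓝 ν) := hν
  rw [ProbabilityMeasure.tendsto_iff_forall_lintegral_tendsto] at hν'
  have hab' : ∀ n, Tendsto (fun j => (a j n : ℝ≥0∞)) (hyperfilter ℕ : Filter ℕ) (𝓝 (b n)) :=
    fun n => ENNReal.tendsto_coe.2 ((hab n).mono_left hU)
  let F : ℕ → ℕ → BoundedContinuousFunction ℝ≥0 ℝ≥0 := fun n K =>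
    BoundedContinuousFunction.mkOfBound ⟨fun x => min (x ^ n) (K:ℝ≥0), by fun_prop⟩ K (by
      intro x y
      have h1 : ((min (x ^ n) (K:ℝ≥0) : ℝ≥0) : ℝ) ≤ K := by exact_mod_cast min_le_right _ _
      have h2 : ((min (y ^ n) (K:ℝ≥0) : ℝ≥0) : ℝ) ≤ K := by exact_mod_cast min_le_right _ _
      have h3 := (min (x ^ n) (K:ℝ≥0)).coe_nonneg
      have h4 := (min (y ^ n) (K:ℝ≥0)).coe_nonneg
      simp only [ContinuousMap.coe_mk, NNReal.dist_eq]
      rw [abs_le]; constructor <;> linarith)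
  have hF : ∀ n K x, F n K x = min (x ^ n) (K:ℝ≥0) := fun n K x => rfl
  have hFle : ∀ n K x, (F n K x : ℝ≥0∞) ≤ (x : ℝ≥0∞) ^ n := fun n K x => by
    rw [hF]; exact_mod_cast min_le_left _ _
  refine ⟨ν, fun n => le_antisymm ?_ ?_⟩
  · have hsup : ∀ x : ℝ≥0, (x : ℝ≥0∞) ^ n = ⨆ K, (F n K x : ℝ≥0∞) := by
      intro x
      refine le_antisymm ?_ (iSup_le fun K => hFle n K x)
      obtain ⟨K, hK⟩ := exists_nat_ge (x ^ n)
      refine le_iSup_of_le K ?_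
      rw [hF, min_eq_left hK]; simp
    rw [lintegral_congr hsup, lintegral_iSup]
    · refine iSup_le fun K => le_of_tendsto_of_tendsto' (hν' (F n K)) (hab' n) fun j => ?_
      rw [← hμ j n]
      exact lintegral_mono (hFle n K)
    · intro K
      exact (F n K).continuous.measurable.coe_nnreal_ennreal
    · intro K L hKL x
      simp only [hF]
      have : (K:ℝ≥0) ≤ L := by exact_mod_cast hKL
      exact_mod_cast min_le_min le_rfl this
  · have hK : ∀ K : ℕ, (b n : ℝ≥0∞) ≤ ∫⁻ x, (x : ℝ≥0∞) ^ n ∂(ν : Measure ℝ≥0)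
        + ((K + 1 : ℕ) : ℝ≥0∞)⁻¹ * b (2 * n) := by
      intro K
      have h1 : Tendsto (fun j => ∫⁻ x, F n (K+1) x ∂(μ j : Measure ℝ≥0)
          + ((K + 1 : ℕ) : ℝ≥0∞)⁻¹ * a j (2 * n)) (hyperfilter ℕ : Filter ℕ)
          (𝓝 (∫⁻ x, F n (K+1) x ∂(ν : Measure ℝ≥0) + ((K + 1 : ℕ) : ℝ≥0∞)⁻¹ * b (2 * n))) :=
        (hν' _).add (ENNReal.Tendsto.const_mul (hab' _) (Or.inr (by simp)))
      refine (le_of_tendsto_of_tendsto' (hab' n) h1 fun j => ?_).trans ?_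
      · rw [← hμ j n, ← hμ j (2 * n), ← lintegral_const_mul _ (by fun_prop),
          ← lintegral_add_right _ (by fun_prop)]
        refine lintegral_mono fun x => ?_
        have : x ^ n ≤ F n (K+1) x + ((K + 1 : ℕ) : ℝ≥0)⁻¹ * x ^ (2 * n) := by
          rw [hF]
          rcases le_total (x ^ n) ((K + 1 : ℕ) : ℝ≥0) with h | h
          · rw [min_eq_left h]; exact le_self_add
          · refine le_trans ?_ le_add_self
            rw [two_mul, pow_add, ← mul_assoc]
            refine le_mul_of_one_le_left zero_le ?_
            have h0 : (0:ℝ≥0) < ((K + 1 : ℕ) : ℝ≥0) := by positivity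
            calc (1:ℝ≥0) = ((K + 1 : ℕ) : ℝ≥0)⁻¹ * ((K + 1 : ℕ) : ℝ≥0) := (inv_mul_cancel₀ h0.ne').symm
              _ ≤ _ := by gcongr
        have h2 := ENNReal.coe_le_coe.2 this
        rw [ENNReal.coe_add, ENNReal.coe_mul, ENNReal.coe_inv (by positivity)] at h2
        simpa using h2
      · gcongr with x
        exact hFle n _ x
    have h2 : Tendsto (fun K : ℕ => ∫⁻ x, (x : ℝ≥0∞) ^ n ∂(ν : Measure ℝ≥0)
        + ((K + 1 : ℕ) : ℝ≥0∞)⁻¹ * b (2 * n)) atTop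
        (𝓝 (∫⁻ x, (x : ℝ≥0∞) ^ n ∂(ν : Measure ℝ≥0) + 0 * b (2 * n))) :=
      tendsto_const_nhds.add (ENNReal.Tendsto.mul_const
        (ENNReal.tendsto_inv_nat_nhds_zero.comp (tendsto_add_atTop_nat 1)) (Or.inr (by simp)))
    simpa using ge_of_tendsto' h2 hK

lemma isStieltjes_factorial {s : ℝ} (hs : 0 ≤ s) :
    IsStieltjes (fun n => (n.factorial : ℝ≥0) ^ s) := by
  rcases hs.eq_or_lt with rfl | hs
  · simpa using IsStieltjes.const_pow 1
  refine IsStieltjes.lim (a := fun m n => ((m : ℝ≥0) ^ s) ^ n *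
    ∏ k ∈ Finset.range (m + 1), (((k + 1 : ℝ≥0)) / ((k + 1 : ℝ≥0) + n)) ^ s) ?_ ?_
  · intro m
    exact (IsStieltjes.const_pow _).mul (IsStieltjes.prod _ _ fun k _ => IsStieltjes.gamma hs
      (by positivity))
  · intro n
    have h1 : Tendsto (fun m : ℕ => (m : ℝ≥0) ^ n *
        ∏ k ∈ Finset.range (m + 1), (((k + 1 : ℝ≥0)) / ((k + 1 : ℝ≥0) + n))) atTop
        (𝓝 (n.factorial : ℝ≥0)) := by
      rw [← NNReal.tendsto_coe]
      have hG := Real.GammaSeq_tendsto_Gamma (n + 1)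
      rw [Real.Gamma_nat_eq_factorial] at hG
      have hq : Tendsto (fun m : ℕ => 1 + 1 / (m:ℝ)) atTop (𝓝 (1 + 0)) :=
        tendsto_const_nhds.add tendsto_one_div_atTop_nhds_zero_nat
      have := hG.mul hq
      simp only [add_zero, mul_one, NNReal.coe_natCast] at this ⊢
      refine this.congr' ?_
      filter_upwards [eventually_gt_atTop 0] with m hm
      have hm' : (m:ℝ) ≠ 0 := by positivity
      push_cast
      rw [Real.GammaSeq, Finset.prod_div_distrib]
      have e1 : ∏ k ∈ Finset.range (m + 1), ((k:ℝ) + 1) = ((m + 1).factorial : ℝ) := by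
        rw [← Finset.prod_range_add_one_eq_factorial]; push_cast; rfl
      have e2 : ∏ k ∈ Finset.range (m + 1), ((k:ℝ) + 1 + n)
          = ∏ k ∈ Finset.range (m + 1), ((n:ℝ) + 1 + k) :=
        Finset.prod_congr rfl fun k _ => by ring
      have e3 : ∏ k ∈ Finset.range (m + 1), ((n:ℝ) + 1 + k) ≠ 0 := by positivity
      rw [e1, e2, Nat.factorial_succ]
      have e4 : (m:ℝ) ^ ((n:ℝ) + 1) = (m:ℝ) ^ n * m := by
        rw [Real.rpow_add_one hm', Real.rpow_natCast]
      rw [e4]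
      push_cast
      field_simp
    have h2 := ((NNReal.continuous_rpow_const hs.le).tendsto _).comp h1
    refine h2.congr fun m => ?_
    simp only [Function.comp_apply]
    rw [NNReal.mul_rpow, NNReal.finsetProd_rpow]
    congr 1
    rw [← NNReal.rpow_natCast, ← NNReal.rpow_mul, ← NNReal.rpow_natCast, ← NNReal.rpow_mul, mul_comm]

lemma ratio_tendsto {α : ℝ} (hα : 0 < α) :
    Tendsto (fun n : ℕ => ‖(1 / ((n.succ).factorial : ℝ) ^ α : ℝ)‖ / ‖(1 / (n.factorial : ℝ) ^ α : ℝ)‖)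
      atTop (𝓝 0) := by
  have h : Tendsto (fun n : ℕ => ((n + 1 : ℕ) : ℝ) ^ (-α)) atTop (𝓝 0) :=
    (tendsto_rpow_neg_atTop hα).comp (tendsto_natCast_atTop_atTop.comp (tendsto_add_atTop_nat 1))
  refine h.congr fun n => ?_
  have h0 : (0:ℝ) < (n.factorial : ℝ) ^ α := Real.rpow_pos_of_pos (by positivity) _
  have h1 : (0:ℝ) < ((n + 1 : ℕ) : ℝ) ^ α := Real.rpow_pos_of_pos (by positivity) _
  rw [Nat.succ_eq_add_one, Nat.factorial_succ, Nat.cast_mul,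
    Real.mul_rpow (by positivity) (by positivity), Real.rpow_neg (by positivity),
    Real.norm_of_nonneg (by positivity), Real.norm_of_nonneg (by positivity)]
  field_simp

lemma radius_top {α : ℝ} (hα : 0 < α) :
    (FormalMultilinearSeries.ofScalars ℝ (fun n : ℕ => (1 / (n.factorial : ℝ) ^ α : ℝ))).radius = ⊤ := by
  refine FormalMultilinearSeries.ofScalars_radius_eq_top_of_tendsto _ _ ?_ (ratio_tendsto hα)
  refine Eventually.of_forall fun n => ?_
  have h0 : (0:ℝ) < (n.factorial : ℝ) ^ α := Real.rpow_pos_of_pos (by positivity) _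
  positivity

lemma leRoy_series {α : ℝ} (hα : 0 < α) : HasFPowerSeriesAt (leRoy α)
    (FormalMultilinearSeries.ofScalars ℝ (fun n : ℕ => (1 / (n.factorial : ℝ) ^ α : ℝ))) 0 := by
  have h := FormalMultilinearSeries.hasFPowerSeriesOnBall _ (by rw [radius_top hα]; simp :
    0 < (FormalMultilinearSeries.ofScalars ℝ (fun n : ℕ => (1 / (n.factorial : ℝ) ^ α : ℝ))).radius)
  have e : leRoy α = (FormalMultilinearSeries.ofScalars ℝ
      (fun n : ℕ => (1 / (n.factorial : ℝ) ^ α : ℝ))).sum := by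
    funext x
    refine Eq.trans ?_ (FormalMultilinearSeries.ofScalars_sum_eq _ x).symm
    exact tsum_congr fun n => by simp [div_eq_inv_mul]
  rw [e]
  exact h.hasFPowerSeriesAt

lemma leRoy_summable {α : ℝ} (hα : 0 < α) (x : ℝ) (hx : 0 ≤ x) :
    Summable (fun n : ℕ => x ^ n / (n.factorial : ℝ) ^ α) := by
  have := FormalMultilinearSeries.summable_norm_mul_pow _ (r := Real.toNNReal x)
    (by rw [radius_top hα]; simp)
  refine this.congr fun n => ?_
  have h0 : (0:ℝ) < (n.factorial : ℝ) ^ α := Real.rpow_pos_of_pos (by positivity) _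
  rw [FormalMultilinearSeries.ofScalars_norm, Real.norm_of_nonneg (by positivity)]
  simp [div_eq_inv_mul, Real.coe_toNNReal x hx]

lemma forward {α : ℝ} (hα : 0 < α) (μ : Measure ℝ) [IsProbabilityMeasure μ]
    (h : ∀ x : ℝ, Integrable (fun t => Real.exp (x * t)) μ ∧
        ∫ t, Real.exp (x * t) ∂μ = leRoy α x) : α ≤ 1 := by
  have hset : integrableExpSet (id : ℝ → ℝ) μ = Set.univ :=
    Set.eq_univ_of_forall fun x => (h x).1
  have h0 : (0:ℝ) ∈ interior (integrableExpSet (id : ℝ → ℝ) μ) := by simp [hset]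
  have hm : mgf id μ = leRoy α := funext fun x => (h x).2
  have hs := hasFPowerSeriesAt_mgf h0
  rw [hm] at hs
  have heq := FormalMultilinearSeries.ofScalars_series_injective ℝ ℝ
    (hs.eq_formalMultilinearSeries (leRoy_series hα))
  have e1 := congrFun heq 1
  have e2 := congrFun heq 2
  simp at e1 e2
  have i1 : Integrable (fun t : ℝ => t) μ := by
    simpa using integrable_pow_of_mem_interior_integrableExpSet h0 1
  have i2 : Integrable (fun t : ℝ => t ^ 2) μ := by
    simpa using integrable_pow_of_mem_interior_integrableExpSet h0 2
  have hnn : 0 ≤ ∫ t, (t - 1) ^ 2 ∂μ := integral_nonneg fun t => sq_nonneg _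
  have hexp : ∫ t, (t - 1) ^ 2 ∂μ = ∫ t, t ^ 2 ∂μ - 2 * ∫ t, t ∂μ + 1 := by
    have : ∀ t : ℝ, (t - 1) ^ 2 = t ^ 2 - 2 * t + 1 := fun t => by ring
    simp_rw [this]
    rw [integral_add (f := fun t : ℝ => t ^ 2 - 2 * t) (g := fun _ => (1:ℝ))
        (i2.sub (i1.const_mul 2)) (integrable_const _),
      integral_sub i2 (i1.const_mul 2), integral_const_mul]
    simp
  by_contra hc
  push Not at hc
  have h2 : (2:ℝ) < 2 ^ α := by
    simpa using Real.rpow_lt_rpow_of_exponent_lt (by norm_num : (1:ℝ) < 2) hc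
  have h3 : ((2:ℝ) ^ α)⁻¹ < 2⁻¹ := inv_strictAnti₀ (by norm_num) h2
  rw [hexp, e1] at hnn
  linarith

lemma backward {α : ℝ} (hα : 0 < α) (h1 : α ≤ 1) : ∃ μ : Measure ℝ, IsProbabilityMeasure μ ∧
      ∀ x : ℝ, Integrable (fun t => Real.exp (x * t)) μ ∧
        ∫ t, Real.exp (x * t) ∂μ = leRoy α x := by
  obtain ⟨ν, hν⟩ := isStieltjes_factorial (s := 1 - α) (by linarith)
  have hc : Measurable (fun t : ℝ≥0 => (t : ℝ)) := by fun_prop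
  refine ⟨(ν : Measure ℝ≥0).map (fun t : ℝ≥0 => (t : ℝ)),
    Measure.isProbabilityMeasure_map hc.aemeasurable, fun x => ?_⟩
  rw [integrable_map_measure (by fun_prop) hc.aemeasurable,
    integral_map hc.aemeasurable (by fun_prop)]
  have hmom : ∀ n : ℕ, Integrable (fun t : ℝ≥0 => (t:ℝ) ^ n) (ν : Measure ℝ≥0) ∧
      ∫ t : ℝ≥0, (t:ℝ) ^ n ∂(ν : Measure ℝ≥0) = (n.factorial : ℝ) ^ (1 - α) := by
    intro n
    have e : ∫⁻ t : ℝ≥0, ENNReal.ofReal ((t:ℝ) ^ n) ∂(ν : Measure ℝ≥0)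
        = (((n.factorial : ℝ≥0) ^ (1 - α) : ℝ≥0) : ℝ≥0∞) := by
      rw [← hν n]
      refine lintegral_congr fun t => ?_
      rw [ENNReal.ofReal_pow t.coe_nonneg, ENNReal.ofReal_coe_nnreal]
    constructor
    · refine ⟨by fun_prop, ?_⟩
      rw [hasFiniteIntegral_iff_ofReal (Eventually.of_forall fun t => by positivity), e]
      exact ENNReal.coe_lt_top
    · rw [integral_eq_lintegral_of_nonneg_ae (Eventually.of_forall fun t => by positivity)
        (by fun_prop), e]
      simp
  have hfac : ∀ n : ℕ, (n.factorial : ℝ) ^ (1 - α) / n.factorial = 1 / (n.factorial : ℝ) ^ α := by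
    intro n
    have hp : (0:ℝ) < n.factorial := by positivity
    have h0 : (0:ℝ) < (n.factorial : ℝ) ^ α := Real.rpow_pos_of_pos hp _
    rw [Real.rpow_sub hp, Real.rpow_one]
    field_simp
  let F : ℝ → ℕ → ℝ≥0 → ℝ := fun y n t => y ^ n / n.factorial * (t:ℝ) ^ n
  have hFi : ∀ y n, Integrable (F y n) (ν : Measure ℝ≥0) := fun y n => (hmom n).1.const_mul _
  have hFv : ∀ y n, ∫ t, F y n t ∂(ν : Measure ℝ≥0) = y ^ n / (n.factorial : ℝ) ^ α := by
    intro y n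
    simp only [F]
    rw [integral_const_mul, (hmom n).2, div_mul_eq_mul_div, mul_div_assoc, hfac, mul_one_div]
  have hFs : ∀ (y : ℝ) (t : ℝ≥0), HasSum (fun n => F y n t) (Real.exp (y * t)) := by
    intro y t
    rw [Real.exp_eq_exp_ℝ]
    have h := NormedSpace.expSeries_div_hasSum_exp (y * (t:ℝ))
    have e : (fun n => F y n t) = fun n : ℕ => (y * (t:ℝ)) ^ n / (n.factorial : ℝ) := by
      funext n
      simp only [F, mul_pow]
      ring
    rw [e]
    exact h
  have hnorm : ∀ y n t, ‖F y n t‖ = F |y| n t := by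
    intro y n t
    simp [F, abs_mul, abs_div]
  have hsum : Summable fun n => ∫ t, ‖F x n t‖ ∂(ν : Measure ℝ≥0) := by
    simp only [hnorm, hFv]
    exact leRoy_summable hα _ (abs_nonneg x)
  have hint : Integrable (fun t : ℝ≥0 => Real.exp (|x| * t)) (ν : Measure ℝ≥0) := by
    refine ⟨by fun_prop, ?_⟩
    rw [hasFiniteIntegral_iff_ofReal (Eventually.of_forall fun t => by positivity)]
    have e : ∀ t : ℝ≥0, ENNReal.ofReal (Real.exp (|x| * t))
        = ∑' n, ENNReal.ofReal (F |x| n t) := by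
      intro t
      rw [← (hFs |x| t).tsum_eq, ENNReal.ofReal_tsum_of_nonneg (fun n => by positivity)
        (hFs |x| t).summable]
    rw [lintegral_congr e, lintegral_tsum (fun n => by fun_prop)]
    have e' : ∀ n, ∫⁻ t, ENNReal.ofReal (F |x| n t) ∂(ν : Measure ℝ≥0)
        = ENNReal.ofReal (∫ t, ‖F x n t‖ ∂(ν : Measure ℝ≥0)) := by
      intro n
      simp only [hnorm]
      rw [ofReal_integral_eq_lintegral_ofReal (hFi _ _)
        (Eventually.of_forall fun t => by positivity)]
    simp only [e']
    rw [← ENNReal.ofReal_tsum_of_nonneg (fun n => integral_nonneg fun t => norm_nonneg _) hsum]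
    exact ENNReal.ofReal_lt_top
  constructor
  · refine hint.mono' (by fun_prop) (Eventually.of_forall fun t => ?_)
    simp only [Function.comp_apply, Real.norm_eq_abs, Real.abs_exp]
    have := le_abs_self x
    gcongr
  · have := hasSum_integral_of_summable_integral_norm (hFi x) hsum
    rw [leRoy, ← tsum_congr (hFv x), this.tsum_eq]
    exact integral_congr_ae (Eventually.of_forall fun t => (hFs x t).tsum_eq.symm)

theorem leRoy_is_mgf_iff (α : ℝ) (hα : 0 < α) :
    (∃ μ : Measure ℝ, IsProbabilityMeasure μ ∧
      ∀ x : ℝ, Integrable (fun t => Real.exp (x * t)) μ ∧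
        ∫ t, Real.exp (x * t) ∂μ = leRoy α x) ↔ α ≤ 1 := by
  constructor
  · rintro ⟨μ, hμ, h⟩
    exact forward hα μ h
  · exact backward hα
end
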